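/- arXiv:1811.05593 — 2 statements merged into one kernel-verified Lean document; each statement's English description precedes it below -/
import Mathlib

section
/- Let (H,R) be a finite-dimensional semisimple and cosemisimple quasi-triangular Hopf algebra over a field k, D a minimal H-adjoint-stable subcoalgebra of H_R, and W a finite-dimensional nonzero left D-comodule. Then the R-adjoint-stable algebra N_W = W* □_D (H⊗W) is a semisimple k-algebra, and the functors W* □_D • : _H^D M → M_{N_W} and • ⊗_{N_W} (H⊗W) : M_{N_W} → _H^D M establish an equivalence between _H^D M and the category M_{N_W} of right N_W-modules. -/
open TensorProduct LinearMap

variable (K : Type) [Field K] (H : Type) [Ring H] [HopfAlgebra K H]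

/-- The left adjoint action as a linear map `H ⊗ H →ₗ H`, `h ⊗ a ↦ Σ h₍₁₎ * a * S(h₍₂₎)`. -/
noncomputable def adMap : H ⊗[K] H →ₗ[K] H :=
  (LinearMap.mul' K H) ∘ₗ
    (LinearMap.lTensor H ((LinearMap.mul' K H) ∘ₗ
      (LinearMap.lTensor H (HopfAlgebra.antipode (R := K))) ∘ₗ
      (TensorProduct.comm K H H).toLinearMap)) ∘ₗ
    (TensorProduct.assoc K H H H).toLinearMap ∘ₗ
    (LinearMap.rTensor H (Coalgebra.comul (R := K)))

/-- `h ·_ad a = Σ h₍₁₎ a S(h₍₂₎)`. -/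
noncomputable def adAct (h a : H) : H := adMap K H (h ⊗ₜ a)

/-- `R¹² = Σ r¹ ⊗ r² ⊗ 1` in `H ⊗ (H ⊗ H)`. -/
noncomputable def r12 (R : H ⊗[K] H) : H ⊗[K] (H ⊗[K] H) :=
  TensorProduct.map LinearMap.id ((TensorProduct.mk K H H).flip 1) R

/-- `R¹³ = Σ r¹ ⊗ 1 ⊗ r²` in `H ⊗ (H ⊗ H)`. -/
noncomputable def r13 (R : H ⊗[K] H) : H ⊗[K] (H ⊗[K] H) :=
  TensorProduct.map LinearMap.id (TensorProduct.mk K H H 1) R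

/-- `R²³ = 1 ⊗ R` in `H ⊗ (H ⊗ H)`. -/
noncomputable def r23 (R : H ⊗[K] H) : H ⊗[K] (H ⊗[K] H) := (1 : H) ⊗ₜ R

/-- `(H,R)` is a quasi-triangular Hopf algebra: `R` is invertible,
`R Δ(h) = Δᶜᵒᵖ(h) R`, `(Δ⊗id)(R) = R¹³R²³` and `(id⊗Δ)(R) = R¹³R¹²`. -/
structure IsQuasiTriangular (R : H ⊗[K] H) : Prop where
  isUnit : IsUnit R
  intertwine : ∀ h : H, R * Coalgebra.comul h =
    (TensorProduct.comm K H H) (Coalgebra.comul h) * R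
  comul_rTensor : (TensorProduct.assoc K H H H)
      ((LinearMap.rTensor H (Coalgebra.comul (R := K))) R) = r13 K H R * r23 K H R
  comul_lTensor : (LinearMap.lTensor H (Coalgebra.comul (R := K))) R = r13 K H R * r12 K H R

/-- The comultiplication `Δ_R` of the transmuted braided group `H_R`:
`Δ_R(h) = Σ h₍₁₎ S(R²) ⊗ R¹ ·_ad h₍₂₎`. -/
noncomputable def deltaR (R : H ⊗[K] H) : H →ₗ[K] H ⊗[K] H :=
  (TensorProduct.map
      ((LinearMap.mul' K H) ∘ₗ (LinearMap.lTensor H (HopfAlgebra.antipode (R := K))))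
      ((adMap K H) ∘ₗ (TensorProduct.comm K H H).toLinearMap)) ∘ₗ
    (TensorProduct.tensorTensorTensorComm K H H H H).toLinearMap ∘ₗ
    (LinearMap.lTensor (H ⊗[K] H) (TensorProduct.comm K H H).toLinearMap) ∘ₗ
    ((TensorProduct.mk K (H ⊗[K] H) (H ⊗[K] H)).flip R) ∘ₗ
    (Coalgebra.comul (R := K))

/-- A subcoalgebra of `(H, Δ)`. -/
def IsSubcoalgebra (D : Submodule K H) : Prop :=
  ∀ a ∈ D, Coalgebra.comul (R := K) a ∈ Submodule.map₂ (TensorProduct.mk K H H) D D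

/-- A simple (nonzero, minimal) subcoalgebra of `(H, Δ)`. -/
def IsSimpleSubcoalgebra (D : Submodule K H) : Prop :=
  D ≠ ⊥ ∧ IsSubcoalgebra K H D ∧
    ∀ D' : Submodule K H, D' ≤ D → IsSubcoalgebra K H D' → D' = ⊥ ∨ D' = D

/-- `H` is a cosemisimple coalgebra: the sum of its simple subcoalgebras is everything. -/
def IsCosemisimpleCoalgebra : Prop :=
  sSup {D : Submodule K H | IsSimpleSubcoalgebra K H D} = ⊤

/-- A subcoalgebra of the transmuted braided group `(H, Δ_R)`. -/
def IsSubcoalgebraR (R : H ⊗[K] H) (D : Submodule K H) : Prop :=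
  ∀ a ∈ D, deltaR K H R a ∈ Submodule.map₂ (TensorProduct.mk K H H) D D

/-- A simple (nonzero, minimal) subcoalgebra of `(H, Δ_R)`. -/
def IsSimpleSubcoalgebraR (R : H ⊗[K] H) (D : Submodule K H) : Prop :=
  D ≠ ⊥ ∧ IsSubcoalgebraR K H R D ∧
    ∀ D' : Submodule K H, D' ≤ D → IsSubcoalgebraR K H R D' → D' = ⊥ ∨ D' = D

/-- The coalgebra `(H, Δ_R)` is cosemisimple: it is the sum of its simple subcoalgebras. -/
def IsCosemisimpleR (R : H ⊗[K] H) : Prop :=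
  sSup {D : Submodule K H | IsSimpleSubcoalgebraR K H R D} = ⊤

/-- A Yetter–Drinfeld submodule of `H` (with the adjoint action and the coproduct):
a subspace stable under `·_ad` and a left subcomodule for `Δ`, i.e. `Δ(D) ⊆ H ⊗ D`. -/
def IsYDSubmodule (D : Submodule K H) : Prop :=
  (∀ (h : H), ∀ a ∈ D, adAct K H h a ∈ D) ∧
  (∀ a ∈ D, Coalgebra.comul (R := K) a ∈ Submodule.map₂ (TensorProduct.mk K H H) ⊤ D)

/-- A minimal (irreducible) Yetter–Drinfeld submodule of `H`. -/
def IsMinimalYDSubmodule (D : Submodule K H) : Prop :=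
  D ≠ ⊥ ∧ IsYDSubmodule K H D ∧
    ∀ D' : Submodule K H, D' ≤ D → IsYDSubmodule K H D' → D' = ⊥ ∨ D' = D

/-- An `H`-adjoint-stable subcoalgebra of the transmuted braided group `H_R`:
a subcoalgebra of `(H, Δ_R)` which is stable under the left adjoint action. -/
def IsAdjointStableSubcoalgebra (R : H ⊗[K] H) (D : Submodule K H) : Prop :=
  (∀ (h : H), ∀ a ∈ D, adAct K H h a ∈ D) ∧
  (∀ a ∈ D, deltaR K H R a ∈ Submodule.map₂ (TensorProduct.mk K H H) D D)

/-- A minimal (nonzero) `H`-adjoint-stable subcoalgebra of `H_R`. -/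
def IsMinimalAdjointStableSubcoalgebra (R : H ⊗[K] H) (D : Submodule K H) : Prop :=
  D ≠ ⊥ ∧ IsAdjointStableSubcoalgebra K H R D ∧
    ∀ D' : Submodule K H, D' ≤ D → IsAdjointStableSubcoalgebra K H R D' → D' = ⊥ ∨ D' = D

/-- An object of `_H^{H_R}M`: a left `H`-module `V` together with a left comodule
structure `ρ_R` over the transmuted braided group `(H, Δ_R)`, satisfying the
compatibility `ρ_R(hv) = Σ h₍₁₎ ·_ad v⁽⁻¹⁾ ⊗ h₍₂₎ v⁽⁰⁾`.  By Zhu's lemma, this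
category is the Yetter–Drinfeld category `_H^H YD`. -/
structure RModStr (R : H ⊗[K] H) (V : Type*) [AddCommGroup V] [Module K V] where
  act : H →ₐ[K] Module.End K V
  coact : V →ₗ[K] H ⊗[K] V
  counit_coact : ∀ v : V,
    (TensorProduct.lid K V)
      ((LinearMap.rTensor V (Coalgebra.counit (R := K))) (coact v)) = v
  coassocR : (LinearMap.rTensor V (deltaR K H R)) ∘ₗ coact
      = (TensorProduct.assoc K H H V).symm.toLinearMap ∘ₗ
        (LinearMap.lTensor H coact) ∘ₗ coact
  compat : coact ∘ₗ (TensorProduct.lift act.toLinearMap)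
      = (TensorProduct.map (adMap K H) (TensorProduct.lift act.toLinearMap)) ∘ₗ
        (TensorProduct.tensorTensorTensorComm K H H H V).toLinearMap ∘ₗ
        (TensorProduct.map (Coalgebra.comul (R := K)) coact)

/-- The object lies in the subcategory `_H^D M`: its coaction takes values in `D ⊗ V`. -/
def memDCat (R : H ⊗[K] H) (D : Submodule K H) {V : Type*} [AddCommGroup V]
    [Module K V] (s : RModStr K H R V) : Prop :=
  ∀ v : V, s.coact v ∈ Submodule.map₂ (TensorProduct.mk K H V) D ⊤

/-- Irreducibility of an object of `_H^{H_R}M = _H^H YD`: it is nonzero and has no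
nontrivial subspace stable under the action and the coaction. -/
def RModIrreducible (R : H ⊗[K] H) {V : Type*} [AddCommGroup V] [Module K V]
    (s : RModStr K H R V) : Prop :=
  (⊥ : Submodule K V) ≠ ⊤ ∧
    ∀ W : Submodule K V, (∀ h : H, ∀ w ∈ W, s.act h w ∈ W) →
      (∀ w ∈ W, s.coact w ∈ Submodule.map₂ (TensorProduct.mk K H V) ⊤ W) →
      W = ⊥ ∨ W = ⊤

/-- A left comodule structure over a subcoalgebra `D` of the transmuted braided
group `(H, Δ_R)`. -/
structure DComodStr (R : H ⊗[K] H) (D : Submodule K H) (W : Type*) [AddCommGroup W]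
    [Module K W] where
  coact : W →ₗ[K] H ⊗[K] W
  mem : ∀ w : W, coact w ∈ Submodule.map₂ (TensorProduct.mk K H W) D ⊤
  counit_coact : ∀ w : W,
    (TensorProduct.lid K W)
      ((LinearMap.rTensor W (Coalgebra.counit (R := K))) (coact w)) = w
  coassocR : (LinearMap.rTensor W (deltaR K H R)) ∘ₗ coact
      = (TensorProduct.assoc K H H W).symm.toLinearMap ∘ₗ
        (LinearMap.lTensor H coact) ∘ₗ coact

/-- The coaction `ρ_R(h ⊗ w) = Σ h₍₁₎ ·_ad w₍₋₁₎ ⊗ (h₍₂₎ ⊗ w₍₀₎)` on `H ⊗ W`. -/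
noncomputable def rhoHW (R : H ⊗[K] H) {D : Submodule K H} {W : Type*} [AddCommGroup W]
    [Module K W] (sW : DComodStr K H R D W) :
    H ⊗[K] W →ₗ[K] H ⊗[K] (H ⊗[K] W) :=
  (TensorProduct.map (adMap K H) LinearMap.id) ∘ₗ
    (TensorProduct.tensorTensorTensorComm K H H H W).toLinearMap ∘ₗ
    (TensorProduct.map (Coalgebra.comul (R := K)) sW.coact)

/-- The cotensor product `X □ Y ⊆ X ⊗ Y` of a right `H`-comodule `(X, ρX)` and a left
`H`-comodule `(Y, ρY)`. -/
noncomputable def cotensor {X Y : Type*} [AddCommGroup X] [Module K X] [AddCommGroup Y]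
    [Module K Y] (ρX : X →ₗ[K] X ⊗[K] H) (ρY : Y →ₗ[K] H ⊗[K] Y) :
    Submodule K (X ⊗[K] Y) :=
  LinearMap.ker ((TensorProduct.assoc K X H Y).toLinearMap ∘ₗ
    (LinearMap.rTensor Y ρX) - (LinearMap.lTensor X ρY))

/-- `ρ*` is the right comodule structure on `W*` dual to the left comodule structure
`coactW` on `W`:  `Σ ⟨f⁽⁰⁾, w⟩ f⁽¹⁾ = Σ w₍₋₁₎ ⟨f, w₍₀₎⟩`. -/
def IsDualCoaction {W : Type*} [AddCommGroup W] [Module K W]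
    (coactW : W →ₗ[K] H ⊗[K] W)
    (ρstar : Module.Dual K W →ₗ[K] (Module.Dual K W) ⊗[K] H) : Prop :=
  ∀ (f : Module.Dual K W) (w : W),
    (TensorProduct.lid K H) ((LinearMap.rTensor H ((Module.Dual.eval K W) w)) (ρstar f))
      = (TensorProduct.rid K H) ((LinearMap.lTensor H f) (coactW w))

/-- The space `Hom_H^D(V₁, V₂)` of maps which are simultaneously left `H`-module and
left comodule morphisms. -/
def homHD (R : H ⊗[K] H) {V₁ V₂ : Type*} [AddCommGroup V₁] [Module K V₁]
    [AddCommGroup V₂] [Module K V₂] (s : RModStr K H R V₁) (t : RModStr K H R V₂) :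
    Submodule K (V₁ →ₗ[K] V₂) where
  carrier := {f | (∀ h : H, (t.act h : V₂ →ₗ[K] V₂) ∘ₗ f = f ∘ₗ (s.act h : V₁ →ₗ[K] V₁)) ∧
    (LinearMap.lTensor H f) ∘ₗ s.coact = t.coact ∘ₗ f}
  add_mem' := by
    rintro f g ⟨hf1, hf2⟩ ⟨hg1, hg2⟩
    refine ⟨fun h => ?_, ?_⟩
    · rw [LinearMap.comp_add, LinearMap.add_comp, hf1 h, hg1 h]
    · rw [LinearMap.lTensor_add, LinearMap.add_comp, LinearMap.comp_add, hf2, hg2]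
  zero_mem' := by
    refine ⟨fun h => ?_, ?_⟩ <;> simp
  smul_mem' := by
    rintro c f ⟨hf1, hf2⟩
    refine ⟨fun h => ?_, ?_⟩
    · rw [LinearMap.comp_smul, LinearMap.smul_comp, hf1 h]
    · rw [LinearMap.lTensor_smul, LinearMap.smul_comp, LinearMap.comp_smul, hf2]

/-- The algebra `Hom_H^D(V, V)` of endomorphisms of `V` which are simultaneously left
`H`-module and left comodule morphisms. -/
def endHD (R : H ⊗[K] H) {V : Type*} [AddCommGroup V] [Module K V]
    (s : RModStr K H R V) : Subalgebra K (Module.End K V) where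
  carrier := {f | (∀ h : H, (s.act h : V →ₗ[K] V) ∘ₗ f = f ∘ₗ (s.act h : V →ₗ[K] V)) ∧
    (LinearMap.lTensor H f) ∘ₗ s.coact = s.coact ∘ₗ f}
  add_mem' := by
    rintro f g ⟨hf1, hf2⟩ ⟨hg1, hg2⟩
    refine ⟨fun h => ?_, ?_⟩
    · rw [LinearMap.comp_add, LinearMap.add_comp, hf1 h, hg1 h]
    · rw [LinearMap.lTensor_add, LinearMap.add_comp, LinearMap.comp_add, hf2, hg2]
  mul_mem' := by
    rintro f g ⟨hf1, hf2⟩ ⟨hg1, hg2⟩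
    refine ⟨fun h => ?_, ?_⟩
    · show (s.act h : V →ₗ[K] V) ∘ₗ (f ∘ₗ g) = (f ∘ₗ g) ∘ₗ (s.act h : V →ₗ[K] V)
      rw [← LinearMap.comp_assoc, hf1 h, LinearMap.comp_assoc, hg1 h, LinearMap.comp_assoc]
    · show (LinearMap.lTensor H (f ∘ₗ g)) ∘ₗ s.coact = s.coact ∘ₗ (f ∘ₗ g)
      rw [LinearMap.lTensor_comp, LinearMap.comp_assoc, hg2, ← LinearMap.comp_assoc, hf2,
        LinearMap.comp_assoc]
  algebraMap_mem' := by
    intro c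
    refine ⟨fun h => ?_, ?_⟩
    · ext v
      simp [Module.algebraMap_end_apply]
    · ext v
      have : ((algebraMap K (Module.End K V)) c) = c • (LinearMap.id (M := V)) := by
        ext w; simp [Module.algebraMap_end_apply]
      simp [this, Module.algebraMap_end_apply]

/-- The canonical element `Σᵢ wᵢ* ⊗ (1_H ⊗ wᵢ) ∈ W* ⊗ (H ⊗ W)` (for a dual basis
`{wᵢ, wᵢ*}` of the finite dimensional space `W`). -/
noncomputable def coevHW (W : Type*) [AddCommGroup W] [Module K W]
    [FiniteDimensional K W] : (Module.Dual K W) ⊗[K] (H ⊗[K] W) :=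
  (LinearMap.lTensor (Module.Dual K W) ((TensorProduct.mk K H W) 1))
    ((TensorProduct.comm K W (Module.Dual K W)) ((coevaluation K W) 1))

/-- `f ↦ Σᵢ wᵢ* ⊗ f(1 ⊗ wᵢ)`, the canonical map from maps out of `H ⊗ W` to `W* ⊗ V`. -/
noncomputable def muW {W : Type*} [AddCommGroup W] [Module K W] [FiniteDimensional K W]
    {V : Type*} [AddCommGroup V] [Module K V] (f : H ⊗[K] W →ₗ[K] V) :
    (Module.Dual K W) ⊗[K] V :=
  (LinearMap.lTensor (Module.Dual K W) f) (coevHW K H W)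

/-- The composition-type product
`(w'* ⊗ v) ∘ (w* ⊗ h ⊗ w') = w* ⊗ ⟨w'*, w'⟩ (h · v)` turning `W* □_D (H ⊗ W)` into the
`R`-adjoint-stable algebra `N_W` (for `V = H ⊗ W`) and `W* □_D V` into a right
`N_W`-module. -/
noncomputable def cmpMod {W : Type} [AddCommGroup W] [Module K W]
    {V : Type} [AddCommGroup V] [Module K V] (act : H →ₐ[K] Module.End K V) :
    (((W →ₗ[K] K) ⊗[K] V) ⊗[K] ((W →ₗ[K] K) ⊗[K] (H ⊗[K] W))) →ₗ[K]
      ((W →ₗ[K] K) ⊗[K] V) :=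
  (TensorProduct.lid K ((W →ₗ[K] K) ⊗[K] V)).toLinearMap ∘ₗ
  (LinearMap.rTensor ((W →ₗ[K] K) ⊗[K] V) (contractLeft K W)) ∘ₗ
  (TensorProduct.tensorTensorTensorComm K (W →ₗ[K] K) (W →ₗ[K] K) W V).toLinearMap ∘ₗ
  (LinearMap.lTensor ((W →ₗ[K] K) ⊗[K] (W →ₗ[K] K))
    ((TensorProduct.comm K V W).toLinearMap ∘ₗ
      (LinearMap.rTensor W (TensorProduct.lift act.toLinearMap)) ∘ₗ
      (LinearMap.rTensor W (TensorProduct.comm K V H).toLinearMap) ∘ₗ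
      (TensorProduct.assoc K V H W).symm.toLinearMap)) ∘ₗ
  (TensorProduct.tensorTensorTensorComm K (W →ₗ[K] K) V (W →ₗ[K] K) (H ⊗[K] W)).toLinearMap

open CategoryTheory in
/-- The category `_H^D M` of left `H`-modules which are left `D`-comodules (over the
transmuted braided group) with the compatibility of Zhu's lemma. -/
structure DCatObj (R : H ⊗[K] H) (D : Submodule K H) : Type 1 where
  V : Type
  [acg : AddCommGroup V]
  [mod : Module K V]
  str : RModStr K H R V
  memD : memDCat K H R D str

attribute [instance] DCatObj.acg DCatObj.mod

open CategoryTheory in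
noncomputable instance DCatCategory (R : H ⊗[K] H) (D : Submodule K H) :
    Category (DCatObj K H R D) where
  Hom X Y := ↥(homHD K H R X.str Y.str)
  id X := ⟨LinearMap.id, ⟨fun h => by simp, by simp⟩⟩
  comp {X Y Z} f g := ⟨g.1 ∘ₗ f.1, by
    refine ⟨fun h => ?_, ?_⟩
    · rw [← LinearMap.comp_assoc, g.2.1 h, LinearMap.comp_assoc, f.2.1 h,
        LinearMap.comp_assoc]
    · rw [LinearMap.lTensor_comp, LinearMap.comp_assoc, f.2.2, ← LinearMap.comp_assoc,
        g.2.2, LinearMap.comp_assoc]⟩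
  id_comp f := by apply Subtype.ext; simp
  comp_id f := by apply Subtype.ext; simp
  assoc f g h := by apply Subtype.ext; simp [LinearMap.comp_assoc]


section TensorSum

open Coalgebra HopfAlgebra

/-- `Lin K f` says that the plain function `f` is `K`-linear. -/
class Lin (K : Type) [Field K] {M N : Type*} [AddCommGroup M] [Module K M] [AddCommGroup N]
    [Module K N] (f : M → N) : Prop where
  add : ∀ x y, f (x + y) = f x + f y
  smul : ∀ (c : K) x, f (c • x) = c • f x

variable {K : Type} [Field K] {M N P Q : Type*} [AddCommGroup M] [Module K M] [AddCommGroup N]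
  [Module K N] [AddCommGroup P] [Module K P] [AddCommGroup Q] [Module K Q]

/-- The bundled linear map of a linear function. -/
def Lin.toMap (f : M → N) [hf : Lin K f] : M →ₗ[K] N := ⟨⟨f, hf.add⟩, hf.smul⟩

theorem Lin.sum {f : M → N} (hf : Lin K f) {ι : Type*} (s : Finset ι) (g : ι → M) :
    f (∑ i ∈ s, g i) = ∑ i ∈ s, f (g i) := map_sum (Lin.toMap (K := K) f) g s

instance Lin.id : Lin K (fun x : M => x) := ⟨fun _ _ => rfl, fun _ _ => rfl⟩

instance Lin.coe (L : M →ₗ[K] N) : Lin K L := ⟨by simp, by simp⟩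

instance Lin.map (L : N →ₗ[K] P) {f : M → N} [hf : Lin K f] : Lin K (fun x => L (f x)) :=
  ⟨fun x y => by simp [hf.add], fun c x => by simp [hf.smul]⟩

theorem Lin.comp {f : N → P} (hf : Lin K f) {g : M → N} (hg : Lin K g) :
    Lin K (fun x => f (g x)) :=
  ⟨fun x y => by rw [hg.add, hf.add], fun c x => by rw [hg.smul, hf.smul]⟩

instance Lin.linComp {f : M → N →ₗ[K] P} [hf : Lin K f] (y : N) : Lin K (fun x => f x y) :=
  ⟨fun x y => by simp [hf.add], fun c x => by simp [hf.smul]⟩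

instance Lin.smul_left {f : M → K} [hf : Lin K f] (y : N) : Lin K (fun x => f x • y) :=
  ⟨fun x z => by simp [hf.add, add_smul], fun c x => by simp [hf.smul, mul_smul]⟩

instance Lin.smul_right {f : M → N} [hf : Lin K f] (c : K) : Lin K (fun x => c • f x) :=
  ⟨fun x z => by simp [hf.add], fun d x => by simp [hf.smul, smul_comm c d]⟩

instance Lin.tmul_left {f : M → N} [hf : Lin K f] (y : P) : Lin K (fun x => f x ⊗ₜ[K] y) :=
  ⟨fun x z => by simp [hf.add, add_tmul], fun c x => by simp [hf.smul, smul_tmul']⟩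

instance Lin.tmul_right {f : M → N} [hf : Lin K f] (y : P) : Lin K (fun x => y ⊗ₜ[K] f x) :=
  ⟨fun x z => by simp [hf.add, tmul_add], fun c x => by simp [hf.smul]⟩

variable {A : Type*} [Ring A] [Algebra K A]

instance Lin.mul_left {f : M → A} [hf : Lin K f] (y : A) : Lin K (fun x => f x * y) :=
  ⟨fun x z => by simp [hf.add, add_mul], fun c x => by simp [hf.smul]⟩

instance Lin.mul_right {f : M → A} [hf : Lin K f] (y : A) : Lin K (fun x => y * f x) :=
  ⟨fun x z => by simp [hf.add, mul_add], fun c x => by simp [hf.smul]⟩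

instance Lin.smul_left_alg {f : M → K} [hf : Lin K f] (y : A) : Lin K (fun x => f x • y) :=
  Lin.smul_left y

instance Lin.smul_right_alg {f : M → A} [hf : Lin K f] (c : K) : Lin K (fun x => c • f x) :=
  Lin.smul_right c

instance Lin.mul_apply (y : A) : Lin K (HMul.hMul y : A → A) := Lin.mul_right y

instance Lin.smul_apply (c : K) : Lin K (HSMul.hSMul c : M → M) := Lin.smul_right c

instance Lin.smul_apply_alg (c : K) : Lin K (HSMul.hSMul c : A → A) := Lin.smul_right c

instance Lin.tmul_apply (y : P) : Lin K (TensorProduct.tmul K y : M → P ⊗[K] M) :=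
  Lin.tmul_right y

/-- The sum `∑ f(t₁, t₂)` over a representation `t = ∑ t₁ ⊗ t₂`. -/
noncomputable def tensorSum {M N P : Type*} [AddCommGroup M] [Module K M]
    [AddCommGroup N] [Module K N] [AddCommGroup P] (t : M ⊗[K] N) (f : M → N → P) : P :=
  ∑ i ∈ (TensorProduct.exists_finset (R := K) t).choose, f i.1 i.2

/-- The bundled bilinear map of a bilinear function. -/
def Lin.toMap₂ (f : M → N → P) [h₁ : ∀ y, Lin K (fun x => f x y)]
    [h₂ : ∀ x, Lin K (fun y => f x y)] : M →ₗ[K] N →ₗ[K] P :=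
  LinearMap.mk₂ K f (fun x y z => (h₁ z).add x y) (fun c x y => (h₁ y).smul c x)
    (fun x => (h₂ x).add) (fun c x y => (h₂ x).smul c y)

theorem tensorSum_eq (t : M ⊗[K] N) (L : M →ₗ[K] N →ₗ[K] P) :
    tensorSum t (fun a b => L a b) = TensorProduct.lift L t := by
  conv_rhs => rw [(TensorProduct.exists_finset (R := K) t).choose_spec]
  simp [tensorSum]

section

variable (f : M → N → P) [∀ y, Lin K (fun x => f x y)] [∀ x, Lin K (fun y => f x y)]

theorem tensorSum_eq_lift (t : M ⊗[K] N) :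
    tensorSum t f = TensorProduct.lift (Lin.toMap₂ f) t := tensorSum_eq t (Lin.toMap₂ f)

theorem tensorSum_tmul (a : M) (b : N) : tensorSum (a ⊗ₜ[K] b) f = f a b := by
  rw [tensorSum_eq_lift]; rfl

theorem tensorSum_add_left (t t' : M ⊗[K] N) :
    tensorSum (t + t') f = tensorSum t f + tensorSum t' f := by
  simp only [tensorSum_eq_lift, map_add]

theorem tensorSum_smul_left (c : K) (t : M ⊗[K] N) :
    tensorSum (c • t) f = c • tensorSum t f := by
  simp only [tensorSum_eq_lift, map_smul]

theorem tensorSum_map {M' N' : Type*} [AddCommGroup M'] [Module K M'] [AddCommGroup N']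
    [Module K N'] (F : M' →ₗ[K] M) (G : N' →ₗ[K] N) (t : M' ⊗[K] N') :
    tensorSum (TensorProduct.map F G t) f = tensorSum t (fun a b => f (F a) (G b)) := by
  have (y : N') : Lin K (fun x => f (F x) (G y)) := .comp (f := fun x => f x (G y)) inferInstance
    (.coe F)
  have (x : M') : Lin K (fun y => f (F x) (G y)) := .comp (f := fun y => f (F x) y) inferInstance
    (.coe G)
  rw [tensorSum_eq_lift, ← LinearMap.comp_apply, TensorProduct.lift_comp_map, tensorSum_eq_lift]
  rfl

/-- A sum over a tensor which is itself a sum. -/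
theorem tensorSum_tensorSum {M' N' : Type*} [AddCommGroup M'] [Module K M'] [AddCommGroup N']
    [Module K N'] (t : M' ⊗[K] N') (g : M' → N' → M ⊗[K] N) :
    tensorSum (tensorSum t g) f = tensorSum t (fun a b => tensorSum (g a b) f) := by
  simp only [tensorSum_eq_lift f]
  exact map_sum _ _ _

end

section

variable {R S : Type*} [AddCommGroup R] [Module K R] [AddCommGroup S] [Module K S] (t : R ⊗[K] S)

theorem tensorSum_congr {P : Type*} [AddCommGroup P] {f g : R → S → P} (h : ∀ a b, f a b = g a b) :
    tensorSum t f = tensorSum t g := by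
  rw [show f = g from funext₂ h]

theorem tensorSum_tmul_self : tensorSum t (fun a b => a ⊗ₜ[K] b) = t := by
  conv_rhs => rw [(TensorProduct.exists_finset (R := K) t).choose_spec]
  rfl

theorem Lin.tensorSum (f : M → P) [hf : Lin K f] (g : R → S → M) :
    f (_root_.tensorSum t g) = _root_.tensorSum t (fun a b => f (g a b)) := hf.sum _ _

theorem map_tensorSum (f : M →ₗ[K] P) (g : R → S → M) :
    f (tensorSum t g) = tensorSum t (fun a b => f (g a b)) := Lin.tensorSum t f g

theorem tensorSum_apply (g : R → S → M →ₗ[K] P) (x : M) :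
    tensorSum t g x = tensorSum t (fun a b => g a b x) := Lin.tensorSum t (fun L => L x) g

theorem mul_tensorSum (x : A) (g : R → S → A) :
    x * tensorSum t g = tensorSum t (fun a b => x * g a b) := Lin.tensorSum t (fun y => x * y) g

theorem tensorSum_mul (x : A) (g : R → S → A) :
    tensorSum t g * x = tensorSum t (fun a b => g a b * x) := Lin.tensorSum t (fun y => y * x) g

theorem smul_tensorSum (c : K) (g : R → S → P) :
    c • tensorSum t g = tensorSum t (fun a b => c • g a b) := Lin.tensorSum t (fun y => c • y) g

theorem tensorSum_smul (g : R → S → K) (x : P) :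
    tensorSum t g • x = tensorSum t (fun a b => g a b • x) := Lin.tensorSum t (fun y => y • x) g

theorem tmul_tensorSum (x : Q) (g : R → S → P) :
    x ⊗ₜ[K] tensorSum t g = tensorSum t (fun a b => x ⊗ₜ[K] g a b) :=
  Lin.tensorSum t (fun y => x ⊗ₜ[K] y) g

theorem tensorSum_tmul' (x : Q) (g : R → S → P) :
    tensorSum t g ⊗ₜ[K] x = tensorSum t (fun a b => g a b ⊗ₜ[K] x) :=
  Lin.tensorSum t (fun y => y ⊗ₜ[K] x) g

end

theorem tensorSum_comm {M' N' P : Type*} [AddCommGroup P] [AddCommGroup M'] [Module K M']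
    [AddCommGroup N'] [Module K N'] (t : M ⊗[K] N) (t' : M' ⊗[K] N') (f : M → N → M' → N' → P) :
    tensorSum t (fun a b => tensorSum t' (fun c d => f a b c d)) =
      tensorSum t' (fun c d => tensorSum t (fun a b => f a b c d)) := Finset.sum_comm

instance Lin.tensorSum_fun (t : M ⊗[K] N) {f : Q → M → N → P}
    [hf : ∀ a b, Lin K (fun x => f x a b)] :
    Lin K (fun x => _root_.tensorSum t (fun a b => f x a b)) :=
  ⟨fun x y => by simp only [_root_.tensorSum, (hf _ _).add, Finset.sum_add_distrib],
    fun c x => by simp only [_root_.tensorSum, (hf _ _).smul, Finset.smul_sum]⟩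

instance Lin.tensorSum_arg {g : Q → M ⊗[K] N} [hg : Lin K g] {f : M → N → P}
    [hf₁ : ∀ y, Lin K (fun x => f x y)] [hf₂ : ∀ x, Lin K (fun y => f x y)] :
    Lin K (fun x => _root_.tensorSum (g x) (fun a b => f a b)) :=
  ⟨fun x y => by simp only [tensorSum_eq_lift f, hg.add, map_add],
    fun c x => by simp only [tensorSum_eq_lift f, hg.smul, map_smul]⟩

end TensorSum

local notation "sw" k:max h:max f:max => tensorSum (Coalgebra.comul (R := k) h) f

section Sweedler

open Coalgebra HopfAlgebra

variable {K : Type} [Field K] {M N P Q : Type*} [AddCommGroup M] [Module K M] [AddCommGroup N]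
  [Module K N] [AddCommGroup P] [Module K P] [AddCommGroup Q] [Module K Q]
  {H : Type} [Ring H] [HopfAlgebra K H]

section

variable (f : H → H → P) [∀ y, Lin K (fun x => f x y)] [∀ x, Lin K (fun y => f x y)]

theorem sw_mul (g h : H) :
    sw K (g * h) f = sw K g (fun a b => sw K h (fun c d => f (a * c) (b * d))) := by
  have : comul (R := K) (g * h) =
      sw K g (fun a b => sw K h (fun c d => (a * c) ⊗ₜ[K] (b * d))) := by
    rw [Bialgebra.comul_mul]
    conv_lhs => rw [← tensorSum_tmul_self (comul g), ← tensorSum_tmul_self (comul h)]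
    simp only [mul_tensorSum, tensorSum_mul, Algebra.TensorProduct.tmul_mul_tmul]
    rw [tensorSum_comm]
  rw [this]
  simp only [tensorSum_tensorSum f, tensorSum_tmul f]

theorem sw_one : sw K (1 : H) f = f 1 1 := by
  rw [Bialgebra.comul_one, Algebra.TensorProduct.one_def, tensorSum_tmul f]

end

theorem sw_coassoc (h : H) (f : H → H → H → P) [∀ y z, Lin K (fun x => f x y z)]
    [∀ x z, Lin K (fun y => f x y z)] [∀ x y, Lin K (fun z => f x y z)] :
    sw K h (fun a b => sw K a (fun c d => f c d b)) =
      sw K h (fun a b => sw K b (fun c d => f a c d)) := by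
  let F : H ⊗[K] (H ⊗[K] H) → P := fun t =>
    tensorSum t (fun a s => tensorSum s (fun c d => f a c d))
  have hF : Lin K F := inferInstanceAs (Lin K fun t : H ⊗[K] (H ⊗[K] H) =>
    tensorSum t (fun a s => tensorSum s (fun c d => f a c d)))
  have hF₁ (a c d : H) : F (a ⊗ₜ[K] (c ⊗ₜ[K] d)) = f a c d := by
    simp only [F]
    rw [tensorSum_tmul (fun a s => tensorSum s (fun c d => f a c d)),
      tensorSum_tmul (fun c d => f a c d)]
  have key := congrArg F (coassoc_apply (R := K) h)
  have e₁ : TensorProduct.assoc K H H H (comul.rTensor H (comul h)) =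
      sw K h (fun a b => sw K a (fun c d => c ⊗ₜ[K] (d ⊗ₜ[K] b))) := by
    conv_lhs => rw [← tensorSum_tmul_self (comul h)]
    rw [map_tensorSum]
    change (TensorProduct.assoc K H H H).toLinearMap _ = _
    rw [map_tensorSum]
    refine tensorSum_congr _ fun a b => ?_
    rw [rTensor_tmul]
    conv_lhs => rw [← tensorSum_tmul_self (comul a)]
    rw [tensorSum_tmul', map_tensorSum]
    rfl
  have e₂ : comul.lTensor H (comul (R := K) h) =
      sw K h (fun a b => sw K b (fun c d => a ⊗ₜ[K] (c ⊗ₜ[K] d))) := by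
    conv_lhs => rw [← tensorSum_tmul_self (comul h)]
    rw [map_tensorSum]
    refine tensorSum_congr _ fun a b => ?_
    rw [lTensor_tmul]
    conv_lhs => rw [← tensorSum_tmul_self (comul b)]
    rw [tmul_tensorSum]
  rw [e₁, e₂] at key
  simpa only [Lin.tensorSum (K := K) _ F, hF₁] using key

section

variable (f : H → P) [hf : Lin K f] (h : H)

theorem sw_counit_left : sw K h (fun a b => counit (R := K) a • f b) = f h := by
  have := tensorSum_map (fun (c : K) (b : H) => c • f b) (counit (R := K) (A := H)) .id (comul h)
  rw [← rTensor, rTensor_counit_comul, tensorSum_tmul, one_smul] at this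
  exact this.symm

theorem sw_counit_right : sw K h (fun a b => counit (R := K) b • f a) = f h := by
  have := tensorSum_map (fun (b : H) (c : K) => c • f b) .id (counit (R := K) (A := H)) (comul h)
  rw [← lTensor, lTensor_counit_comul, tensorSum_tmul, one_smul] at this
  exact this.symm

theorem sw_antipode_mul :
    sw K h (fun a b => f (antipode K a * b)) = counit (R := K) h • f 1 := by
  have := congrArg f (mul_antipode_rTensor_comul_apply (R := K) h)
  rw [Algebra.algebraMap_eq_smul_one, hf.smul] at this
  rw [← this, ← Lin.tensorSum (K := K) _ f, mul', ← tensorSum_eq, rTensor, tensorSum_map]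
  rfl

theorem sw_mul_antipode :
    sw K h (fun a b => f (a * antipode K b)) = counit (R := K) h • f 1 := by
  have := congrArg f (mul_antipode_lTensor_comul_apply (R := K) h)
  rw [Algebra.algebraMap_eq_smul_one, hf.smul] at this
  rw [← this, ← Lin.tensorSum (K := K) _ f, mul', ← tensorSum_eq, lTensor, tensorSum_map]
  rfl

end

end Sweedler

section HopfIdentities

open Coalgebra HopfAlgebra

variable {K : Type} [Field K] {P : Type*} [AddCommGroup P] [Module K P]
  {H : Type} [Ring H] [HopfAlgebra K H]

theorem convolution_inverse_unique {A : Type*} [Ring A] [Algebra K A] (ρ δ ν : H → A) [Lin K ρ]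
    [Lin K δ] [Lin K ν] (h₁ : ∀ h, sw K h (fun a b => ρ a * δ b) = counit (R := K) h • 1)
    (h₂ : ∀ h, sw K h (fun a b => δ a * ν b) = counit (R := K) h • 1) (h : H) : ρ h = ν h := by
  have key := sw_coassoc (K := K) h (fun a b c => ρ a * δ b * ν c)
  simp only [mul_assoc, ← mul_tensorSum, h₂] at key
  simp only [← mul_assoc, ← tensorSum_mul, h₁] at key
  simp only [smul_mul_assoc, mul_smul_comm, one_mul, mul_one] at key
  rwa [sw_counit_left (fun x => ν x), sw_counit_right (fun x => ρ x), eq_comm] at key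

theorem sw_antipode_comul (f : H → H → P) [∀ y, Lin K (fun x => f x y)]
    [∀ x, Lin K (fun y => f x y)] (h : H) :
    sw K (antipode K h) f = sw K h (fun a b => f (antipode K b) (antipode K a)) := by
  have key := convolution_inverse_unique (K := K) (A := H ⊗[K] H)
    (fun h => comul (antipode K h)) (fun h => comul h)
    (fun h => sw K h (fun a b => antipode K b ⊗ₜ[K] antipode K a)) ?_ ?_ h
  · rw [key, tensorSum_tensorSum f]
    simp only [tensorSum_tmul f]
  · intro h
    simp only [← Bialgebra.comul_mul]
    rw [sw_antipode_mul (fun x => comul (R := K) x), Bialgebra.comul_one]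
  · intro h
    have h₁ (a b : H) : comul a * sw K b (fun c d => antipode K d ⊗ₜ[K] antipode K c) =
      sw K a (fun x y => sw K b (fun c d => (x * antipode K d) ⊗ₜ[K] (y * antipode K c))) := by
      conv_lhs => rw [← tensorSum_tmul_self (comul a)]
      simp only [mul_tensorSum, tensorSum_mul, Algebra.TensorProduct.tmul_mul_tmul]
      rw [tensorSum_comm]
    simp only [h₁]
    rw [sw_coassoc h (fun x y b =>
      sw K b (fun c d => (x * antipode K d) ⊗ₜ[K] (y * antipode K c)))]
    have h₂ (a b : H) : sw K b (fun c d => sw K d (fun e g =>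
        (a * antipode K g) ⊗ₜ[K] (c * antipode K e))) = (a * antipode K b) ⊗ₜ 1 := by
      rw [← sw_coassoc b (fun c e g => (a * antipode K g) ⊗ₜ[K] (c * antipode K e))]
      simp only [← tmul_tensorSum]
      simp only [sw_mul_antipode (fun x => x), tmul_smul]
      rw [sw_counit_left (fun g => (a * antipode K g) ⊗ₜ[K] (1 : H))]
    simp only [h₂]
    rw [sw_mul_antipode (fun x => x ⊗ₜ[K] (1 : H)), Algebra.TensorProduct.one_def]

section

variable (f : H → H → P) [∀ y, Lin K (fun x => f x y)] [∀ x, Lin K (fun y => f x y)] (h : H)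

theorem sw_antipode_mul_cancel :
    sw K h (fun a b => sw K b (fun c d => f (antipode K a * c) d)) = f 1 h := by
  change sw K h (fun a b => sw K b (fun c d => Lin.toMap₂ (K := K) f (antipode K a * c) d)) = _
  rw [← sw_coassoc h (fun a c d => Lin.toMap₂ (K := K) f (antipode K a * c) d),
    tensorSum_congr _ fun a b => sw_antipode_mul (K := K) (fun z => Lin.toMap₂ f z b) a,
    sw_counit_left (Lin.toMap₂ f 1)]
  rfl

theorem sw_mul_antipode_cancel :
    sw K h (fun a b => sw K b (fun c d => f (a * antipode K c) d)) = f 1 h := by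
  change sw K h (fun a b => sw K b (fun c d => Lin.toMap₂ (K := K) f (a * antipode K c) d)) = _
  rw [← sw_coassoc h (fun a c d => Lin.toMap₂ (K := K) f (a * antipode K c) d),
    tensorSum_congr _ fun a b => sw_mul_antipode (K := K) (fun z => Lin.toMap₂ f z b) a,
    sw_counit_left (Lin.toMap₂ f 1)]
  rfl

theorem sw_cancel_antipode_mul :
    sw K h (fun a b => sw K b (fun c d => f a (antipode K c * d))) = f h 1 := by
  change sw K h (fun a b => sw K b (fun c d => Lin.toMap₂ (K := K) f a (antipode K c * d))) = _
  rw [tensorSum_congr _ fun a b => sw_antipode_mul (K := K) (fun z => Lin.toMap₂ (K := K) f a z) b,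
    sw_counit_right (fun x => Lin.toMap₂ f x 1)]
  rfl

theorem sw_cancel_mul_antipode :
    sw K h (fun a b => sw K b (fun c d => f a (c * antipode K d))) = f h 1 := by
  change sw K h (fun a b => sw K b (fun c d => Lin.toMap₂ (K := K) f a (c * antipode K d))) = _
  rw [tensorSum_congr _ fun a b => sw_mul_antipode (K := K) (fun z => Lin.toMap₂ (K := K) f a z) b,
    sw_counit_right (fun x => Lin.toMap₂ f x 1)]
  rfl

end

/-- The adjoint action in Sweedler form. -/
theorem adAct_eq (h a : H) : adAct K H h a = sw K h (fun x y => x * a * antipode K y) := by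
  have : adAct K H h a = TensorProduct.lift (Lin.toMap₂ (K := K)
      (fun x y : H => x * a * antipode K y)) (comul h) := by
    rw [adAct, adMap]
    simp only [LinearMap.comp_apply, rTensor_tmul]
    conv_lhs => rw [← tensorSum_tmul_self (comul h)]
    conv_rhs => rw [← tensorSum_tmul_self (comul h)]
    simp only [tensorSum_tmul', LinearEquiv.coe_coe, Lin.tensorSum]
    refine tensorSum_congr _ fun x y => ?_
    simp [Lin.toMap₂, mul_assoc]
  rw [this, ← tensorSum_eq]
  rfl

variable (K H) in
/-- The adjoint action as a bilinear map. -/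
noncomputable def adLin : H →ₗ[K] H →ₗ[K] H := TensorProduct.curry (adMap K H)

theorem adLin_eq (h a : H) : adLin K H h a = sw K h (fun x y => x * a * antipode K y) :=
  adAct_eq h a

theorem adLin_one (a : H) : adLin K H 1 a = a := by
  rw [adLin_eq, sw_one (fun x y => x * a * antipode K y)]
  simp

theorem adLin_mul (g h a : H) : adLin K H (g * h) a = adLin K H g (adLin K H h a) := by
  simp only [adLin_eq, mul_tensorSum, tensorSum_mul]
  rw [sw_mul (fun x y => x * a * antipode K y)]
  simp only [antipode_mul_antidistrib, mul_assoc]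

end HopfIdentities

section QuasiTriangular

open Coalgebra HopfAlgebra

variable {K : Type} [Field K] {P : Type*} [AddCommGroup P] [Module K P]
  {H : Type} [Ring H] [HopfAlgebra K H] {R : H ⊗[K] H}

namespace IsQuasiTriangular

theorem sum_intertwine (hR : IsQuasiTriangular K H R) (h : H) (f : H → H → P)
    [∀ y, Lin K (fun x => f x y)] [∀ x, Lin K (fun y => f x y)] :
    tensorSum R (fun a b => sw K h (fun x y => f (a * x) (b * y))) =
      tensorSum R (fun a b => sw K h (fun x y => f (y * a) (x * b))) := by
  have e := hR.intertwine h
  have h₁ : R * comul h = tensorSum R (fun a b => sw K h (fun x y => (a * x) ⊗ₜ[K] (b * y))) := by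
    conv_lhs => rw [← tensorSum_tmul_self (comul h), ← tensorSum_tmul_self R]
    simp only [mul_tensorSum, tensorSum_mul, Algebra.TensorProduct.tmul_mul_tmul]
    rw [tensorSum_comm]
  have h₂ : (TensorProduct.comm K H H) (comul h) * R =
      tensorSum R (fun a b => sw K h (fun x y => (y * a) ⊗ₜ[K] (x * b))) := by
    conv_lhs => rw [← tensorSum_tmul_self (comul h), ← tensorSum_tmul_self R]
    rw [← LinearEquiv.coe_coe, map_tensorSum]
    simp only [mul_tensorSum, tensorSum_mul, LinearEquiv.coe_coe, TensorProduct.comm_tmul,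
      Algebra.TensorProduct.tmul_mul_tmul]
  rw [h₁, h₂] at e
  have := congrArg (fun t => tensorSum t f) e
  simpa only [tensorSum_tensorSum f, tensorSum_tmul f] using this

theorem sum_comul_left (hR : IsQuasiTriangular K H R) (f : H → H → H → P)
    [∀ y z, Lin K (fun x => f x y z)] [∀ x z, Lin K (fun y => f x y z)]
    [∀ x y, Lin K (fun z => f x y z)] :
    tensorSum R (fun a b => sw K a (fun x y => f x y b)) =
      tensorSum R (fun a b => tensorSum R (fun c d => f a c (b * d))) := by
  let F : H ⊗[K] (H ⊗[K] H) → P := fun t =>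
    tensorSum t (fun a s => tensorSum s (fun c d => f a c d))
  have hF : Lin K F := inferInstanceAs (Lin K fun t : H ⊗[K] (H ⊗[K] H) =>
    tensorSum t (fun a s => tensorSum s (fun c d => f a c d)))
  have hF₁ (a c d : H) : F (a ⊗ₜ[K] (c ⊗ₜ[K] d)) = f a c d := by
    simp only [F]
    rw [tensorSum_tmul (fun a s => tensorSum s (fun c d => f a c d)),
      tensorSum_tmul (fun c d => f a c d)]
  have e₁ : TensorProduct.assoc K H H H (comul.rTensor H R) =
      tensorSum R (fun a b => sw K a (fun c d => c ⊗ₜ[K] (d ⊗ₜ[K] b))) := by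
    conv_lhs => rw [← tensorSum_tmul_self R]
    rw [map_tensorSum]
    change (TensorProduct.assoc K H H H).toLinearMap _ = _
    rw [map_tensorSum]
    refine tensorSum_congr _ fun a b => ?_
    rw [rTensor_tmul]
    conv_lhs => rw [← tensorSum_tmul_self (comul a)]
    rw [tensorSum_tmul', map_tensorSum]
    rfl
  have e₂ : r13 K H R * r23 K H R =
      tensorSum R (fun a b => tensorSum R (fun c d => a ⊗ₜ[K] (c ⊗ₜ[K] (b * d)))) := by
    conv_lhs => rw [r13, r23, ← tensorSum_tmul_self R]
    simp only [map_tensorSum, tmul_tensorSum, mul_tensorSum, tensorSum_mul]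
    rw [tensorSum_comm]
    simp [Algebra.TensorProduct.tmul_mul_tmul]
  have key := hR.comul_rTensor
  rw [e₁, e₂] at key
  simpa only [Lin.tensorSum (K := K) _ F, hF₁] using congrArg F key

theorem sum_comul_right (hR : IsQuasiTriangular K H R) (f : H → H → H → P)
    [∀ y z, Lin K (fun x => f x y z)] [∀ x z, Lin K (fun y => f x y z)]
    [∀ x y, Lin K (fun z => f x y z)] :
    tensorSum R (fun a b => sw K b (fun x y => f a x y)) =
      tensorSum R (fun a b => tensorSum R (fun c d => f (a * c) d b)) := by
  let F : H ⊗[K] (H ⊗[K] H) → P := fun t =>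
    tensorSum t (fun a s => tensorSum s (fun c d => f a c d))
  have hF : Lin K F := inferInstanceAs (Lin K fun t : H ⊗[K] (H ⊗[K] H) =>
    tensorSum t (fun a s => tensorSum s (fun c d => f a c d)))
  have hF₁ (a c d : H) : F (a ⊗ₜ[K] (c ⊗ₜ[K] d)) = f a c d := by
    simp only [F]
    rw [tensorSum_tmul (fun a s => tensorSum s (fun c d => f a c d)),
      tensorSum_tmul (fun c d => f a c d)]
  have e₁ : comul.lTensor H R =
      tensorSum R (fun a b => sw K b (fun c d => a ⊗ₜ[K] (c ⊗ₜ[K] d))) := by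
    conv_lhs => rw [← tensorSum_tmul_self R]
    rw [map_tensorSum]
    refine tensorSum_congr _ fun a b => ?_
    rw [lTensor_tmul]
    conv_lhs => rw [← tensorSum_tmul_self (comul b)]
    rw [tmul_tensorSum]
  have e₂ : r13 K H R * r12 K H R =
      tensorSum R (fun a b => tensorSum R (fun c d => (a * c) ⊗ₜ[K] (d ⊗ₜ[K] b))) := by
    conv_lhs => rw [r13, r12, ← tensorSum_tmul_self R]
    simp only [map_tensorSum, mul_tensorSum, tensorSum_mul]
    rw [tensorSum_comm]
    simp [Algebra.TensorProduct.tmul_mul_tmul]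
  have key := hR.comul_lTensor
  rw [e₁, e₂] at key
  simpa only [Lin.tensorSum (K := K) _ F, hF₁] using congrArg F key

theorem sum_counit_left_one (hR : IsQuasiTriangular K H R) :
    tensorSum R (fun a b => counit (R := K) a • b) = 1 := by
  have key := hR.sum_comul_left (fun x y z => counit (R := K) x • y ⊗ₜ[K] z)
  have (b a : H) := sw_counit_left (K := K) (fun y => y ⊗ₜ[K] b) a
  simp only [this, tensorSum_tmul_self] at key
  have h₂ : tensorSum R (fun a b => tensorSum R (fun c d => counit (R := K) a • c ⊗ₜ[K] (b * d))) =
      (1 ⊗ₜ tensorSum R (fun a b => counit (R := K) a • b)) * R := by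
    conv_rhs => enter [2]; rw [← tensorSum_tmul_self R]
    simp only [tmul_tensorSum, tensorSum_mul, mul_tensorSum, Algebra.TensorProduct.tmul_mul_tmul,
      one_mul, tmul_smul, smul_mul_assoc]
    rw [tensorSum_comm]
  rw [h₂, eq_comm, hR.isUnit.mul_eq_right] at key
  simpa [Algebra.TensorProduct.one_def] using
    congrArg (fun t => TensorProduct.lid K H (counit.rTensor H t)) key

theorem sum_counit_right_one (hR : IsQuasiTriangular K H R) :
    tensorSum R (fun a b => counit (R := K) b • a) = 1 := by
  have key := hR.sum_comul_right (fun x y z => counit (R := K) z • x ⊗ₜ[K] y)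
  have (b a : H) := sw_counit_right (K := K) (fun y => b ⊗ₜ[K] y) a
  simp only [this, tensorSum_tmul_self] at key
  have h₂ : tensorSum R (fun a b => tensorSum R (fun c d => counit (R := K) b • (a * c) ⊗ₜ[K] d)) =
      (tensorSum R (fun a b => counit (R := K) b • a) ⊗ₜ 1) * R := by
    conv_rhs => enter [2]; rw [← tensorSum_tmul_self R]
    simp only [tensorSum_tmul', tensorSum_mul, mul_tensorSum, Algebra.TensorProduct.tmul_mul_tmul,
      one_mul, ← smul_tmul', smul_mul_assoc]
    rw [tensorSum_comm]
  rw [h₂, eq_comm, hR.isUnit.mul_eq_right] at key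
  simpa [Algebra.TensorProduct.one_def] using
    congrArg (fun t => TensorProduct.rid K H (counit.lTensor H t)) key

theorem sum_counit_left (hR : IsQuasiTriangular K H R) (f : H → P) [Lin K f] :
    tensorSum R (fun a b => counit (R := K) a • f b) = f 1 := by
  rw [← hR.sum_counit_left_one, Lin.tensorSum (K := K) R f]
  exact tensorSum_congr _ fun a b => (Lin.smul (f := f) _ _).symm

theorem sum_counit_right (hR : IsQuasiTriangular K H R) (f : H → P) [Lin K f] :
    tensorSum R (fun a b => counit (R := K) b • f a) = f 1 := by
  rw [← hR.sum_counit_right_one, Lin.tensorSum (K := K) R f]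
  exact tensorSum_congr _ fun a b => (Lin.smul (f := f) _ _).symm

section

variable (f : H → H → P) [∀ y, Lin K (fun x => f x y)] [∀ x, Lin K (fun y => f x y)]

theorem sum_antipode_mul (hR : IsQuasiTriangular K H R) :
    tensorSum R (fun a b => tensorSum R (fun c d => f (antipode K a * c) (b * d))) = f 1 1 := by
  have key := hR.sum_comul_left (fun x y z => Lin.toMap₂ (K := K) f (antipode K x * y) z)
  have (b a : H) := sw_antipode_mul (K := K) (fun x => Lin.toMap₂ (K := K) f x b) a
  simp only [this] at key
  rw [hR.sum_counit_left (fun x => Lin.toMap₂ (K := K) f 1 x)] at key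
  exact key.symm

theorem sum_mul_antipode_right (hR : IsQuasiTriangular K H R) :
    tensorSum R (fun a b => tensorSum R (fun c d => f (a * c) (antipode K d * b))) = f 1 1 := by
  have key := hR.sum_comul_right (fun x y z => Lin.toMap₂ (K := K) f x (antipode K y * z))
  have (b a : H) := sw_antipode_mul (K := K) (fun x => Lin.toMap₂ (K := K) f b x) a
  simp only [this] at key
  rw [hR.sum_counit_right (fun x => Lin.toMap₂ (K := K) f x 1)] at key
  exact key.symm

theorem sum_mul_antipode (hR : IsQuasiTriangular K H R) :
    tensorSum R (fun a b => tensorSum R (fun c d => f (a * antipode K c) (b * d))) = f 1 1 := by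
  have h₁ : tensorSum R (fun a b => antipode K a ⊗ₜ[K] b) * R = 1 := by
    conv_lhs => enter [2]; rw [← tensorSum_tmul_self R]
    simp only [tensorSum_mul, mul_tensorSum, Algebra.TensorProduct.tmul_mul_tmul]
    rw [tensorSum_comm, hR.sum_antipode_mul (fun x y => x ⊗ₜ[K] y), Algebra.TensorProduct.one_def]
  have h₂ : R * tensorSum R (fun a b => antipode K a ⊗ₜ[K] b) = 1 := by
    obtain ⟨u, hu⟩ := hR.isUnit
    rw [← hu] at h₁ ⊢
    rw [← Units.inv_eq_of_mul_eq_one_left h₁, Units.mul_inv]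
  have h₃ : R * tensorSum R (fun a b => antipode K a ⊗ₜ[K] b) = tensorSum R (fun a b =>
      tensorSum R (fun c d => (a * antipode K c) ⊗ₜ[K] (b * d))) := by
    conv_lhs => enter [1]; rw [← tensorSum_tmul_self R]
    simp only [tensorSum_mul, mul_tensorSum, Algebra.TensorProduct.tmul_mul_tmul]
    rw [tensorSum_comm]
  have := congrArg (fun t => tensorSum t f) (h₃.symm.trans h₂)
  simpa only [tensorSum_tensorSum f, tensorSum_tmul f, Algebra.TensorProduct.one_def] using this

theorem sum_antipode_antipode (hR : IsQuasiTriangular K H R) :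
    tensorSum R (fun a b => f (antipode K a) (antipode K b)) = tensorSum R f := by
  let g := Lin.toMap₂ (K := K) f
  have h₁ := tensorSum_congr R fun s s' => hR.sum_mul_antipode_right (fun x y =>
    g (x * antipode K s) (antipode K s' * y))
  have h₂ := tensorSum_congr R fun a b => hR.sum_mul_antipode (fun x y =>
    g (a * x) (antipode K y * b))
  simp only [one_mul, mul_one, antipode_mul_antidistrib, antipode_one, one_mul, mul_assoc] at h₁ h₂
  have h₃ (a b : H) := tensorSum_comm R R fun s s' c d =>
    g (a * (c * antipode K s)) (antipode K s' * (antipode K d * b))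
  rw [tensorSum_comm] at h₁
  simp only [h₃, h₂] at h₁
  exact h₁.symm

/-- `R²S(h₍₂₎) ⊗ h₍₁₎R¹ = S(h₍₁₎)R² ⊗ R¹h₍₂₎`. -/
theorem sum_mul_antipode_comm (hR : IsQuasiTriangular K H R) (h : H) :
    tensorSum R (fun a b => sw K h (fun x y => f (b * antipode K y) (x * a))) =
      tensorSum R (fun a b => sw K h (fun x y => f (antipode K x * b) (a * y))) := by
  let g := Lin.toMap₂ (K := K) f
  have h₁ (a b u v : H) := sw_cancel_mul_antipode (K := K) (fun z t =>
    g (antipode K u * (b * t)) (a * z)) v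
  have h₂ (a b u v : H) := sw_coassoc (K := K) v fun z p q =>
    g (antipode K u * (b * (p * antipode K q))) (a * z)
  have h₃ (u q y : H) := hR.sum_intertwine y fun c d =>
    g (antipode K u * (d * antipode K q)) c
  have h₄ (a b u v : H) := sw_coassoc (K := K) v fun z p q =>
    g (antipode K u * (z * (b * antipode K q))) (p * a)
  have h₅ (a b : H) := sw_antipode_mul_cancel (K := K) (fun t w =>
    sw K w (fun p q => g (t * (b * antipode K q)) (p * a))) h
  simp only [mul_one, one_mul, mul_assoc] at h₁ h₂ h₃ h₄ h₅
  change tensorSum R (fun a b => sw K h (fun x y => g (b * antipode K y) (x * a))) =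
      tensorSum R (fun a b => sw K h (fun x y => g (antipode K x * b) (a * y)))
  calc _ = tensorSum R (fun a b => sw K h fun u v => sw K v fun y q => sw K y fun z p =>
            g (antipode K u * (z * (b * antipode K q))) (p * a)) := by
        simp only [h₄, h₅]
    _ = sw K h fun u v => sw K v fun y q => tensorSum R (fun a b => sw K y fun z p =>
            g (antipode K u * (z * (b * antipode K q))) (p * a)) := by
        rw [tensorSum_comm]
        exact tensorSum_congr _ fun _ _ => tensorSum_comm ..
    _ = sw K h fun u v => sw K v fun y q => tensorSum R (fun a b => sw K y fun z p =>
            g (antipode K u * (b * (p * antipode K q))) (a * z)) := by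
        simp only [h₃]
    _ = tensorSum R (fun a b => sw K h fun u v => sw K v fun y q => sw K y fun z p =>
            g (antipode K u * (b * (p * antipode K q))) (a * z)) := by
        rw [tensorSum_comm R]
        exact tensorSum_congr _ fun _ _ => (tensorSum_comm ..).symm
    _ = _ := by simp only [h₂, h₁]

end

/-- `h₍₂₎R¹ ⊗ h₍₁₎R²S(h₍₃₎) = R¹h ⊗ R²`. -/
theorem sum_mul_left (hR : IsQuasiTriangular K H R) (h : H) (f : H → H → P)
    [∀ y, Lin K (fun x => f x y)] [∀ x, Lin K (fun y => f x y)] :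
    tensorSum R (fun a b => sw K h (fun x y => sw K y (fun z w =>
      f (z * a) (x * (b * antipode K w))))) = tensorSum R (fun a b => f (a * h) b) := by
  let g := Lin.toMap₂ (K := K) f
  have h₁ (a b : H) := sw_coassoc (K := K) h fun x z w =>
    g (z * a) (x * (b * antipode K w))
  have h₂ (w u : H) := hR.sum_intertwine u fun c d => g c (d * antipode K w)
  have h₃ (a b : H) := sw_coassoc (K := K) h fun x z w =>
    g (a * x) (b * (z * antipode K w))
  have h₄ (a b : H) := sw_cancel_mul_antipode (K := K) (fun x y => g (a * x) (b * y)) h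
  simp only [mul_one, mul_assoc] at h₁ h₂ h₃ h₄
  change tensorSum R (fun a b => sw K h (fun x y => sw K y (fun z w =>
      g (z * a) (x * (b * antipode K w))))) = tensorSum R (fun a b => g (a * h) b)
  simp only [← h₁]
  rw [tensorSum_comm R]
  simp only [← h₂]
  rw [← tensorSum_comm R]
  simp only [h₃, h₄]

/-- `t S²(x) = x t` for `t = R²S²(R¹)`. -/
theorem sum_drinfeld_mul (hR : IsQuasiTriangular K H R) (h : H) :
    tensorSum R (fun a b => b * antipode K (antipode K a)) * antipode K (antipode K h) =
      h * tensorSum R (fun a b => b * antipode K (antipode K a)) := by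
  have h₁ := hR.sum_mul_left h (fun a b => b * antipode K (antipode K a))
  let g (a b : H) : H →ₗ[K] H →ₗ[K] H := Lin.toMap₂ (K := K) (fun x y : H =>
    x * (b * (antipode K y * antipode K (antipode K a))))
  have h₂ (a b : H) := sw_cancel_antipode_mul (K := K) (fun x y => g a b x y) h
  simp only [g, Lin.toMap₂, mk₂_apply] at h₂
  simp only [antipode_mul_antidistrib, antipode_one, mul_assoc, one_mul] at h₁ h₂
  simp only [h₂] at h₁
  simp only [mul_tensorSum, tensorSum_mul, mul_assoc]
  exact h₁.symm

end IsQuasiTriangular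

end QuasiTriangular

section Integrals

open Coalgebra HopfAlgebra

variable {K : Type} [Field K]

theorem tensorSum_mem {M N P : Type*} [AddCommGroup M] [Module K M] [AddCommGroup N] [Module K N]
    [AddCommGroup P] [Module K P] {p : Submodule K M} {q : Submodule K N} {s : Submodule K P}
    {t : M ⊗[K] N} (ht : t ∈ Submodule.map₂ (TensorProduct.mk K M N) p q) (f : M → N → P)
    [∀ y, Lin K (fun x => f x y)] [∀ x, Lin K (fun y => f x y)]
    (hf : ∀ x ∈ p, ∀ y ∈ q, f x y ∈ s) : tensorSum t f ∈ s := by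
  rw [tensorSum_eq_lift]
  have : Submodule.map₂ (TensorProduct.mk K M N) p q ≤
      s.comap (TensorProduct.lift (Lin.toMap₂ f)) := Submodule.map₂_le.2 hf
  exact this ht

theorem exists_idempotent_of_algHom {A : Type*} [Ring A] [Algebra K A] [IsSemisimpleRing A]
    (ε : A →ₐ[K] K) : ∃ e : A, ε e = 1 ∧ ∀ a, a * e = ε a • e := by
  obtain ⟨J, hJ⟩ := exists_isCompl (RingHom.ker ε : Submodule A A)
  obtain ⟨x, hx, e, he, h⟩ := Submodule.mem_sup.1 (hJ.sup_eq_top ▸ Submodule.mem_top : (1 : A) ∈ _)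
  have hε : ε e = 1 := by
    have := congrArg ε h
    rwa [map_add, (hx : ε x = 0), zero_add, map_one] at this
  refine ⟨e, hε, fun a => sub_eq_zero.1 ?_⟩
  have h₁ : a * e - ε a • e ∈ J := by
    rw [Algebra.smul_def]
    exact J.sub_mem (J.smul_mem a he) (J.smul_mem _ he)
  have h₂ : a * e - ε a • e ∈ (RingHom.ker ε : Submodule A A) :=
    show ε _ = 0 by simp [hε]
  simpa using hJ.disjoint.le_bot ⟨h₂, h₁⟩

variable {H : Type} [Ring H] [HopfAlgebra K H]

theorem exists_integral [IsSemisimpleRing H] : ∃ Λ : H, counit (R := K) Λ = 1 ∧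
    (∀ h, h * Λ = counit (R := K) h • Λ) ∧ ∀ h, Λ * h = counit (R := K) h • Λ := by
  obtain ⟨e, he₁, he⟩ := exists_idempotent_of_algHom (Bialgebra.counitAlgHom K H)
  obtain ⟨f, hf₁, hf⟩ := exists_idempotent_of_algHom
    ((Bialgebra.counitAlgHom K H).fromOpposite fun _ _ => mul_comm _ _)
  have hf' (h : H) : f.unop * h = counit (R := K) h • f.unop :=
    congrArg MulOpposite.unop (hf (.op h))
  have h : f.unop = e := by
    have h₁ := he f.unop
    rw [hf', show counit (R := K) e = 1 from he₁, one_smul] at h₁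
    rw [h₁, show Bialgebra.counitAlgHom K H f.unop = 1 from hf₁, one_smul]
  exact ⟨e, he₁, he, h ▸ hf'⟩

theorem exists_functional_eq_zero_of_one_notMem (s : Finset (Submodule K H))
    (hs : ∀ C ∈ s, IsSubcoalgebra K H C ∧ (1 : H) ∉ C) :
    ∃ φ : H →ₗ[K] K, φ 1 = 1 ∧ ∀ C ∈ s, ∀ x ∈ C, φ x = 0 := by
  classical
  induction s using Finset.induction_on with
  | empty => exact ⟨counit, Bialgebra.counit_one, by simp⟩
  | insert C s _ ih =>
    obtain ⟨φ, hφ₁, hφ⟩ := ih fun C hC => hs C (Finset.mem_insert_of_mem hC)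
    obtain ⟨ψ, hψ₁, hψ⟩ := Submodule.exists_le_ker_of_notMem
      (hs C (Finset.mem_insert_self _ _)).2
    let ψ' : H →ₗ[K] K := (ψ 1)⁻¹ • ψ
    have hχ (x : H) : TensorProduct.lift ((LinearMap.mul K K).compl₁₂ ψ' φ) (comul x) =
        sw K x (fun a b => ψ' a * φ b) := (tensorSum_eq _ _).symm
    refine ⟨TensorProduct.lift ((LinearMap.mul K K).compl₁₂ ψ' φ) ∘ₗ comul, ?_, ?_⟩
    · rw [LinearMap.comp_apply, hχ, sw_one (fun a b => ψ' a * φ b), hφ₁]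
      simp [ψ', hψ₁]
    · intro C' hC' x hx
      rw [LinearMap.comp_apply, hχ, ← Submodule.mem_bot K]
      refine tensorSum_mem ((hs C' hC').1 x hx) (fun a b => ψ' a * φ b) fun a ha b hb => ?_
      rw [Submodule.mem_bot]
      rcases Finset.mem_insert.1 hC' with rfl | h
      · simp [ψ', show ψ a = 0 from hψ ha]
      · rw [hφ C' h b hb, mul_zero]

theorem exists_cointegral [FiniteDimensional K H] (hH : IsCosemisimpleCoalgebra K H) :
    ∃ φ : H →ₗ[K] K, φ 1 = 1 ∧ (∀ h, sw K h (fun a b => φ b • a) = φ h • (1 : H)) ∧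
      ∀ h, sw K h (fun a b => φ a • b) = φ h • (1 : H) := by
  obtain ⟨s, hs, hs'⟩ := CompleteLattice.WellFoundedGT.isSupFiniteCompact (Submodule K H)
    {C | IsSimpleSubcoalgebra K H C ∧ (1 : H) ∉ C}
  obtain ⟨φ, hφ₁, hφ⟩ := exists_functional_eq_zero_of_one_notMem s fun C hC =>
    ⟨(hs hC).1.2.1, (hs hC).2⟩
  have hφ' (C : Submodule K H) (hC : IsSimpleSubcoalgebra K H C) (h : (1 : H) ∉ C) :
      C ≤ LinearMap.ker φ := by
    refine le_trans (hs' ▸ le_sSup ⟨hC, h⟩) (Finset.sup_le fun C hC x hx => hφ C hC x hx)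
  have : Nontrivial H := Bialgebra.nontrivial K
  have hspan (C : Submodule K H) (hC : IsSimpleSubcoalgebra K H C) (h : (1 : H) ∈ C) :
      C = Submodule.span K {1} := by
    refine ((hC.2.2 _ (by simpa using h) fun a ha => ?_).resolve_left (by simp)).symm
    obtain ⟨c, rfl⟩ := Submodule.mem_span_singleton.1 ha
    rw [map_smul, Bialgebra.comul_one, Algebra.TensorProduct.one_def]
    exact Submodule.smul_mem _ _ (Submodule.apply_mem_map₂ _ (Submodule.mem_span_singleton_self _)
      (Submodule.mem_span_singleton_self _))
  have key (F : H → H) [Lin K F] (hF₁ : F 1 = φ 1 • 1)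
      (hF : ∀ C : Submodule K H, C ≤ LinearMap.ker φ → IsSubcoalgebra K H C →
        ∀ x ∈ C, F x = 0) (x : H) : F x = φ x • 1 := by
    have hle : sSup {D : Submodule K H | IsSimpleSubcoalgebra K H D} ≤
        LinearMap.ker (Lin.toMap (K := K) F - φ.smulRight 1) := by
      refine sSup_le fun C hC x hx => sub_eq_zero.2 (show F x = φ x • 1 from ?_)
      by_cases h : (1 : H) ∈ C
      · rw [hspan C hC h] at hx
        obtain ⟨c, rfl⟩ := Submodule.mem_span_singleton.1 hx
        rw [(‹Lin K F›).smul, hF₁, map_smul, smul_assoc]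
      · rw [hF C (hφ' C hC h) hC.2.1 x hx, (hφ' C hC h hx : φ x = 0), zero_smul]
    rw [hH] at hle
    exact sub_eq_zero.1 (hle (Submodule.mem_top (x := x)))
  refine ⟨φ, hφ₁, key _ (sw_one fun a b => φ b • a) fun C h hC x hx => ?_,
    key _ (sw_one fun a b => φ a • b) fun C h hC x hx => ?_⟩
  · refine (Submodule.mem_bot K).1 (tensorSum_mem (hC x hx) (fun a b => φ b • a) fun a _ b hb => ?_)
    rw [(h hb : φ b = 0), zero_smul, Submodule.mem_bot]
  · refine (Submodule.mem_bot K).1 (tensorSum_mem (hC x hx) (fun a b => φ a • b) fun a ha b _ => ?_)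
    rw [(h ha : φ a = 0), zero_smul, Submodule.mem_bot]

end Integrals

section Frobenius

open Coalgebra HopfAlgebra

variable {K : Type} [Field K] {H : Type} [Ring H] [HopfAlgebra K H]

/-- A normalized two-sided integral `φ` on `H`. -/
structure IsCointegral (φ : H →ₗ[K] K) : Prop where
  map_one : φ 1 = 1
  right : ∀ h, sw K h (fun a b => φ b • a) = φ h • (1 : H)
  left : ∀ h, sw K h (fun a b => φ a • b) = φ h • (1 : H)

namespace IsCointegral

variable {P : Type*} [AddCommGroup P] [Module K P] {φ : H →ₗ[K] K} (hφ : IsCointegral φ)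
  (f : H → P) [hf : Lin K f]

include hφ

theorem sw_right (h : H) : sw K h (fun a b => φ b • f a) = φ h • f 1 := by
  rw [← hf.smul, ← hφ.right, Lin.tensorSum (K := K) _ f]
  simp only [hf.smul]

theorem sw_left (h : H) : sw K h (fun a b => φ a • f b) = φ h • f 1 := by
  rw [← hf.smul, ← hφ.left, Lin.tensorSum (K := K) _ f]
  simp only [hf.smul]

theorem sw_mul_left (x y : H) : sw K x (fun a b => φ (b * y) • f (antipode K a)) =
    sw K y (fun a b => φ (x * b) • f a) := by
  have h (a b : H) : φ (b * y) • f (antipode K a) =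
      sw K b (fun b₁ b₂ => sw K y (fun c d => φ (b₂ * d) • f (antipode K a * (b₁ * c)))) := by
    have (a : H) : Lin K fun u => f (antipode K a * u) := .comp hf inferInstance
    have (a d : H) : Lin K fun u => f (antipode K a * (u * d)) := .comp hf inferInstance
    have := hφ.sw_right (fun u => f (antipode K a * u)) (b * y)
    rw [mul_one] at this
    rw [← this, sw_mul fun u v => φ v • f (antipode K a * u)]
  simp only [h]
  have (b c : H) : Lin K fun a => f (antipode K a * (b * c)) := .comp hf inferInstance
  have (a c : H) : Lin K fun b => f (antipode K a * (b * c)) := .comp hf inferInstance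
  simp only [← mul_assoc]
  have (c : H) : Lin K fun a => f (a * c) := .comp hf inferInstance
  rw [sw_antipode_mul_cancel (fun u v => sw K y (fun c d => φ (v * d) • f (u * c)))]
  simp only [one_mul]

theorem sw_mul_right (x y : H) : sw K y (fun a b => φ (x * a) • f (antipode K b)) =
    sw K x (fun a b => φ (a * y) • f b) := by
  have h (a b : H) : φ (x * a) • f (antipode K b) =
      sw K x (fun c d => sw K a (fun p q => φ (c * p) • f (d * (q * antipode K b)))) := by
    have (b : H) : Lin K fun u => f (u * antipode K b) := .comp hf inferInstance
    have := hφ.sw_left (fun u => f (u * antipode K b)) (x * a)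
    rw [one_mul] at this
    rw [← this, sw_mul fun u v => φ u • f (v * antipode K b)]
    simp only [mul_assoc]
  have (u : H) : Lin K fun v => f (u * v) := .comp hf inferInstance
  have (u v : H) : Lin K fun z => f (u * (v * z)) := .comp hf inferInstance
  have (u v : H) : Lin K fun z => f (u * (v * antipode K z)) := .comp hf inferInstance
  have (u v : H) : Lin K fun z => f (u * (z * v)) := .comp hf inferInstance
  rw [tensorSum_congr _ h, tensorSum_comm]
  refine tensorSum_congr _ fun c d => ?_
  rw [sw_coassoc y fun p q b => φ (c * p) • f (d * (q * antipode K b)),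
    sw_cancel_mul_antipode fun u v => φ (c * u) • f (d * v), mul_one]

theorem sw_mul_antipode (x y : H) : sw K y (fun a b => φ (x * antipode K a) • f b) =
    sw K x (fun a b => φ (b * antipode K y) • f a) := by
  have h (a b : H) : φ (x * antipode K a) • f b = sw K x (fun c d => sw K a (fun p q =>
      φ (d * antipode K p) • f (c * (antipode K q * b)))) := by
    have (b : H) : Lin K fun u => f (u * b) := .comp hf inferInstance
    have (c b : H) : Lin K fun u => f (c * u * b) := .comp hf inferInstance
    have := hφ.sw_right (fun u => f (u * b)) (x * antipode K a)
    rw [one_mul] at this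
    rw [← this, sw_mul fun u v => φ v • f (u * b), tensorSum_congr _ fun c d =>
      sw_antipode_comul (fun p q => φ (d * q) • f (c * p * b)) a]
    simp only [mul_assoc]
  have (u : H) : Lin K fun v => f (u * v) := .comp hf inferInstance
  have (u v : H) : Lin K fun z => f (u * (v * z)) := .comp hf inferInstance
  have (u v : H) : Lin K fun z => f (u * (antipode K z * v)) := .comp hf inferInstance
  rw [tensorSum_congr _ h, tensorSum_comm]
  refine tensorSum_congr _ fun c d => ?_
  rw [sw_coassoc y fun p q b => φ (d * antipode K p) • f (c * (antipode K q * b)),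
    sw_cancel_antipode_mul fun u v => φ (d * antipode K u) • f (c * v), mul_one]

variable [FiniteDimensional K H]

theorem eq_zero_of_forall_mul (y : H) (hy : ∀ x, φ (x * y) = 0) : y = 0 := by
  let Ψ : H →ₗ[K] Module.Dual K H := (LinearMap.mul K H).flip.compr₂ φ
  have hε : counit (R := K) (A := H) ∈ LinearMap.range Ψ.dualMap := by
    rw [LinearMap.range_dualMap_eq_dualAnnihilator_ker, Submodule.mem_dualAnnihilator]
    intro z hz
    have hz (x : H) : φ (x * z) = 0 := LinearMap.congr_fun hz x
    have h₁ (x : H) : sw K z (fun a b => φ (x * b) • a) = 0 := by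
      rw [← hφ.sw_mul_left (fun a => a) x z]
      simp [hz, tensorSum]
    have h₂ : sw K z (fun a b => φ (antipode K a * b)) = 0 := by
      let e := Module.finBasis K H
      have (a b : H) : φ (antipode K a * b) =
          ∑ i, e.coord i (antipode K (φ (e i * b) • a)) := by
        conv_lhs => rw [← e.sum_repr (antipode K a), Finset.sum_mul, map_sum]
        simp [mul_comm]
      simp only [this]
      rw [tensorSum, Finset.sum_comm]
      refine Finset.sum_eq_zero fun i _ => ?_
      have := congrArg (fun u => e.coord i (antipode K u)) (h₁ (e i))
      simpa [tensorSum] using this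
    rw [sw_antipode_mul φ, hφ.map_one] at h₂
    simpa using h₂
  obtain ⟨L, hL⟩ := hε
  obtain ⟨x, rfl⟩ := (Module.evalEquiv K H).surjective L
  have h := sw_counit_right (K := K) (fun a : H => a) y
  rw [← h, ← hL]
  have h₁ := hφ.sw_mul_left (fun a => a) x y
  simp only [hy, zero_smul] at h₁
  refine Eq.trans ?_ (h₁.symm.trans ?_)
  · rfl
  · simp [tensorSum]

theorem exists_eq_mul (g : H →ₗ[K] K) : ∃ y, ∀ x, g x = φ (x * y) := by
  let Ψ : H →ₗ[K] Module.Dual K H := (LinearMap.mul K H).flip.compr₂ φ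
  have h : Function.Injective Ψ := (injective_iff_map_eq_zero Ψ).2 fun y hy =>
    hφ.eq_zero_of_forall_mul y (LinearMap.congr_fun hy)
  obtain ⟨y, hy⟩ := (LinearMap.injective_iff_surjective_of_finrank_eq_finrank
    Subspace.dual_finrank_eq.symm).1 h g
  exact ⟨y, fun x => (LinearMap.congr_fun hy x).symm⟩

theorem exists_integral_apply_eq_one [IsSemisimpleRing H] : ∃ Λ : H, φ Λ = 1 ∧
    (∀ h, h * Λ = counit (R := K) h • Λ) ∧ ∀ h, Λ * h = counit (R := K) h • Λ := by
  obtain ⟨Λ, hΛ₁, hΛ, hΛ'⟩ := exists_integral (K := K) (H := H)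
  obtain ⟨y, hy⟩ := hφ.exists_eq_mul counit
  have hl : Λ * y = y := by
    refine sub_eq_zero.1 (hφ.eq_zero_of_forall_mul _ fun x => ?_)
    rw [mul_sub, map_sub, ← mul_assoc, ← hy, ← hy, Bialgebra.counit_mul, hΛ₁, mul_one, sub_self]
  have h₁ : counit (R := K) y * φ Λ = 1 := by
    have := hy 1
    rw [Bialgebra.counit_one, one_mul, ← hl, hΛ', map_smul, smul_eq_mul] at this
    exact this.symm
  exact ⟨y, by rw [← one_mul y, ← hy, Bialgebra.counit_one], fun h => by
    rw [← hl, hΛ', mul_smul_comm, hΛ, smul_comm], fun h => by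
    rw [← hl, hΛ', smul_mul_assoc, hΛ', smul_comm]⟩

theorem exists_antipode_eq [IsSemisimpleRing H] (x : H) : ∃ y, antipode K y = x := by
  obtain ⟨Λ, hφΛ, hΛ, hΛ'⟩ := hφ.exists_integral_apply_eq_one
  refine ⟨sw K Λ (fun a b => φ (b * x) • a), ?_⟩
  have h := hφ.sw_mul_left (fun a => a) Λ x
  simp only [hΛ', map_smul, hφΛ, smul_eq_mul, mul_one] at h
  rw [map_tensorSum]
  simp only [map_smul]
  exact h.trans (sw_counit_right (K := K) (fun a : H => a) x)

theorem antipode_injective [IsSemisimpleRing H] :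
    Function.Injective (antipode K : H →ₗ[K] H) :=
  LinearMap.injective_iff_surjective.2 hφ.exists_antipode_eq

theorem apply_antipode [IsSemisimpleRing H] (h : H) : φ (antipode K h) = φ h := by
  have h₁ := hφ.sw_right (fun a => φ (antipode K a)) h
  have h₂ := hφ.right (antipode K h)
  rw [sw_antipode_comul (fun a b => φ b • a)] at h₂
  have h₃ : sw K h (fun a b => φ (antipode K a) • b) = φ (antipode K h) • 1 := by
    apply hφ.antipode_injective
    rw [map_tensorSum, map_smul, HopfAlgebra.antipode_one, ← h₂]
    simp only [map_smul]
  have h₄ := congrArg φ h₃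
  rw [map_tensorSum, map_smul, hφ.map_one, smul_eq_mul, mul_one] at h₄
  rw [HopfAlgebra.antipode_one, hφ.map_one, smul_eq_mul, mul_one] at h₁
  rw [← h₄, ← h₁]
  simp only [map_smul, smul_eq_mul, mul_comm]

/-- The Nakayama automorphism of the Frobenius form `φ` is `S²`. -/
theorem apply_mul_comm [IsSemisimpleRing H] (x y : H) :
    φ (x * y) = φ (y * antipode K (antipode K x)) := by
  obtain ⟨Λ, hφΛ, hΛ, hΛ'⟩ := hφ.exists_integral_apply_eq_one
  have h₁ (x : H) : sw K Λ (fun a b => φ (x * antipode K a) • b) = x := by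
    obtain ⟨w, rfl⟩ := hφ.exists_antipode_eq x
    have := hφ.sw_mul_right (fun a => a) Λ w
    simp only [hΛ', map_smul, hφΛ, smul_eq_mul, mul_one] at this
    simp only [← HopfAlgebra.antipode_mul_antidistrib, hφ.apply_antipode]
    rw [← this, sw_counit_left (K := K) (fun a : H => antipode K a)]
  have h₂ (x : H) : sw K Λ (fun a b => φ (antipode K a * x) •
      antipode K (antipode K b)) = x := by
    obtain ⟨w, rfl⟩ := hφ.exists_antipode_eq x
    have := hφ.sw_mul_right (fun a => a) w Λ
    simp only [hΛ, map_smul, hφΛ, smul_eq_mul, mul_one] at this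
    rw [sw_counit_left (K := K) (fun a : H => a)] at this
    simp only [← HopfAlgebra.antipode_mul_antidistrib, hφ.apply_antipode]
    conv_rhs => rw [← this, map_tensorSum]
    simp only [map_smul]
  have h₃ : sw K Λ (fun a b => φ (x * antipode K a) • antipode K (antipode K b)) =
      sw K Λ (fun a b => φ (antipode K a * antipode K (antipode K x)) •
        antipode K (antipode K b)) := by
    rw [h₂]
    conv_rhs => rw [← h₁ x, map_tensorSum, map_tensorSum]
    simp only [map_smul]
  have h₄ : sw K Λ (fun a b => φ (b * y) • antipode K a) = y := by
    have := hφ.sw_mul_left (fun a => a) Λ y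
    simp only [hΛ', map_smul, hφΛ, smul_eq_mul, mul_one] at this
    rw [this, sw_counit_right (K := K) (fun a : H => a)]
  have h₅ := congrArg (fun u => φ (u * antipode K (antipode K y))) h₃
  simp only [tensorSum_mul (K := K), map_tensorSum, smul_mul_assoc, map_smul,
    ← HopfAlgebra.antipode_mul_antidistrib, hφ.apply_antipode, smul_eq_mul] at h₅
  have h₆ := congrArg (fun u => φ (x * u)) h₄
  have h₇ := congrArg (fun u => φ (u * antipode K (antipode K x))) h₄
  simp only [mul_tensorSum (K := K), tensorSum_mul (K := K), map_tensorSum, smul_mul_assoc,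
    mul_smul_comm, map_smul, smul_eq_mul] at h₆ h₇
  rw [← h₆, ← h₇]
  simpa only [mul_comm, ← HopfAlgebra.antipode_mul_antidistrib, hφ.apply_antipode] using h₅

end IsCointegral
end Frobenius

section BraidedForm

open Coalgebra HopfAlgebra

variable {K : Type} [Field K] {P : Type*} [AddCommGroup P] [Module K P]
  {H : Type} [Ring H] [HopfAlgebra K H] {R : H ⊗[K] H}

theorem deltaR_eq (h : H) : deltaR K H R h = sw K h (fun a b => tensorSum R (fun r s =>
    (a * antipode K s) ⊗ₜ[K] adLin K H r b)) := by
  rw [deltaR]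
  simp only [LinearMap.comp_apply]
  conv_lhs => rw [← tensorSum_tmul_self (comul h), map_tensorSum]
  simp only [map_tensorSum]
  refine tensorSum_congr _ fun a b => ?_
  conv_lhs => rw [← tensorSum_tmul_self R]
  simp only [map_tensorSum, LinearMap.flip_apply, TensorProduct.mk_apply]
  rfl

theorem sum_deltaR (h : H) (f : H → H → P) [∀ y, Lin K (fun x => f x y)]
    [∀ x, Lin K (fun y => f x y)] : tensorSum (deltaR K H R h) f =
      sw K h (fun a b => tensorSum R (fun r s => f (a * antipode K s) (adLin K H r b))) := by
  rw [deltaR_eq]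
  simp only [tensorSum_tensorSum f, tensorSum_tmul f]

theorem sw_antipode_mul_antipode_adLin (h z : H) :
    sw K h (fun a b => antipode K b * antipode K (adLin K H a z)) =
      antipode K z * antipode K h := by
  simp only [adLin_eq, map_tensorSum, mul_tensorSum, antipode_mul_antidistrib]
  rw [sw_coassoc h fun c d b =>
      antipode K b * (antipode K (antipode K d) * (antipode K z * antipode K c)),
    tensorSum_congr _ fun c v => tensorSum_congr _ fun d b =>
      show _ = antipode K (antipode K d * b) * (antipode K z * antipode K c) by
        rw [antipode_mul_antidistrib, mul_assoc],
    sw_cancel_antipode_mul fun c u => antipode K u * (antipode K z * antipode K c),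
    antipode_one, one_mul]

theorem sw_adLin (h y : H) (f : H → H → P) [∀ y, Lin K (fun x => f x y)]
    [∀ x, Lin K (fun y => f x y)] : sw K (adLin K H h y) f = sw K h (fun a b => sw K b (fun c d =>
      sw K y (fun p q => f (a * (p * antipode K d)) (adLin K H c q)))) := by
  let g := Lin.toMap₂ (K := K) f
  let F (a b c d : H) : P := sw K y (fun p q => g (a * (p * antipode K d)) (b * (q * antipode K c)))
  have hl : sw K (adLin K H h y) f =
      sw K h (fun u b => sw K u (fun a₁ a₂ => sw K b (fun b₁ b₂ => F a₁ a₂ b₁ b₂))) := by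
    rw [adLin_eq, map_tensorSum, tensorSum_tensorSum f]
    refine tensorSum_congr _ fun u b => ?_
    change sw K (u * y * antipode K b) (fun p q => g p q) = _
    rw [mul_assoc, sw_mul fun p q => g p q]
    refine tensorSum_congr _ fun a₁ a₂ => ?_
    rw [sw_mul fun p q => g (a₁ * p) (a₂ * q), tensorSum_congr _ fun p q =>
      sw_antipode_comul (fun c d => g (a₁ * (p * c)) (a₂ * (q * d))) b, tensorSum_comm]
  have hr : sw K h (fun a b => sw K b (fun c d => sw K y (fun p q =>
      f (a * (p * antipode K d)) (adLin K H c q)))) = sw K h (fun a b => sw K b (fun c d =>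
        sw K c (fun c₁ c₂ => F a c₁ c₂ d))) := by
    refine tensorSum_congr _ fun a b => tensorSum_congr _ fun c d => ?_
    rw [tensorSum_comm]
    refine tensorSum_congr _ fun p q => ?_
    change g _ _ = _
    rw [adLin_eq, map_tensorSum]
    simp only [mul_assoc]
  rw [hl, hr, sw_coassoc h fun a₁ a₂ b => sw K b (fun b₁ b₂ => F a₁ a₂ b₁ b₂)]
  exact tensorSum_congr _ fun a b => (sw_coassoc b fun c₁ c₂ d => F a c₁ c₂ d).symm

variable (R) in
/-- The bilinear form `φ(x R² S(R¹ · y))`. -/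
noncomputable def braidedForm (φ : H →ₗ[K] K) : H →ₗ[K] H →ₗ[K] K :=
  Lin.toMap₂ fun x y => tensorSum R fun a b => φ (x * (b * antipode K (adLin K H a y)))

theorem braidedForm_apply (φ : H →ₗ[K] K) (x y : H) : braidedForm R φ x y =
    tensorSum R fun a b => φ (x * (b * antipode K (adLin K H a y))) := rfl

namespace IsQuasiTriangular

variable (hR : IsQuasiTriangular K H R) {φ : H →ₗ[K] K} (hφ : IsCointegral φ)

include hR hφ

theorem sum_deltaR_braidedForm (x : H) : tensorSum (deltaR K H R x)
    (fun a b => braidedForm R φ a b) = counit (R := K) x := by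
  rw [sum_deltaR x fun a b => braidedForm R φ a b]
  simp only [braidedForm_apply, ← adLin_mul]
  have (a b : H) : tensorSum R (fun r s => tensorSum R fun p q =>
      φ (a * antipode K s * (q * antipode K (adLin K H (p * r) b)))) = φ (a * antipode K b) := by
    rw [tensorSum_comm]
    have := hR.sum_mul_antipode_right fun u v => φ (a * (v * antipode K (adLin K H u b)))
    rw [adLin_one, one_mul] at this
    simpa only [mul_assoc] using this
  simp only [this]
  rw [sw_mul_antipode φ, hφ.map_one, smul_eq_mul, mul_one]

variable [FiniteDimensional K H] [IsSemisimpleRing H]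

theorem sw_braidedForm_adLin_adLin (h x y : H) :
    sw K h (fun a b => braidedForm R φ (adLin K H a x) (adLin K H b y)) =
      counit (R := K) h * braidedForm R φ x y := by
  simp only [braidedForm_apply, ← adLin_mul]
  have h₁ (a b r s : H) : φ (adLin K H a x * (s * antipode K (adLin K H (r * b) y))) =
      sw K a (fun c d => φ (c * (x * (antipode K d * s * antipode K (adLin K H (r * b) y))))) := by
    simp only [adLin_eq a x, tensorSum_mul (K := K), map_tensorSum, mul_assoc]
  have h₂ (c v : H) : sw K v (fun d b => tensorSum R fun r s =>
      φ (c * (x * (antipode K d * s * antipode K (adLin K H (r * b) y))))) =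
      tensorSum R fun r s => φ (x * (s * antipode K (adLin K H r y) *
        antipode K (antipode K c * v))) := by
    rw [tensorSum_comm, ← hR.sum_mul_antipode_comm
      (fun u w => φ (c * (x * (u * antipode K (adLin K H w y))))) v]
    refine tensorSum_congr _ fun r s => ?_
    have := congrArg (fun u => φ (c * (x * (s * u))))
      (sw_antipode_mul_antipode_adLin (K := K) v (adLin K H r y))
    simp only [mul_tensorSum (K := K), map_tensorSum, ← adLin_mul, ← mul_assoc] at this
    simp only [← mul_assoc]
    rw [this, antipode_mul_antidistrib (R := K)]
    simp only [mul_assoc]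
    rw [hφ.apply_mul_comm c]
    simp only [mul_assoc]
  have h₃ := sw_coassoc (K := K) h fun c d b => tensorSum R fun r s =>
      φ (c * (x * (antipode K d * s * antipode K (adLin K H (r * b) y))))
  rw [tensorSum_congr (comul (R := K) h) fun a b => tensorSum_congr R fun r s => h₁ a b r s,
    tensorSum_congr (comul (R := K) h) fun a b => tensorSum_comm _ _ _, h₃,
    tensorSum_congr (comul (R := K) h) h₂, tensorSum_comm, ← smul_eq_mul, smul_tensorSum]
  refine tensorSum_congr _ fun r s => ?_
  rw [sw_antipode_mul (K := K) fun u => φ (x * (s * antipode K (adLin K H r y) * antipode K u)),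
    antipode_one, mul_one]

theorem braidedForm_adLin_left (h x y : H) :
    braidedForm R φ (adLin K H h x) y = braidedForm R φ x (adLin K H (antipode K h) y) := by
  have h₁ := sw_cancel_mul_antipode (K := K) (fun u v => braidedForm R φ (adLin K H u x)
    (adLin K H v y)) h
  rw [adLin_one] at h₁
  simp only [adLin_mul] at h₁
  rw [← h₁, ← sw_coassoc h fun a c d => braidedForm R φ (adLin K H a x)
    (adLin K H c (adLin K H (antipode K d) y)), tensorSum_congr _ fun a b =>
    hR.sw_braidedForm_adLin_adLin hφ a x (adLin K H (antipode K b) y)]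
  exact sw_counit_left (K := K) (fun b => braidedForm R φ x (adLin K H (antipode K b) y)) h

theorem sum_deltaR_braidedForm_smul (x y : H) (f : H →ₗ[K] P) :
    tensorSum (deltaR K H R x) (fun a b => braidedForm R φ b y • f a) =
      tensorSum (deltaR K H R y) (fun a b => braidedForm R φ x a • f b) := by
  have hl : tensorSum (deltaR K H R x) (fun a b => braidedForm R φ b y • f a) =
      tensorSum R fun a b => tensorSum R fun c d => tensorSum R fun e g => sw K y (fun p q =>
        φ (x * (b * (d * (g * (antipode K (antipode K e) * (antipode K p * antipode K a)))))) •
          f (adLin K H c q)) := by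
    rw [sum_deltaR x fun a b => braidedForm R φ b y • f a]
    simp only [hR.braidedForm_adLin_left hφ]
    rw [tensorSum_congr _ fun a b => hR.sum_antipode_antipode fun r s =>
      braidedForm R φ b (adLin K H r y) • f (a * s)]
    simp only [braidedForm_apply, ← adLin_mul, tensorSum_smul]
    have h₁ (a b : H) := hR.sum_comul_right fun u v w =>
      φ (b * (w * antipode K (adLin K H u y))) • f (a * v)
    have h₂ (r s : H) : sw K x (fun a b => sw K s (fun c d =>
        φ (b * (d * antipode K (adLin K H r y))) • f (a * c))) = sw K r (fun a b =>
          sw K b (fun c d => sw K y (fun p q =>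
            φ (x * (s * antipode K (a * (p * antipode K d)))) • f (adLin K H c q)))) := by
      have := hφ.sw_mul_antipode f (x * s) (adLin K H r y)
      rw [sw_mul fun a b => φ (b * antipode K (adLin K H r y)) • f a,
        sw_adLin r y fun a b => φ (x * s * antipode K a) • f b] at this
      simp only [mul_assoc] at this ⊢
      exact this.symm
    rw [tensorSum_congr _ fun a b => (tensorSum_comm R R _).trans (h₁ a b).symm, tensorSum_comm,
      tensorSum_congr _ h₂, hR.sum_comul_left fun a b s => sw K b (fun c d => sw K y (fun p q =>
            φ (x * (s * antipode K (a * (p * antipode K d)))) • f (adLin K H c q)))]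
    refine tensorSum_congr _ fun a b => ?_
    rw [hR.sum_comul_left fun c e d => sw K y (fun p q =>
      φ (x * (b * d * antipode K (a * (p * antipode K e)))) • f (adLin K H c q))]
    simp only [antipode_mul_antidistrib, mul_assoc]
  have hr : tensorSum (deltaR K H R y) (fun a b => braidedForm R φ x a • f b) =
      tensorSum R fun a b => tensorSum R fun c d => tensorSum R fun e g => sw K y (fun p q =>
        φ (x * (b * (g * (antipode K (antipode K e) * (antipode K (antipode K d) *
          (antipode K p * antipode K a)))))) • f (adLin K H c q)) := by
    rw [sum_deltaR y fun a b => braidedForm R φ x a • f b]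
    have h₁ (p d : H) : braidedForm R φ x (p * antipode K d) =
        tensorSum R fun a b => tensorSum R fun e g =>
          φ (x * (b * (g * (antipode K (antipode K e) * (antipode K (antipode K d) *
            (antipode K p * antipode K a)))))) := by
      have := hR.sum_comul_left fun a e b =>
        φ (x * (b * (antipode K (antipode K e) * (antipode K (antipode K d) *
          (antipode K p * antipode K a)))))
      simp only [mul_assoc] at this
      rw [← this, braidedForm_apply]
      simp only [adLin_eq, map_tensorSum, mul_tensorSum (K := K), antipode_mul_antidistrib,
        mul_assoc]
    simp only [h₁, tensorSum_smul]
    rw [tensorSum_congr (comul (R := K) y) fun p q => tensorSum_comm R R _,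
      tensorSum_comm]
    refine tensorSum_congr _ fun a b => ?_
    rw [tensorSum_comm]
    exact tensorSum_congr _ fun c d => tensorSum_comm _ _ _
  rw [hl, hr]
  refine tensorSum_congr _ fun a b => tensorSum_congr _ fun c d => ?_
  rw [tensorSum_comm, tensorSum_comm R]
  refine tensorSum_congr _ fun p q => ?_
  have h₃ := congrArg (fun u => φ (x * (b * (u * (antipode K p * antipode K a)))) •
    f (adLin K H c q)) (hR.sum_drinfeld_mul d)
  simp only [mul_tensorSum (K := K), tensorSum_mul (K := K), map_tensorSum, tensorSum_smul,
    mul_assoc] at h₃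
  exact h₃.symm

end IsQuasiTriangular

end BraidedForm

section Coaction

open Coalgebra HopfAlgebra

variable {K : Type} [Field K] {H : Type} [Ring H] [HopfAlgebra K H] {R : H ⊗[K] H}
  {V U Q : Type*} [AddCommGroup V] [Module K V] [AddCommGroup U] [Module K U]
  [AddCommGroup Q] [Module K Q]

theorem rTensor_eq_tensorSum (F : H →ₗ[K] U) (t : H ⊗[K] V) :
    rTensor V F t = tensorSum t fun a b => F a ⊗ₜ[K] b := by
  conv_lhs => rw [← tensorSum_tmul_self t]
  rw [map_tensorSum]; rfl

theorem lTensor_eq_tensorSum (F : V →ₗ[K] U) (t : H ⊗[K] V) :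
    lTensor H F t = tensorSum t fun a b => a ⊗ₜ[K] F b := by
  conv_lhs => rw [← tensorSum_tmul_self t]
  rw [map_tensorSum]; rfl

theorem tensorSum_lTensor (F : V →ₗ[K] U) (t : H ⊗[K] V) (f : H → U → Q)
    [∀ y, Lin K (fun x => f x y)] [∀ x, Lin K (fun y => f x y)] :
    tensorSum (lTensor H F t) f = tensorSum t fun a b => f a (F b) :=
  tensorSum_map f .id F t

variable (R) in
/-- `ρ` is a left coaction of the braided group `(H, Δ_R)`. -/
structure IsCoaction (ρ : V →ₗ[K] H ⊗[K] V) : Prop where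
  counit_coact : ∀ v : V, TensorProduct.lid K V (rTensor V (counit (R := K)) (ρ v)) = v
  coassocR : rTensor V (deltaR K H R) ∘ₗ ρ =
    (TensorProduct.assoc K H H V).symm.toLinearMap ∘ₗ lTensor H ρ ∘ₗ ρ

theorem RModStr.isCoaction (s : RModStr K H R V) : IsCoaction R s.coact :=
  ⟨s.counit_coact, s.coassocR⟩

theorem DComodStr.isCoaction {D : Submodule K H} (s : DComodStr K H R D V) :
    IsCoaction R s.coact := ⟨s.counit_coact, s.coassocR⟩

namespace IsCoaction

variable {ρ : V →ₗ[K] H ⊗[K] V} (hρ : IsCoaction R ρ)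
include hρ

theorem sum_counit (v : V) : tensorSum (ρ v) (fun a b => counit (R := K) a • b) = v := by
  conv_rhs => rw [← hρ.counit_coact v, rTensor_eq_tensorSum]
  change _ = (TensorProduct.lid K V).toLinearMap _
  rw [map_tensorSum]
  exact tensorSum_congr _ fun a b => (TensorProduct.lid_tmul _ _).symm

theorem sum_coassoc (v : V) (f : H → H → V → Q) [∀ y z, Lin K (fun x => f x y z)]
    [∀ x z, Lin K (fun y => f x y z)] [∀ x y, Lin K (fun z => f x y z)] :
    tensorSum (ρ v) (fun a b => tensorSum (ρ b) (fun c d => f a c d)) =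
      tensorSum (ρ v) (fun a b => tensorSum (deltaR K H R a) (fun p q => f p q b)) := by
  have h := LinearMap.congr_fun hρ.coassocR v
  simp only [LinearMap.comp_apply, rTensor_eq_tensorSum, lTensor_eq_tensorSum] at h
  have h' := congrArg (fun t => tensorSum t fun x b => tensorSum x fun p q => f p q b) h
  rw [tensorSum_tensorSum fun x b => tensorSum x fun p q => f p q b] at h'
  simp only [tensorSum_tmul fun (x : H ⊗[K] H) b => tensorSum x fun p q => f p q b] at h'
  rw [h', map_tensorSum, tensorSum_tensorSum fun x b => tensorSum x fun p q => f p q b]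
  refine tensorSum_congr _ fun a b => ?_
  conv_rhs => rw [← tensorSum_tmul_self (ρ b), tmul_tensorSum, map_tensorSum,
    tensorSum_tensorSum fun x b => tensorSum x fun p q => f p q b]
  refine tensorSum_congr _ fun c d => ?_
  change _ = tensorSum ((a ⊗ₜ[K] c) ⊗ₜ[K] d) _
  rw [tensorSum_tmul fun (x : H ⊗[K] H) b => tensorSum x fun p q => f p q b,
    tensorSum_tmul fun p q => f p q d]

end IsCoaction

/-- Linear maps intertwining two coactions. -/
def IsColinear (ρ : V →ₗ[K] H ⊗[K] V) (σ : U →ₗ[K] H ⊗[K] U) (f : V →ₗ[K] U) : Prop :=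
  lTensor H f ∘ₗ ρ = σ ∘ₗ f

theorem IsColinear.sum_coact {ρ : V →ₗ[K] H ⊗[K] V} {σ : U →ₗ[K] H ⊗[K] U} {f : V →ₗ[K] U}
    (hf : IsColinear ρ σ f) (v : V) (g : H → U → Q)
    [∀ y, Lin K (fun x => g x y)] [∀ x, Lin K (fun y => g x y)] :
    tensorSum (σ (f v)) g = tensorSum (ρ v) fun a b => g a (f b) := by
  rw [← LinearMap.comp_apply, ← hf, LinearMap.comp_apply, tensorSum_lTensor f _ g]

theorem isColinear_of_tmul {ρ : V →ₗ[K] H ⊗[K] V} {σ : U →ₗ[K] H ⊗[K] U} {f : V →ₗ[K] U}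
    (h : ∀ v, σ (f v) = tensorSum (ρ v) fun a b => a ⊗ₜ[K] f b) : IsColinear ρ σ f :=
  LinearMap.ext fun v => by
    rw [LinearMap.comp_apply, LinearMap.comp_apply, h, lTensor_eq_tensorSum]

section Average

/-- The average `v ↦ Σ B(v₍₋₁₎, p(v₍₀₎)₍₋₁₎) p(v₍₀₎)₍₀₎` of a linear map between comodules with
respect to a bilinear form `B`. -/
noncomputable def coactAverage (B : H →ₗ[K] H →ₗ[K] K) (ρ : V →ₗ[K] H ⊗[K] V)
    (σ : U →ₗ[K] H ⊗[K] U) (p : V →ₗ[K] U) : V →ₗ[K] U :=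
  Lin.toMap (K := K) fun v => tensorSum (ρ v) fun a b => tensorSum (σ (p b)) fun c d => B a c • d

theorem coactAverage_apply (B : H →ₗ[K] H →ₗ[K] K) (ρ : V →ₗ[K] H ⊗[K] V)
    (σ : U →ₗ[K] H ⊗[K] U) (p : V →ₗ[K] U) (v : V) : coactAverage B ρ σ p v =
      tensorSum (ρ v) fun a b => tensorSum (σ (p b)) fun c d => B a c • d := rfl

variable [FiniteDimensional K H] [IsSemisimpleRing H] (hR : IsQuasiTriangular K H R)
  {φ : H →ₗ[K] K} (hφ : IsCointegral φ) {ρ : V →ₗ[K] H ⊗[K] V} {σ : U →ₗ[K] H ⊗[K] U}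
  (hρ : IsCoaction R ρ) (hσ : IsCoaction R σ) (p : V →ₗ[K] U)

include hR hφ hρ hσ in
theorem isColinear_coactAverage : IsColinear ρ σ (coactAverage (braidedForm R φ) ρ σ p) := by
  refine isColinear_of_tmul fun v => ?_
  simp only [coactAverage_apply, map_tensorSum, map_smul]
  have h₁ (a : H) (b : V) : tensorSum (σ (p b)) (fun c d => braidedForm R φ a c • σ d) =
      tensorSum (σ (p b)) fun c d => tensorSum (deltaR K H R a) fun x y =>
        (braidedForm R φ y c) • (x ⊗ₜ[K] d) := by
    conv_lhs => rw [tensorSum_congr _ fun c d => by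
      rw [← tensorSum_tmul_self (σ d), smul_tensorSum]]
    have (y : H) (z : U) : Lin K fun x => braidedForm R φ a x • (y ⊗ₜ[K] z) :=
      .smul_left (f := fun x => braidedForm R φ a x) _
    have (x : H) (z : U) : Lin K fun y => braidedForm R φ a x • (y ⊗ₜ[K] z) :=
      .smul_right (f := fun y : H => y ⊗ₜ[K] z) _
    have (x y : H) : Lin K fun z : U => braidedForm R φ a x • (y ⊗ₜ[K] z) :=
      .smul_right (f := fun z : U => y ⊗ₜ[K] z) _
    rw [hσ.sum_coassoc (p b) fun c x y => braidedForm R φ a c • (x ⊗ₜ[K] y)]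
    refine tensorSum_congr _ fun c d => ?_
    have := hR.sum_deltaR_braidedForm_smul hφ a c ((TensorProduct.mk K H U).flip d)
    exact this.symm
  have h₂ := hρ.sum_coassoc v fun a c b => a ⊗ₜ[K]
    tensorSum (σ (p b)) fun c' d => braidedForm R φ c c' • d
  simp only [tmul_tensorSum] at h₂ ⊢
  rw [tensorSum_congr _ h₁, h₂]
  refine tensorSum_congr _ fun a b => ?_
  rw [tensorSum_comm]
  simp only [TensorProduct.tmul_smul]

omit [FiniteDimensional K H] [IsSemisimpleRing H] in
include hR hφ hσ in
theorem coactAverage_apply_of_leftInverse {f : U →ₗ[K] V} (hf : IsColinear σ ρ f)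
    (hpf : p ∘ₗ f = .id) (u : U) : coactAverage (braidedForm R φ) ρ σ p (f u) = u := by
  have h₁ (b : U) : p (f b) = b := LinearMap.congr_fun hpf b
  rw [coactAverage_apply, hf.sum_coact u fun a b => tensorSum (σ (p b)) fun c d =>
    braidedForm R φ a c • d]
  simp only [h₁]
  rw [hσ.sum_coassoc u fun a c d => braidedForm R φ a c • d]
  simp only [← tensorSum_smul, hR.sum_deltaR_braidedForm hφ]
  exact hσ.sum_counit u

end Average

end Coaction

section BraidedModule

open Coalgebra HopfAlgebra

variable {K : Type} [Field K] {H : Type} [Ring H] [HopfAlgebra K H] {R : H ⊗[K] H}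
  {V U Q : Type*} [AddCommGroup V] [Module K V] [AddCommGroup U] [Module K U]
  [AddCommGroup Q] [Module K Q]

instance Lin.act {M : Type*} [AddCommGroup M] [Module K M] (s : RModStr K H R V) {f : M → H}
    [hf : Lin K f] (v : V) : Lin K fun x => s.act (f x) v :=
  ⟨fun x y => by rw [hf.add, map_add, LinearMap.add_apply],
    fun c x => by rw [hf.smul, map_smul, LinearMap.smul_apply]⟩

theorem mem_homHD_iff {s : RModStr K H R V} {t : RModStr K H R U} {f : V →ₗ[K] U} :
    f ∈ homHD K H R s t ↔ (∀ h v, t.act h (f v) = f (s.act h v)) ∧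
      IsColinear s.coact t.coact f :=
  and_congr_left fun _ => forall_congr' fun _ => LinearMap.ext_iff

namespace RModStr

variable (s : RModStr K H R V)

theorem coact_act (h : H) (v : V) : s.coact (s.act h v) =
    sw K h (fun a b => tensorSum (s.coact v) fun c d => adLin K H a c ⊗ₜ[K] s.act b d) := by
  have := LinearMap.congr_fun s.compat (h ⊗ₜ v)
  simp only [LinearMap.comp_apply, TensorProduct.map_tmul, TensorProduct.lift.tmul,
    AlgHom.toLinearMap_apply] at this
  rw [this]
  conv_lhs => rw [← tensorSum_tmul_self (comul (R := K) h), ← tensorSum_tmul_self (s.coact v)]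
  simp only [tensorSum_tmul', tmul_tensorSum, map_tensorSum]
  rw [tensorSum_comm]
  rfl

theorem sum_coact_act (h : H) (v : V) (f : H → V → Q) [∀ y, Lin K (fun x => f x y)]
    [∀ x, Lin K (fun y => f x y)] : tensorSum (s.coact (s.act h v)) f =
      sw K h (fun a b => tensorSum (s.coact v) fun c d => f (adLin K H a c) (s.act b d)) := by
  rw [coact_act]
  simp only [tensorSum_tensorSum f, tensorSum_tmul f]

/-- The average `v ↦ Σ S(Λ₍₁₎) q(Λ₍₂₎ v)` of a linear map between `H`-modules with respect to an
integral `Λ`. -/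
noncomputable def actAverage (Λ : H) (s : RModStr K H R V) (t : RModStr K H R U)
    (q : V →ₗ[K] U) : V →ₗ[K] U :=
  Lin.toMap (K := K) fun v => sw K Λ (fun a b => t.act (antipode K a) (q (s.act b v)))

variable {s} {t : RModStr K H R U} {q : V →ₗ[K] U}

theorem actAverage_apply (Λ : H) (v : V) : actAverage Λ s t q v =
    sw K Λ (fun a b => t.act (antipode K a) (q (s.act b v))) := rfl

theorem sw_mul_antipode_integral {Λ : H} (hΛ : ∀ h, Λ * h = counit (R := K) h • Λ) (h : H)
    (f : H → H → Q) [∀ y, Lin K (fun x => f x y)] [∀ x, Lin K (fun y => f x y)] :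
    sw K Λ (fun a b => f (h * antipode K a) b) = sw K Λ (fun a b => f (antipode K a) (b * h)) := by
  have h₁ (z x : H) : sw K z (fun c d => sw K Λ (fun a b => f (x * antipode K c * antipode K a)
      (b * d))) = counit (R := K) z • sw K Λ (fun a b => f (x * antipode K a) b) := by
    have (y : H) : Lin K fun a => f (x * antipode K a) y :=
      .comp (f := fun a => f a y) inferInstance inferInstance
    have h₂ := sw_mul (K := K) (fun a b => f (x * antipode K a) b) Λ z
    rw [hΛ, map_smul, tensorSum_smul_left fun a b => f (x * antipode K a) b, tensorSum_comm] at h₂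
    simp only [h₂, antipode_mul_antidistrib, mul_assoc]
  have (x y : H) : Lin K fun z => f (z * antipode K x) y :=
    .comp (f := fun a => f a y) inferInstance inferInstance
  have (x y : H) : Lin K fun z => f x (y * z) :=
    .comp (f := fun a => f x a) inferInstance inferInstance
  have h₃ := sw_mul_antipode_cancel (K := K) (fun x y =>
    sw K Λ (fun a b => f (x * antipode K a) (b * y))) h
  simp only [h₁, one_mul] at h₃
  rw [← h₃, sw_counit_right fun x => sw K Λ (fun a b => f (x * antipode K a) b)]

theorem actAverage_mem_homHD {Λ : H} (hΛ : ∀ h, Λ * h = counit (R := K) h • Λ)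
    (hq : IsColinear s.coact t.coact q) : actAverage Λ s t q ∈ homHD K H R s t := by
  rw [mem_homHD_iff]
  constructor
  · intro h v
    simp only [actAverage_apply, map_tensorSum]
    have := sw_mul_antipode_integral hΛ h fun a b => t.act a (q (s.act b v))
    simpa only [map_mul, Module.End.mul_apply] using this
  · refine isColinear_of_tmul fun v => ?_
    have h₁ (a b : H) : t.coact (t.act (antipode K a) (q (s.act b v))) =
        sw K a (fun x y => sw K b (fun e g => tensorSum (s.coact v) fun c d =>
          adLin K H (antipode K y * e) c ⊗ₜ[K] t.act (antipode K x) (q (s.act g d)))) := by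
      have h₂ (x y : H) : tensorSum (t.coact (q (s.act b v)))
          (fun c d => adLin K H x c ⊗ₜ[K] t.act y d) =
          sw K b (fun e g => tensorSum (s.coact v) fun c d =>
            adLin K H (x * e) c ⊗ₜ[K] t.act y (q (s.act g d))) := by
        rw [hq.sum_coact (s.act b v) fun c d => adLin K H x c ⊗ₜ[K] t.act y d,
          s.sum_coact_act b v fun c d => adLin K H x c ⊗ₜ[K] t.act y (q d)]
        simp only [adLin_mul]
      rw [coact_act]
      simp only [h₂]
      rw [sw_antipode_comul fun x y => sw K b (fun e g => tensorSum (s.coact v) fun c d =>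
        adLin K H (x * e) c ⊗ₜ[K] t.act y (q (s.act g d)))]
    simp only [actAverage_apply, map_tensorSum, tmul_tensorSum, h₁]
    rw [sw_coassoc Λ fun x y b => sw K b (fun e g => tensorSum (s.coact v) fun c d =>
      adLin K H (antipode K y * e) c ⊗ₜ[K] t.act (antipode K x) (q (s.act g d))),
      tensorSum_comm (s.coact v)]
    refine tensorSum_congr _ fun x z => ?_
    rw [sw_antipode_mul_cancel (fun y g => tensorSum (s.coact v) fun c d =>
      adLin K H y c ⊗ₜ[K] t.act (antipode K x) (q (s.act g d)))]
    simp only [adLin_one]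

/-- A homomorphism with a linear retraction has a retraction which is a homomorphism. -/
theorem exists_leftInverse [FiniteDimensional K H] [IsSemisimpleRing H]
    (hcoss : IsCosemisimpleCoalgebra K H) (hR : IsQuasiTriangular K H R)
    {f : U →ₗ[K] V} (hf : f ∈ homHD K H R t s) (p : V →ₗ[K] U) (hpf : p ∘ₗ f = .id) :
    ∃ q ∈ homHD K H R s t, q ∘ₗ f = .id := by
  obtain ⟨Λ, hΛ₁, -, hΛ⟩ := exists_integral (K := K) (H := H)
  obtain ⟨φ, hφ₁, hφ₂, hφ₃⟩ := exists_cointegral hcoss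
  have hφ : IsCointegral φ := ⟨hφ₁, hφ₂, hφ₃⟩
  rw [mem_homHD_iff] at hf
  refine ⟨_, actAverage_mem_homHD hΛ
    (isColinear_coactAverage hR hφ s.isCoaction t.isCoaction p), ?_⟩
  ext u
  rw [LinearMap.comp_apply, actAverage_apply]
  simp only [hf.1, coactAverage_apply_of_leftInverse hR hφ t.isCoaction p hf.2 hpf]
  simp only [← Module.End.mul_apply, ← map_mul]
  rw [sw_antipode_mul (K := K) (fun x => t.act x u), hΛ₁]
  simp

end RModStr

end BraidedModule

section Slices

variable {K : Type} [Field K] {M V : Type*} [AddCommGroup M] [Module K M]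
  [AddCommGroup V] [Module K V]

theorem tensor_eq_zero_of_left_slices [FiniteDimensional K M] {t : M ⊗[K] V}
    (h : ∀ φ : M →ₗ[K] K, tensorSum t (fun a b => φ a • b) = 0) : t = 0 := by
  let e := Module.finBasis K M
  have h₁ (x : M) (y : V) : x ⊗ₜ[K] y = ∑ i, e i ⊗ₜ[K] (e.coord i x • y) := by
    conv_lhs => rw [← e.sum_repr x, TensorProduct.sum_tmul]
    exact Finset.sum_congr rfl fun i _ => (TensorProduct.smul_tmul _ _ _)
  rw [← tensorSum_tmul_self t, tensorSum_congr _ h₁]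
  unfold tensorSum
  rw [Finset.sum_comm]
  refine Finset.sum_eq_zero fun i _ => ?_
  rw [← TensorProduct.tmul_sum]
  change e i ⊗ₜ[K] tensorSum t (fun a b => e.coord i a • b) = 0
  rw [h, TensorProduct.tmul_zero]

theorem tensor_ext_left_slices [FiniteDimensional K M] {t t' : M ⊗[K] V}
    (h : ∀ φ : M →ₗ[K] K, tensorSum t (fun a b => φ a • b) = tensorSum t' fun a b => φ a • b) :
    t = t' := by
  refine sub_eq_zero.1 (tensor_eq_zero_of_left_slices fun φ => ?_)
  have := tensorSum_add_left (fun a (b : V) => φ a • b) (t - t') t'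
  rw [sub_add_cancel, h] at this
  exact right_eq_add.1 this

theorem mem_map₂_of_right_slices [FiniteDimensional K M] {t : M ⊗[K] V} {N : Submodule K M}
    (h : ∀ f : V →ₗ[K] K, tensorSum t (fun a b => f b • a) ∈ N) :
    t ∈ Submodule.map₂ (TensorProduct.mk K M V) N ⊤ := by
  obtain ⟨π, hπ⟩ := N.subtype.exists_leftInverse_of_injective N.ker_subtype
  have key : t = TensorProduct.map (N.subtype ∘ₗ π) .id t := by
    refine tensor_ext_left_slices fun φ => ?_
    rw [tensorSum_map fun a b => φ a • b]
    rw [← sub_eq_zero, ← Module.forall_dual_apply_eq_zero_iff K]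
    intro f
    have h₁ (u : M →ₗ[K] K) : f (tensorSum t fun a b => u a • b) =
        u (tensorSum t fun a b => f b • a) := by
      simp only [map_tensorSum, map_smul, smul_eq_mul, mul_comm]
    have h₂ := congrArg N.subtype (LinearMap.congr_fun hπ ⟨_, h f⟩)
    rw [map_sub, h₁, sub_eq_zero]
    refine Eq.trans ?_ (h₁ (φ ∘ₗ N.subtype ∘ₗ π)).symm
    exact congrArg φ h₂.symm
  rw [key, ← tensorSum_tmul_self t, map_tensorSum]
  exact Submodule.sum_mem _ fun i _ => Submodule.apply_mem_map₂ _ (π _).2 trivial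

end Slices

section Coefficients

open Coalgebra HopfAlgebra

variable {K : Type} [Field K] {H : Type} [Ring H] [HopfAlgebra K H] {R : H ⊗[K] H}
  {V W : Type*} [AddCommGroup V] [Module K V] [AddCommGroup W] [Module K W]

/-- The space spanned by the matrix coefficients `f(v₍₀₎) v₍₋₁₎` of a coaction. -/
noncomputable def coeffSpace (ρ : V →ₗ[K] H ⊗[K] V) : Submodule K H :=
  Submodule.span K {x | ∃ (f : V →ₗ[K] K) (v : V), x = tensorSum (ρ v) fun a b => f b • a}

theorem coeff_mem_coeffSpace (ρ : V →ₗ[K] H ⊗[K] V) (f : V →ₗ[K] K) (v : V) :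
    tensorSum (ρ v) (fun a b => f b • a) ∈ coeffSpace ρ := Submodule.subset_span ⟨f, v, rfl⟩

theorem coact_mem_coeffSpace [FiniteDimensional K H] (ρ : V →ₗ[K] H ⊗[K] V) (v : V) :
    ρ v ∈ Submodule.map₂ (TensorProduct.mk K H V) (coeffSpace ρ) ⊤ :=
  mem_map₂_of_right_slices fun f => coeff_mem_coeffSpace ρ f v

theorem coeffSpace_le {ρ : V →ₗ[K] H ⊗[K] V} {D : Submodule K H}
    (h : ∀ v, ρ v ∈ Submodule.map₂ (TensorProduct.mk K H V) D ⊤) : coeffSpace ρ ≤ D := by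
  rw [coeffSpace, Submodule.span_le]
  rintro _ ⟨f, v, rfl⟩
  exact tensorSum_mem (h v) _ fun x hx y _ => D.smul_mem _ hx

theorem IsCoaction.deltaR_mem_coeffSpace [FiniteDimensional K H] {ρ : V →ₗ[K] H ⊗[K] V}
    (hρ : IsCoaction R ρ) {x : H} (hx : x ∈ coeffSpace ρ) :
    deltaR K H R x ∈ Submodule.map₂ (TensorProduct.mk K H H) (coeffSpace ρ) (coeffSpace ρ) := by
  rw [coeffSpace] at hx
  induction hx using Submodule.span_induction with
  | mem x hx =>
    obtain ⟨f, v, rfl⟩ := hx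
    have h₁ : deltaR K H R (tensorSum (ρ v) fun a b => f b • a) =
        tensorSum (ρ v) fun a b => a ⊗ₜ[K] tensorSum (ρ b) fun c d => f d • c := by
      simp only [tmul_tensorSum]
      rw [hρ.sum_coassoc v fun a c d => a ⊗ₜ[K] (f d • c), map_tensorSum]
      refine tensorSum_congr _ fun a b => ?_
      conv_lhs => rw [map_smul, ← tensorSum_tmul_self (deltaR K H R a), smul_tensorSum]
      simp only [TensorProduct.tmul_smul]
    rw [h₁]
    exact tensorSum_mem (coact_mem_coeffSpace ρ v) _ fun a ha b _ =>
      Submodule.apply_mem_map₂ _ ha (coeff_mem_coeffSpace ρ f b)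
  | zero => rw [map_zero]; exact Submodule.zero_mem _
  | add x y _ _ hx hy => rw [map_add]; exact Submodule.add_mem _ hx hy
  | smul c x _ hx => rw [map_smul]; exact Submodule.smul_mem _ _ hx

theorem IsCoaction.coeffSpace_ne_bot [FiniteDimensional K H] [Nontrivial V]
    {ρ : V →ₗ[K] H ⊗[K] V} (hρ : IsCoaction R ρ) : coeffSpace ρ ≠ ⊥ := by
  intro h
  obtain ⟨v, hv⟩ := exists_ne (0 : V)
  refine hv ?_
  have := tensorSum_mem (s := ⊥) (coact_mem_coeffSpace ρ v)
    (fun a b => counit (R := K) a • b) fun x hx y _ => by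
      rw [h, Submodule.mem_bot] at hx
      simp [hx]
  rwa [hρ.sum_counit, Submodule.mem_bot] at this

theorem RModStr.adAct_mem_coeffSpace [FiniteDimensional K H] [IsSemisimpleRing H]
    {φ : H →ₗ[K] K} (hφ : IsCointegral φ) (s : RModStr K H R V) (h : H) {x : H}
    (hx : x ∈ coeffSpace s.coact) : adAct K H h x ∈ coeffSpace s.coact := by
  change adLin K H h x ∈ _
  rw [coeffSpace] at hx
  induction hx using Submodule.span_induction with
  | mem x hx =>
    obtain ⟨f, v, rfl⟩ := hx
    obtain ⟨g, rfl⟩ := hφ.exists_antipode_eq h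
    have h₁ : adLin K H (antipode K g) (tensorSum (s.coact v) fun a b => f b • a) =
        sw K g (fun x y => tensorSum (s.coact (s.act (antipode K y) v))
          fun a b => f (s.act x b) • a) := by
      have (x y : H) := s.sum_coact_act (antipode K y) v fun a b => f (s.act x b) • a
      simp only [this]
      have (x y : H) := sw_antipode_comul (K := K) (fun a b => tensorSum (s.coact v) fun c d =>
        f (s.act x (s.act b d)) • adLin K H a c) y
      simp only [this]
      simp only [← Module.End.mul_apply, ← map_mul]
      have := sw_mul_antipode_cancel (K := K) (fun x y => tensorSum (s.coact v) fun c d =>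
        f (s.act x d) • adLin K H (antipode K y) c) g
      rw [this]
      simp only [map_tensorSum, map_smul, map_one, Module.End.one_apply]
    rw [h₁]
    exact Submodule.sum_mem _ fun i _ => coeff_mem_coeffSpace s.coact (f ∘ₗ s.act i.1) _
  | zero => rw [map_zero]; exact Submodule.zero_mem _
  | add x y _ _ hx hy => rw [map_add]; exact Submodule.add_mem _ hx hy
  | smul c x _ hx => rw [map_smul]; exact Submodule.smul_mem _ _ hx

theorem RModStr.coeffSpace_eq [FiniteDimensional K H] [IsSemisimpleRing H] [Nontrivial V]
    {φ : H →ₗ[K] K} (hφ : IsCointegral φ) {D : Submodule K H}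
    (hD : IsMinimalAdjointStableSubcoalgebra K H R D) {s : RModStr K H R V}
    (hs : memDCat K H R D s) : coeffSpace s.coact = D :=
  (hD.2.2 _ (coeffSpace_le hs) ⟨fun h _ hx => s.adAct_mem_coeffSpace hφ h hx,
    fun _ hx => s.isCoaction.deltaR_mem_coeffSpace hx⟩).resolve_left
      s.isCoaction.coeffSpace_ne_bot

/-- Nonzero comodules over a minimal adjoint-stable subcoalgebra have nonzero colinear maps into
nonzero objects. -/
theorem exists_isColinear_ne_zero [FiniteDimensional K H] [IsSemisimpleRing H]
    (hcoss : IsCosemisimpleCoalgebra K H) (hR : IsQuasiTriangular K H R) {D : Submodule K H}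
    (hD : IsMinimalAdjointStableSubcoalgebra K H R D) [Nontrivial W] (sW : DComodStr K H R D W)
    [Nontrivial V] {s : RModStr K H R V} (hs : memDCat K H R D s) :
    ∃ f : W →ₗ[K] V, IsColinear sW.coact s.coact f ∧ f ≠ 0 := by
  obtain ⟨φ, hφ₁, hφ₂, hφ₃⟩ := exists_cointegral hcoss
  have hφ : IsCointegral φ := ⟨hφ₁, hφ₂, hφ₃⟩
  by_contra! hne
  have hzero (p : W →ₗ[K] V) (w : W) :
      coactAverage (braidedForm R φ) sW.coact s.coact p w = 0 := by
    rw [hne _ (isColinear_coactAverage hR hφ sW.isCoaction s.isCoaction p), LinearMap.zero_apply]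
  -- the left radical of the braided form restricted to `D`
  let N : Submodule K H :=
    { carrier := {x | ∀ d ∈ D, braidedForm R φ x d = 0}
      add_mem' := fun hx hy d hd => by
        rw [map_add, LinearMap.add_apply, hx d hd, hy d hd, add_zero]
      zero_mem' := fun d _ => by rw [map_zero, LinearMap.zero_apply]
      smul_mem' := fun c x hx d hd => by
        rw [map_smul, LinearMap.smul_apply, hx d hd, smul_zero] }
  have hN (w : W) : sW.coact w ∈ Submodule.map₂ (TensorProduct.mk K H W) N ⊤ := by
    refine mem_map₂_of_right_slices fun f d hd => ?_
    set x := tensorSum (sW.coact w) fun a b => f b • a with hx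
    have hxv (v : V) : tensorSum (s.coact v) (fun c e => braidedForm R φ x c • e) = 0 := by
      rw [← hzero (f.smulRight v) w, coactAverage_apply]
      simp only [LinearMap.smulRight_apply, map_smul, hx, map_tensorSum, tensorSum_apply,
        LinearMap.smul_apply, tensorSum_smul]
      rw [tensorSum_comm]
      refine tensorSum_congr _ fun a b => ?_
      rw [tensorSum_smul_left fun c e => braidedForm R φ a c • e, smul_tensorSum]
      simp only [smul_assoc]
    rw [← RModStr.coeffSpace_eq hφ hD hs, coeffSpace] at hd
    induction hd using Submodule.span_induction with
    | mem d hd =>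
      obtain ⟨g, v, rfl⟩ := hd
      have := congrArg g (hxv v)
      simp only [map_tensorSum, map_smul, map_zero, smul_eq_mul] at this ⊢
      simpa only [mul_comm] using this
    | zero => rw [map_zero]
    | add a b _ _ ha hb => rw [map_add, ha, hb, add_zero]
    | smul c a _ ha => rw [map_smul, ha, smul_zero]
  obtain ⟨w, hw⟩ := exists_ne (0 : W)
  refine hw ?_
  have h₁ := sW.isCoaction.sum_coassoc w fun a c d => braidedForm R φ a c • d
  simp only [← tensorSum_smul, hR.sum_deltaR_braidedForm hφ, sW.isCoaction.sum_counit] at h₁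
  rw [← h₁, ← Submodule.mem_bot K]
  refine tensorSum_mem (hN w) _ fun a ha b _ => tensorSum_mem (sW.mem b) _ fun c hc d _ => ?_
  rw [Submodule.mem_bot, ha c hc, zero_smul]

end Coefficients

section HomEquivalence

open CategoryTheory

variable {S P : Type} [Ring S] [AddCommGroup P] [Module S P]

theorem exists_eq_sum_lsingle_comp {ι X : Type*} [AddCommGroup X] [Module S X]
    [Module.Finite S X] (k : X →ₗ[S] ι →₀ P) :
    ∃ s : Finset ι, k = ∑ i ∈ s, Finsupp.lsingle (R := S) i ∘ₗ Finsupp.lapply i ∘ₗ k := by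
  classical
  obtain ⟨t, ht⟩ := Module.Finite.fg_top (R := S) (M := X)
  refine ⟨t.biUnion fun x => (k x).support, ?_⟩
  refine LinearMap.ext_on (s := (t : Set X)) ht fun x hx => ?_
  simp only [LinearMap.sum_apply, LinearMap.comp_apply, Finsupp.lapply_apply,
    Finsupp.lsingle_apply]
  refine Finsupp.ext fun i => ?_
  rw [Finsupp.finsetSum_apply]
  simp only [Finsupp.single_apply, Finset.sum_ite_eq', Finset.mem_biUnion]
  split_ifs with h
  · rfl
  · by_contra hne
    exact h ⟨x, hx, by simpa using hne⟩

variable {B : Type} [Ring B]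

/-- For `θ : B ≃ End P`, the right `B`-module structure on `Hom(P, X)` by precomposition. -/
@[reducible]
def homModule (θ : B ≃+* Module.End S P) (X : Type*) [AddCommGroup X] [Module S X] :
    Module Bᵐᵒᵖ (P →ₗ[S] X) where
  smul b g := g ∘ₗ θ b.unop
  one_smul g := by
    change g ∘ₗ θ 1 = g
    rw [map_one]; rfl
  mul_smul a b g := by
    change g ∘ₗ θ (b.unop * a.unop) = (g ∘ₗ θ b.unop) ∘ₗ θ a.unop
    rw [map_mul]; rfl
  smul_zero b := LinearMap.zero_comp _
  smul_add b f g := LinearMap.add_comp _ _ _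
  add_smul a b g := by
    change g ∘ₗ θ (a.unop + b.unop) = g ∘ₗ θ a.unop + g ∘ₗ θ b.unop
    rw [map_add, LinearMap.comp_add]
  zero_smul g := by
    change g ∘ₗ θ 0 = 0
    rw [map_zero, LinearMap.comp_zero]

/-- The functor `Hom(P, -)` from `S`-modules to right modules over `B ≃ End P`. -/
def homFunctor (θ : B ≃+* Module.End S P) : ModuleCat.{0} S ⥤ ModuleCat.{0} Bᵐᵒᵖ where
  obj X := @ModuleCat.of Bᵐᵒᵖ _ (P →ₗ[S] X) _ (homModule θ X)
  map {X Y} f := letI := homModule θ X; letI := homModule θ Y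
    ModuleCat.ofHom (X := P →ₗ[S] X) (Y := P →ₗ[S] Y)
      { toFun := fun g => f.hom ∘ₗ g
        map_add' := fun g g' => LinearMap.comp_add _ _ _
        map_smul' := fun _ _ => rfl }

variable (θ : B ≃+* Module.End S P)

section Generator

variable [IsSemisimpleRing S]
  (hP : ∀ (X : Type) [AddCommGroup X] [Module S X] [Nontrivial X], ∃ f : P →ₗ[S] X, f ≠ 0)
include hP

theorem iSup_range_hom_eq_top (X : Type) [AddCommGroup X] [Module S X] :
    ⨆ f : P →ₗ[S] X, LinearMap.range f = ⊤ := by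
  by_contra hne
  obtain ⟨C, hC⟩ := exists_isCompl (⨆ f : P →ₗ[S] X, LinearMap.range f)
  have : Nontrivial C := by
    rw [Submodule.nontrivial_iff_ne_bot]
    rintro rfl
    exact hne (by simpa using hC.sup_eq_top)
  obtain ⟨f, hf⟩ := hP C
  refine hf (LinearMap.ext fun p => ?_)
  have h := (Submodule.disjoint_def.1 hC.disjoint) (f p)
    (Submodule.mem_iSup_of_mem (C.subtype ∘ₗ f) ⟨p, rfl⟩) (f p).2
  exact Subtype.ext h

theorem homFunctor_faithful : (homFunctor θ).Faithful where
  map_injective {X Y} f g h := by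
    ext x
    have hx : x ∈ ⨆ f : P →ₗ[S] X, LinearMap.range f := by
      rw [iSup_range_hom_eq_top hP]; trivial
    refine Submodule.iSup_induction _ (motive := fun x => f.hom x = g.hom x) hx ?_ ?_ ?_
    · rintro k _ ⟨p, rfl⟩
      exact LinearMap.congr_fun (congrArg (fun F => F.hom k) h) p
    · simp
    · intro x y hx hy
      rw [map_add, map_add, hx, hy]

theorem homFunctor_full [Module.Finite S P] : (homFunctor θ).Full where
  map_surjective {X Y} α := by
    let := homModule θ X
    let := homModule θ Y
    let α' : (P →ₗ[S] X) →ₗ[Bᵐᵒᵖ] (P →ₗ[S] Y) := α.hom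
    have hα (g : P →ₗ[S] X) (b : Module.End S P) : α' (g ∘ₗ b) = α' g ∘ₗ b := by
      have := α'.map_smul (MulOpposite.op (θ.symm b)) g
      have h₁ (Z : Type) [AddCommGroup Z] [Module S Z] (g : P →ₗ[S] Z) :
          (homModule θ Z).smul (MulOpposite.op (θ.symm b)) g = g ∘ₗ b := by
        change g ∘ₗ θ (θ.symm b) = _
        rw [θ.apply_symm_apply]
      exact ((congrArg α' (h₁ X g)).symm.trans this).trans (h₁ Y _)
    let Φ : ((P →ₗ[S] X) →₀ P) →ₗ[S] X := Finsupp.lsum ℕ fun g => g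
    let Φ' : ((P →ₗ[S] X) →₀ P) →ₗ[S] Y := Finsupp.lsum ℕ fun g => α' g
    have hΦ : LinearMap.range Φ = ⊤ := by
      rw [eq_top_iff, ← iSup_range_hom_eq_top hP, iSup_le_iff]
      rintro g _ ⟨p, rfl⟩
      exact ⟨Finsupp.single g p, by simp [Φ]⟩
    have := Module.projective_of_isSemisimpleRing S X
    obtain ⟨s, hs⟩ := Module.projective_lifting_property Φ LinearMap.id
      (LinearMap.range_eq_top.1 hΦ)
    refine ⟨ModuleCat.ofHom (Φ' ∘ₗ s), ?_⟩
    suffices h : ∀ g : P →ₗ[S] X, Φ' ∘ₗ s ∘ₗ g = α' g from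
      ModuleCat.hom_ext (LinearMap.ext h)
    intro g
    obtain ⟨t, ht⟩ := exists_eq_sum_lsingle_comp (s ∘ₗ g)
    have hg : g = ∑ i ∈ t, i ∘ₗ (Finsupp.lapply i ∘ₗ s ∘ₗ g) := by
      have : g = Φ ∘ₗ (s ∘ₗ g) := by
        rw [← LinearMap.comp_assoc, hs, LinearMap.id_comp]
      conv_lhs => rw [this, ht]
      refine LinearMap.ext fun p => ?_
      rw [LinearMap.comp_apply, LinearMap.sum_apply, map_sum, LinearMap.sum_apply]
      exact Finset.sum_congr rfl fun i _ => by simp [Φ]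
    conv_rhs => rw [hg]
    rw [map_sum]
    simp only [hα]
    conv_lhs => rw [ht]
    refine LinearMap.ext fun p => ?_
    rw [LinearMap.comp_apply, LinearMap.sum_apply, map_sum, LinearMap.sum_apply]
    exact Finset.sum_congr rfl fun i _ => by simp [Φ']

theorem homFunctor_essSurj [Module.Finite S P] [IsSemisimpleRing B] :
    (homFunctor θ).EssSurj where
  mem_essImage M := by
    have hfull := homFunctor_full θ hP
    have hfaith := homFunctor_faithful θ hP
    let Y : ModuleCat.{0} S := ModuleCat.of S (M →₀ P)
    let := homModule θ Y
    let j : (M →₀ Bᵐᵒᵖ) →ₗ[Bᵐᵒᵖ] (P →ₗ[S] Y) :=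
      Finsupp.linearCombination Bᵐᵒᵖ fun m => (Finsupp.lsingle m : P →ₗ[S] M →₀ P)
    have hj (m : M) (b : Bᵐᵒᵖ) :
        j (Finsupp.single m b) = (Finsupp.lsingle m : P →ₗ[S] M →₀ P) ∘ₗ θ b.unop := by
      rw [Finsupp.linearCombination_single]; rfl
    have hj' (z : M →₀ Bᵐᵒᵖ) (m : M) : (Finsupp.lapply m : (M →₀ P) →ₗ[S] P) ∘ₗ j z =
        θ (z m).unop := by
      induction z using Finsupp.induction_linear with
      | zero => simp
      | add f g hf hg => rw [map_add, LinearMap.comp_add, hf, hg]; simp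
      | single n b =>
        rw [hj]
        ext p
        by_cases h : n = m
        · subst h; simp
        · simp [h]
    have hbij : Function.Bijective j := by
      constructor
      · intro y z hyz
        ext m
        exact MulOpposite.unop_injective
          (θ.injective (by rw [← hj', ← hj', hyz]))
      · intro g
        obtain ⟨t, ht⟩ := exists_eq_sum_lsingle_comp (g : P →ₗ[S] M →₀ P)
        refine ⟨∑ m ∈ t, Finsupp.single m
          (MulOpposite.op (θ.symm (Finsupp.lapply m ∘ₗ (g : P →ₗ[S] M →₀ P)))), ?_⟩
        rw [map_sum]
        simp only [hj, MulOpposite.unop_op, RingEquiv.apply_symm_apply]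
        exact ht.symm
    let J := LinearEquiv.ofBijective j hbij
    have := Module.projective_of_isSemisimpleRing Bᵐᵒᵖ M
    obtain ⟨s, hs⟩ := Module.projective_lifting_property
      (Finsupp.linearCombination Bᵐᵒᵖ (id : M → M)) LinearMap.id
      (Finsupp.linearCombination_id_surjective _ _)
    let i : M ⟶ (homFunctor θ).obj Y := ModuleCat.ofHom (J.toLinearMap ∘ₗ s)
    let r : (homFunctor θ).obj Y ⟶ M :=
      ModuleCat.ofHom (Finsupp.linearCombination Bᵐᵒᵖ (id : M → M) ∘ₗ J.symm.toLinearMap)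
    have hir : i ≫ r = 𝟙 M := by
      ext m
      change Finsupp.linearCombination Bᵐᵒᵖ (id : M → M) (J.symm (J (s m))) = m
      rw [J.symm_apply_apply]
      exact LinearMap.congr_fun hs m
    obtain ⟨e, he⟩ := (homFunctor θ).map_surjective (r ≫ i)
    have hee : e ≫ e = e := (homFunctor θ).map_injective (by
      rw [Functor.map_comp, he, Category.assoc, reassoc_of% hir])
    let X : ModuleCat.{0} S := ModuleCat.of S (LinearMap.range e.hom)
    let a : X ⟶ Y := ModuleCat.ofHom (LinearMap.range e.hom).subtype
    let p : Y ⟶ X := ModuleCat.ofHom e.hom.rangeRestrict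
    have hpa : p ≫ a = e := by ext; rfl
    have hap : a ≫ p = 𝟙 X := by
      refine ModuleCat.hom_ext (LinearMap.ext ?_)
      rintro ⟨_, y, rfl⟩
      exact Subtype.ext (LinearMap.congr_fun (congrArg (fun f => f.hom) hee) y)
    refine ⟨X, ⟨⟨(homFunctor θ).map a ≫ r, i ≫ (homFunctor θ).map p, ?_, ?_⟩⟩⟩
    · rw [Category.assoc, ← reassoc_of% he, ← Functor.map_comp, ← Functor.map_comp, ← hpa,
        Category.assoc, hap, Category.comp_id, hap, CategoryTheory.Functor.map_id]
    · rw [Category.assoc, ← Functor.map_comp_assoc, hpa, he, Category.assoc, hir,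
        Category.comp_id, hir]

theorem homFunctor_isEquivalence [Module.Finite S P] [IsSemisimpleRing B] :
    (homFunctor θ).IsEquivalence :=
  have := homFunctor_full θ hP
  have := homFunctor_faithful θ hP
  have := homFunctor_essSurj θ hP
  {}

end Generator

end HomEquivalence

section ModuleAlgebra

open Coalgebra HopfAlgebra

variable {K : Type} [Field K] {H : Type} [Ring H] [HopfAlgebra K H] (R : H ⊗[K] H)
  (D : Submodule K H) {V U : Type*} [AddCommGroup V] [Module K V] [AddCommGroup U] [Module K U]

/-- The linear operator `v ↦ Σ φ(v₍₋₁₎) v₍₀₎` induced by a functional `φ`. -/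
noncomputable def coactEval (ρ : V →ₗ[K] H ⊗[K] V) : (H →ₗ[K] K) →ₗ[K] Module.End K V :=
  Lin.toMap₂ (K := K) fun (φ : H →ₗ[K] K) (v : V) => tensorSum (ρ v) fun a b => φ a • b

theorem coactEval_apply (ρ : V →ₗ[K] H ⊗[K] V) (φ : H →ₗ[K] K) (v : V) :
    coactEval ρ φ v = tensorSum (ρ v) fun a b => φ a • b := rfl

/-- The convolution product of two functionals with respect to `Δ_R`. -/
noncomputable def convR (φ ψ : H →ₗ[K] K) : H →ₗ[K] K :=
  Lin.toMap (K := K) fun x => tensorSum (deltaR K H R x) fun p q => φ p * ψ q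

theorem convR_apply (φ ψ : H →ₗ[K] K) (x : H) :
    convR R φ ψ x = tensorSum (deltaR K H R x) fun p q => φ p * ψ q := rfl

namespace DModAlg

/-- The generator given by an element of `H`. -/
noncomputable def actGen : H →ₗ[K] TensorAlgebra K (H × (H →ₗ[K] K)) :=
  TensorAlgebra.ι K ∘ₗ LinearMap.inl K H (H →ₗ[K] K)

/-- The generator given by a functional on `H`. -/
noncomputable def coactGen : (H →ₗ[K] K) →ₗ[K] TensorAlgebra K (H × (H →ₗ[K] K)) :=
  TensorAlgebra.ι K ∘ₗ LinearMap.inr K H (H →ₗ[K] K)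

/-- The relations satisfied by the action of `H` and the functionals on an object of `_H^D M`. -/
inductive Rel : TensorAlgebra K (H × (H →ₗ[K] K)) → TensorAlgebra K (H × (H →ₗ[K] K)) → Prop
  | act_one : Rel (actGen 1) 1
  | act_mul (a b : H) : Rel (actGen (a * b)) (actGen a * actGen b)
  | coact_counit : Rel (coactGen (counit (R := K) (A := H))) 1
  | coact_mul (φ ψ : H →ₗ[K] K) : Rel (coactGen (convR R φ ψ)) (coactGen ψ * coactGen φ)
  | coact_zero (φ : H →ₗ[K] K) (hφ : ∀ a ∈ D, φ a = 0) : Rel (coactGen φ) 0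
  | compat (φ : H →ₗ[K] K) (h : H) : Rel (coactGen φ * actGen h)
      (sw K h (fun a b => actGen b * coactGen (φ ∘ₗ adLin K H a)))

end DModAlg

/-- The algebra whose modules are the objects of `_H^D M`. -/
abbrev DModAlg : Type := RingQuot (DModAlg.Rel R D)

namespace DModAlg

/-- The elements of `H` in `DModAlg`. -/
noncomputable def ofAct : H →ₗ[K] DModAlg R D :=
  (RingQuot.mkAlgHom K (Rel R D)).toLinearMap ∘ₗ actGen

/-- The functionals on `H` in `DModAlg`. -/
noncomputable def ofCoact : (H →ₗ[K] K) →ₗ[K] DModAlg R D :=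
  (RingQuot.mkAlgHom K (Rel R D)).toLinearMap ∘ₗ coactGen

theorem ofAct_one : ofAct R D 1 = 1 :=
  (RingQuot.mkAlgHom_rel K (.act_one (R := R) (D := D))).trans (map_one _)

theorem ofAct_mul (a b : H) : ofAct R D (a * b) = ofAct R D a * ofAct R D b :=
  (RingQuot.mkAlgHom_rel K (.act_mul (R := R) (D := D) a b)).trans (map_mul _ _ _)

theorem ofCoact_counit : ofCoact R D (counit (R := K) (A := H)) = 1 :=
  (RingQuot.mkAlgHom_rel K (.coact_counit (R := R) (D := D))).trans (map_one _)

theorem ofCoact_convR (φ ψ : H →ₗ[K] K) :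
    ofCoact R D (convR R φ ψ) = ofCoact R D ψ * ofCoact R D φ :=
  (RingQuot.mkAlgHom_rel K (.coact_mul (R := R) (D := D) φ ψ)).trans (map_mul _ _ _)

variable {D} in
theorem ofCoact_eq_zero {φ : H →ₗ[K] K} (hφ : ∀ a ∈ D, φ a = 0) : ofCoact R D φ = 0 :=
  (RingQuot.mkAlgHom_rel K (.coact_zero (R := R) (D := D) φ hφ)).trans (map_zero _)

theorem ofCoact_mul_ofAct (φ : H →ₗ[K] K) (h : H) : ofCoact R D φ * ofAct R D h =
    sw K h (fun a b => ofAct R D b * ofCoact R D (φ ∘ₗ adLin K H a)) := by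
  refine (map_mul (RingQuot.mkAlgHom K (Rel R D)) _ _).symm.trans
    ((RingQuot.mkAlgHom_rel K (.compat (R := R) (D := D) φ h)).trans ?_)
  refine (map_tensorSum _ (RingQuot.mkAlgHom K (Rel R D)).toLinearMap _).trans ?_
  exact tensorSum_congr _ fun a b => map_mul (RingQuot.mkAlgHom K (Rel R D)) _ _

variable {R D}

theorem algHom_ext {A : Type*} [Ring A] [Algebra K A] {f g : DModAlg R D →ₐ[K] A}
    (h₁ : ∀ h, f (ofAct R D h) = g (ofAct R D h))
    (h₂ : ∀ φ, f (ofCoact R D φ) = g (ofCoact R D φ)) : f = g := by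
  refine RingQuot.ringQuot_ext' K f g (TensorAlgebra.hom_ext (LinearMap.prod_ext ?_ ?_))
  · exact LinearMap.ext h₁
  · exact LinearMap.ext h₂

end DModAlg

variable {R D} in
/-- The action of `DModAlg` on an object of `_H^D M`. -/
noncomputable def RModStr.toEnd (s : RModStr K H R V) (hs : memDCat K H R D s) :
    DModAlg R D →ₐ[K] Module.End K V :=
  RingQuot.liftAlgHom K ⟨TensorAlgebra.lift K (s.act.toLinearMap.coprod (coactEval s.coact)), by
    have h₁ (h : H) : TensorAlgebra.lift K (s.act.toLinearMap.coprod (coactEval s.coact))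
        (DModAlg.actGen h) = s.act h := by simp [DModAlg.actGen]
    have h₂ (φ : H →ₗ[K] K) : TensorAlgebra.lift K (s.act.toLinearMap.coprod (coactEval s.coact))
        (DModAlg.coactGen φ) = coactEval s.coact φ := by simp [DModAlg.coactGen]
    intro x y hxy
    induction hxy with
    | act_one => simp only [h₁, map_one]
    | act_mul a b => simp only [h₁, map_mul]
    | coact_counit =>
      rw [h₂, map_one]
      exact LinearMap.ext fun v => s.isCoaction.sum_counit v
    | coact_mul φ ψ =>
      rw [map_mul, h₂, h₂, h₂]
      refine LinearMap.ext fun v => ?_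
      rw [Module.End.mul_apply, coactEval_apply _ φ, map_tensorSum]
      simp only [map_smul]
      simp only [coactEval_apply _ ψ, smul_tensorSum]
      have (c : H) (d : V) : Lin K fun a => φ a • ψ c • d :=
        .smul_left (f := fun a => φ a) _
      rw [s.isCoaction.sum_coassoc v fun a c d => φ a • ψ c • d]
      rw [coactEval_apply]
      refine tensorSum_congr _ fun a b => ?_
      rw [convR_apply]
      simp only [← smul_eq_mul, tensorSum_smul, ← smul_assoc]
    | coact_zero φ hφ =>
      rw [h₂, map_zero]
      refine LinearMap.ext fun v => ?_
      have := tensorSum_mem (s := (⊥ : Submodule K V)) (hs v) (fun a b => φ a • b)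
        fun a ha b _ => by simp [hφ a ha]
      exact (Submodule.mem_bot K).1 this
    | compat φ h =>
      rw [map_mul, h₁, h₂]
      refine (LinearMap.ext fun v => ?_ : _ = sw K h (fun a b =>
        s.act b * coactEval s.coact (φ ∘ₗ adLin K H a))).trans ?_
      · rw [Module.End.mul_apply, coactEval_apply, s.sum_coact_act, tensorSum_apply]
        refine tensorSum_congr _ fun a b => ?_
        rw [Module.End.mul_apply, coactEval_apply, map_tensorSum]
        simp only [map_smul, LinearMap.comp_apply]
      · refine Eq.trans ?_ (map_tensorSum _ (TensorAlgebra.lift K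
          (s.act.toLinearMap.coprod (coactEval s.coact))).toLinearMap _).symm
        refine tensorSum_congr _ fun a b => ?_
        rw [AlgHom.toLinearMap_apply, map_mul, h₁, h₂]⟩

namespace RModStr

variable {R D} (s : RModStr K H R V) (hs : memDCat K H R D s)

@[simp]
theorem toEnd_ofAct (h : H) : s.toEnd hs (DModAlg.ofAct R D h) = s.act h := by
  simp [toEnd, DModAlg.ofAct, DModAlg.actGen]

@[simp]
theorem toEnd_ofCoact (φ : H →ₗ[K] K) :
    s.toEnd hs (DModAlg.ofCoact R D φ) = coactEval s.coact φ := by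
  simp [toEnd, DModAlg.ofCoact, DModAlg.coactGen]

end RModStr

end ModuleAlgebra

section ModulesAsObjects

open Coalgebra HopfAlgebra

variable {K : Type} [Field K] {H : Type} [Ring H] [HopfAlgebra K H] {R : H ⊗[K] H}
  {D : Submodule K H}

theorem tensor_ext_left_slices₂ [FiniteDimensional K H] {V : Type*} [AddCommGroup V] [Module K V]
    {t t' : H ⊗[K] (H ⊗[K] V)}
    (h : ∀ φ ψ : H →ₗ[K] K,
      tensorSum t (fun a x => φ a • tensorSum x fun b v => ψ b • v) =
        tensorSum t' (fun a x => φ a • tensorSum x fun b v => ψ b • v)) : t = t' := by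
  refine tensor_ext_left_slices fun φ => tensor_ext_left_slices fun ψ => ?_
  have h₁ (t : H ⊗[K] (H ⊗[K] V)) :
      tensorSum (tensorSum t fun a x => φ a • x) (fun b v => ψ b • v) =
        tensorSum t (fun a x => φ a • tensorSum x fun b v => ψ b • v) := by
    rw [tensorSum_tensorSum]
    exact tensorSum_congr _ fun a x => tensorSum_smul_left _ _ _
  rw [h₁, h₁, h]

variable [FiniteDimensional K H] (R D) (M : Type) [AddCommGroup M] [Module K M]
  [Module (DModAlg R D) M] [IsScalarTower K (DModAlg R D) M]

/-- The coaction on a module over `DModAlg`. -/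
noncomputable def DModAlg.coact : M →ₗ[K] H ⊗[K] M :=
  ∑ i, TensorProduct.mk K H M (Module.finBasis K H i) ∘ₗ
    Algebra.lsmul K K M (ofCoact R D ((Module.finBasis K H).coord i))

theorem DModAlg.sum_coact_smul (φ : H →ₗ[K] K) (m : M) :
    tensorSum (coact R D M m) (fun a b => φ a • b) = ofCoact R D φ • m := by
  have hφ : φ = ∑ i, φ (Module.finBasis K H i) • (Module.finBasis K H).coord i := by
    refine (Module.finBasis K H).ext fun j => ?_
    simp
  rw [tensorSum_eq_lift, coact, LinearMap.sum_apply, map_sum]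
  conv_rhs => rw [hφ, map_sum, Finset.sum_smul]
  refine Finset.sum_congr rfl fun i _ => ?_
  rw [map_smul, smul_assoc]
  rfl

theorem DModAlg.coactEval_coact (φ : H →ₗ[K] K) (m : M) :
    coactEval (coact R D M) φ m = ofCoact R D φ • m := sum_coact_smul R D M φ m

/-- The object of `_H^D M` underlying a module over `DModAlg`. -/
noncomputable def DModAlg.str : RModStr K H R M where
  act := AlgHom.ofLinearMap ((Algebra.lsmul K K M).toLinearMap ∘ₗ ofAct R D)
    (by simp [ofAct_one]) (fun a b => by simp [ofAct_mul])
  coact := coact R D M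
  counit_coact m := by
    rw [rTensor_eq_tensorSum]
    change (TensorProduct.lid K M).toLinearMap _ = _
    rw [map_tensorSum]
    refine (tensorSum_congr _ fun a b => TensorProduct.lid_tmul _ _).trans ?_
    rw [sum_coact_smul, ofCoact_counit, one_smul]
  coassocR := by
    refine (LinearEquiv.eq_toLinearMap_symm_comp _ _).2 (LinearMap.ext fun m => ?_)
    simp only [LinearMap.comp_apply, rTensor_eq_tensorSum, lTensor_eq_tensorSum]
    refine tensor_ext_left_slices₂ fun φ ψ => ?_
    have (x : H ⊗[K] M) : Lin K fun a => φ a • tensorSum x fun b v => ψ b • v :=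
      .smul_left (f := fun a => φ a) _
    rw [tensorSum_tensorSum fun a x => φ a • tensorSum x fun b v => ψ b • v]
    simp only [tensorSum_tmul fun a x => φ a • tensorSum x fun b v => ψ b • v, sum_coact_smul]
    change tensorSum ((TensorProduct.assoc K H H M).toLinearMap _) _ = _
    rw [map_tensorSum, tensorSum_tensorSum fun a x => φ a • tensorSum x fun b v => ψ b • v]
    have h₁ (a : H) (b : M) : tensorSum
        ((TensorProduct.assoc K H H M).toLinearMap (deltaR K H R a ⊗ₜ[K] b))
        (fun a x => φ a • tensorSum x fun b v => ψ b • v) = convR R φ ψ a • b := by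
      conv_lhs => rw [← tensorSum_tmul_self (deltaR K H R a), tensorSum_tmul', map_tensorSum,
        tensorSum_tensorSum fun a x => φ a • tensorSum x fun b v => ψ b • v]
      rw [convR_apply]
      simp only [← smul_eq_mul, tensorSum_smul]
      refine tensorSum_congr _ fun p q => ?_
      change tensorSum (p ⊗ₜ[K] (q ⊗ₜ[K] b))
        (fun a x => φ a • tensorSum x fun b v => ψ b • v) = _
      rw [tensorSum_tmul fun a x => φ a • tensorSum x fun b v => ψ b • v,
        tensorSum_tmul fun b v => ψ b • v, smul_assoc]
    simp only [h₁]
    have h₂ := congrArg (Algebra.lsmul K K M (ofCoact R D ψ)) (sum_coact_smul R D M φ m)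
    rw [map_tensorSum] at h₂
    simp only [map_smul] at h₂
    rw [sum_coact_smul, ofCoact_convR, mul_smul]
    exact h₂.symm
  compat := by
    refine TensorProduct.ext' fun h m => tensor_ext_left_slices fun φ => ?_
    simp only [LinearMap.comp_apply, TensorProduct.map_tmul, TensorProduct.lift.tmul,
      AlgHom.toLinearMap_apply]
    conv_rhs => rw [← tensorSum_tmul_self (comul (R := K) h), ← tensorSum_tmul_self (coact R D M m)]
    simp only [tensorSum_tmul', tmul_tensorSum, map_tensorSum]
    refine (sum_coact_smul R D M φ (ofAct R D h • m)).trans ?_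
    rw [← mul_smul, ofCoact_mul_ofAct]
    change Algebra.lsmul K K M (tensorSum _ _) m = _
    rw [← AlgHom.toLinearMap_apply, map_tensorSum, tensorSum_apply, tensorSum_comm,
      tensorSum_tensorSum fun a b => φ a • b]
    refine tensorSum_congr _ fun a b => ?_
    rw [tensorSum_tensorSum fun a b => φ a • b, AlgHom.toLinearMap_apply, map_mul,
      Module.End.mul_apply]
    refine (congrArg _ (sum_coact_smul R D M (φ ∘ₗ adLin K H a) m).symm).trans ?_
    rw [map_tensorSum]
    refine tensorSum_congr _ fun c d => ?_
    change _ = tensorSum (adLin K H a c ⊗ₜ[K] (ofAct R D b • d)) fun a b => φ a • b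
    rw [tensorSum_tmul fun a b => φ a • b, map_smul]
    rfl

theorem DModAlg.str_coact : (str R D M).coact = coact R D M := rfl

theorem DModAlg.memDCat_str : memDCat K H R D (str R D M) := by
  intro m
  refine mem_map₂_of_right_slices fun f => ?_
  by_contra h
  obtain ⟨φ, hφ, hD⟩ := Submodule.exists_le_ker_of_notMem h
  apply hφ
  have h₁ : φ (tensorSum ((str R D M).coact m) fun a b => f b • a) =
      f (tensorSum ((str R D M).coact m) fun a b => φ a • b) := by
    simp only [map_tensorSum, map_smul, smul_eq_mul, mul_comm]
  rw [h₁, str_coact, sum_coact_smul, ofCoact_eq_zero R fun a ha => hD ha, zero_smul, map_zero]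

theorem DModAlg.toEnd_str (x : DModAlg R D) :
    (str R D M).toEnd (memDCat_str R D M) x = Algebra.lsmul K K M x := by
  refine AlgHom.congr_fun (DModAlg.algHom_ext (fun h => ?_) fun φ => ?_) x
  · rw [RModStr.toEnd_ofAct]; rfl
  · rw [RModStr.toEnd_ofCoact]
    exact LinearMap.ext fun m => coactEval_coact R D M φ m

end ModulesAsObjects

section CategoryOfModules

open CategoryTheory

variable {K : Type} [Field K] {H : Type} [Ring H] [HopfAlgebra K H] {R : H ⊗[K] H}
  {D : Submodule K H}

theorem DModAlg.induction {p : DModAlg R D → Prop} (scalar : ∀ c : K, p (algebraMap K _ c))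
    (act : ∀ h, p (ofAct R D h)) (coact : ∀ φ, p (ofCoact R D φ))
    (add : ∀ x y, p x → p y → p (x + y)) (mul : ∀ x y, p x → p y → p (x * y))
    (x : DModAlg R D) : p x := by
  obtain ⟨x, rfl⟩ := RingQuot.mkAlgHom_surjective K (Rel R D) x
  induction x using TensorAlgebra.induction with
  | algebraMap c => rw [AlgHom.commutes]; exact scalar c
  | ι m =>
    rw [← Prod.fst_add_snd m, map_add, map_add]
    exact add _ _ (act m.1) (coact m.2)
  | mul x y hx hy => rw [map_mul]; exact mul _ _ hx hy
  | add x y hx hy => rw [map_add]; exact add _ _ hx hy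

theorem mem_homHD_iff_toEnd [FiniteDimensional K H] {V U : Type*} [AddCommGroup V] [Module K V]
    [AddCommGroup U] [Module K U] {s : RModStr K H R V} {t : RModStr K H R U}
    (hs : memDCat K H R D s) (ht : memDCat K H R D t) {f : V →ₗ[K] U} :
    f ∈ homHD K H R s t ↔ ∀ x v, f (s.toEnd hs x v) = t.toEnd ht x (f v) := by
  rw [mem_homHD_iff]
  constructor
  · rintro ⟨h₁, h₂⟩ x
    induction x using DModAlg.induction with
    | scalar c => simp [AlgHom.commutes, Module.algebraMap_end_apply]
    | act h => simp [h₁]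
    | coact φ =>
      intro v
      simp only [RModStr.toEnd_ofCoact, coactEval_apply]
      rw [h₂.sum_coact v fun a b => φ a • b, map_tensorSum]
      simp only [map_smul]
    | add x y hx hy => simp [hx, hy]
    | mul x y hx hy => simp [hx, hy]
  · intro h
    refine ⟨fun a v => ?_, isColinear_of_tmul fun v => tensor_ext_left_slices fun φ => ?_⟩
    · have := h (DModAlg.ofAct R D a) v
      rw [RModStr.toEnd_ofAct, RModStr.toEnd_ofAct] at this
      exact this.symm
    · have := h (DModAlg.ofCoact R D φ) v
      rw [RModStr.toEnd_ofCoact, RModStr.toEnd_ofCoact, coactEval_apply, coactEval_apply,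
        map_tensorSum] at this
      simp only [map_smul] at this
      rw [← this, tensorSum_tensorSum fun a b => φ a • b]
      simp only [tensorSum_tmul fun a b => φ a • b]

/-- Objects of `_H^D M` are modules over `DModAlg`. -/
noncomputable instance DCatObj.module (X : DCatObj K H R D) : Module (DModAlg R D) X.V :=
  Module.compHom X.V (X.str.toEnd X.memD).toRingHom

theorem DCatObj.smul_eq (X : DCatObj K H R D) (x : DModAlg R D) (v : X.V) :
    x • v = X.str.toEnd X.memD x v := rfl

instance DCatObj.isScalarTower (X : DCatObj K H R D) : IsScalarTower K (DModAlg R D) X.V :=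
  .of_algebraMap_smul fun c v => by
    rw [X.smul_eq, AlgHom.commutes, Module.algebraMap_end_apply]

variable [FiniteDimensional K H]

theorem DModAlg.isSemisimpleRing [IsSemisimpleRing H] (hcoss : IsCosemisimpleCoalgebra K H)
    (hR : IsQuasiTriangular K H R) : IsSemisimpleRing (DModAlg R D) := by
  rw [IsSemisimpleRing, isSemisimpleModule_iff]
  refine ⟨fun N => ?_⟩
  let f := N.subtype.restrictScalars K
  obtain ⟨p, hp⟩ := f.exists_leftInverse_of_injective
    (LinearMap.ker_eq_bot.2 (Submodule.injective_subtype N))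
  have hf : f ∈ homHD K H R (str R D N) (str R D (DModAlg R D)) := by
    rw [mem_homHD_iff_toEnd (memDCat_str R D N) (memDCat_str R D _)]
    intro x v
    rw [toEnd_str, toEnd_str]
    exact map_smul N.subtype x v
  obtain ⟨q, hq, hqf⟩ := RModStr.exists_leftInverse hcoss hR hf p hp
  rw [mem_homHD_iff_toEnd (memDCat_str R D _) (memDCat_str R D N)] at hq
  simp only [toEnd_str] at hq
  let q' : DModAlg R D →ₗ[DModAlg R D] N := ⟨⟨q, map_add q⟩, hq⟩
  exact ⟨_, LinearMap.isCompl_of_proj (f := q') fun x => LinearMap.congr_fun hqf x⟩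

/-- The functor from `_H^D M` to modules over `DModAlg`. -/
noncomputable def DCatObj.toModuleCat : DCatObj K H R D ⥤ ModuleCat.{0} (DModAlg R D) where
  obj X := ModuleCat.of _ X.V
  map {X Y} f := ModuleCat.ofHom ⟨⟨f.1, map_add f.1⟩,
    (mem_homHD_iff_toEnd X.memD Y.memD).1 f.2⟩

instance : (DCatObj.toModuleCat (R := R) (D := D)).Faithful where
  map_injective h := Subtype.ext (LinearMap.ext fun v =>
    LinearMap.congr_fun (congrArg ModuleCat.Hom.hom h) v)

instance : (DCatObj.toModuleCat (R := R) (D := D)).Full where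
  map_surjective {X Y} f := by
    refine ⟨⟨LinearMap.restrictScalars K (M := X.V) (M₂ := Y.V) (S := DModAlg R D) f.hom, ?_⟩, rfl⟩
    rw [mem_homHD_iff_toEnd X.memD Y.memD]
    exact map_smul f.hom

theorem DCatObj.nonempty_toModuleCat_iso (X : DCatObj K H R D) (M : ModuleCat.{0} (DModAlg R D))
    (e : X.V ≃+ M) (he : ∀ (x : DModAlg R D) (v : X.V), e (x • v) = x • e v) :
    Nonempty (toModuleCat.obj X ≅ M) :=
  ⟨LinearEquiv.toModuleIso (X₁ := X.V) (e.toLinearEquiv he)⟩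

instance : (DCatObj.toModuleCat (R := R) (D := D)).EssSurj where
  mem_essImage M := by
    let _ : Module K M := Module.compHom M (algebraMap K (DModAlg R D))
    have : IsScalarTower K (DModAlg R D) M := .of_algebraMap_smul fun _ _ => rfl
    let X : DCatObj K H R D := ⟨M, DModAlg.str R D M, DModAlg.memDCat_str R D M⟩
    exact ⟨X, X.nonempty_toModuleCat_iso M (AddEquiv.refl M) fun x m =>
      LinearMap.congr_fun (DModAlg.toEnd_str R D M x) m⟩

instance : (DCatObj.toModuleCat (R := R) (D := D)).IsEquivalence where

end CategoryOfModules

section CotensorHom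

open Coalgebra HopfAlgebra

variable {K : Type} [Field K] {H : Type} [Ring H] [HopfAlgebra K H] {R : H ⊗[K] H}
  {D : Submodule K H} {W : Type} [AddCommGroup W] [Module K W]
  {V : Type} [AddCommGroup V] [Module K V]

theorem dualTensorHom_assoc_rTensor {ρ : W →ₗ[K] H ⊗[K] W}
    {ρstar : (W →ₗ[K] K) →ₗ[K] (W →ₗ[K] K) ⊗[K] H} (hρ : IsDualCoaction K H ρ ρstar)
    (t : (W →ₗ[K] K) ⊗[K] V) (w : W) :
    dualTensorHom K W (H ⊗[K] V) (TensorProduct.assoc K _ H V (rTensor V ρstar t)) w =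
      lTensor H (dualTensorHom K W V t) (ρ w) := by
  induction t with
  | zero => simp
  | add x y hx hy => simp only [map_add, LinearMap.add_apply, lTensor_add, hx, hy]
  | tmul f v =>
    have h₁ (u : (W →ₗ[K] K) ⊗[K] H) :
        dualTensorHom K W (H ⊗[K] V) (TensorProduct.assoc K _ H V (u ⊗ₜ[K] v)) w =
          TensorProduct.lid K H (rTensor H (Module.Dual.eval K W w) u) ⊗ₜ[K] v := by
      induction u with
      | zero => simp
      | add x y hx hy =>
        simp only [TensorProduct.add_tmul, map_add, LinearMap.add_apply, hx, hy]
      | tmul g h => simp [TensorProduct.smul_tmul']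
    have h₂ (u : H ⊗[K] W) : lTensor H (dualTensorHom K W V (f ⊗ₜ[K] v)) u =
        TensorProduct.rid K H (lTensor H f u) ⊗ₜ[K] v := by
      induction u with
      | zero => simp
      | add x y hx hy => simp only [TensorProduct.add_tmul, map_add, hx, hy]
      | tmul h w => simp [TensorProduct.smul_tmul]
    rw [rTensor_tmul, h₁, h₂, hρ]

theorem dualTensorHom_lTensor (σ : V →ₗ[K] H ⊗[K] V) (t : (W →ₗ[K] K) ⊗[K] V) (w : W) :
    dualTensorHom K W (H ⊗[K] V) (lTensor (W →ₗ[K] K) σ t) w = σ (dualTensorHom K W V t w) := by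
  induction t with
  | zero => simp
  | add x y hx hy => simp only [map_add, LinearMap.add_apply, hx, hy]
  | tmul f v => simp

theorem mem_cotensor_iff [FiniteDimensional K W] {ρ : W →ₗ[K] H ⊗[K] W}
    {ρstar : (W →ₗ[K] K) →ₗ[K] (W →ₗ[K] K) ⊗[K] H} (hρ : IsDualCoaction K H ρ ρstar)
    {σ : V →ₗ[K] H ⊗[K] V} {t : (W →ₗ[K] K) ⊗[K] V} :
    t ∈ cotensor K H ρstar σ ↔ IsColinear ρ σ (dualTensorHom K W V t) := by
  rw [cotensor, LinearMap.mem_ker]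
  refine sub_eq_zero.trans ((dualTensorHom_bijective (R := K) (M := W)
    (N := H ⊗[K] V)).1.eq_iff.symm.trans ?_)
  rw [IsColinear, LinearMap.ext_iff, LinearMap.ext_iff]
  refine forall_congr' fun w => ?_
  rw [dualTensorHom_lTensor, LinearMap.comp_apply (lTensor H _), ← dualTensorHom_assoc_rTensor hρ]
  rfl

/-- The `H`-linear extension `h ⊗ w ↦ h · x(w)` of a linear map `x`. -/
noncomputable def extAct (act : H →ₐ[K] Module.End K V) (x : W →ₗ[K] V) : H ⊗[K] W →ₗ[K] V :=
  TensorProduct.lift act.toLinearMap ∘ₗ lTensor H x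

@[simp]
theorem extAct_tmul (act : H →ₐ[K] Module.End K V) (x : W →ₗ[K] V) (h : H) (w : W) :
    extAct act x (h ⊗ₜ w) = act h (x w) := by
  simp [extAct]

theorem extAct_comp_mk_one (act : H →ₐ[K] Module.End K V) (x : W →ₗ[K] V) :
    extAct act x ∘ₗ TensorProduct.mk K H W 1 = x :=
  LinearMap.ext fun w => by simp

theorem dualTensorHom_cmpMod (act : H →ₐ[K] Module.End K V) (x : (W →ₗ[K] K) ⊗[K] V)
    (y : (W →ₗ[K] K) ⊗[K] (H ⊗[K] W)) : dualTensorHom K W V (cmpMod K H act (x ⊗ₜ y)) =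
      extAct act (dualTensorHom K W V x) ∘ₗ dualTensorHom K W (H ⊗[K] W) y := by
  refine LinearMap.ext fun w₀ => ?_
  induction x with
  | zero => simp [extAct]
  | add x x' hx hx' =>
    simp only [TensorProduct.add_tmul, map_add, LinearMap.add_apply, hx, hx', extAct, lTensor_add,
      LinearMap.comp_add, LinearMap.add_comp]
  | tmul f v =>
    induction y with
    | zero => simp
    | add y y' hy hy' =>
      simp only [TensorProduct.tmul_add, map_add, LinearMap.add_apply, hy, hy', LinearMap.comp_add]
    | tmul g u =>
      induction u with
      | zero => simp
      | add u u' hu hu' =>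
        simp only [TensorProduct.tmul_add, map_add, LinearMap.add_apply, hu, hu',
          LinearMap.comp_add]
      | tmul h w =>
        refine Eq.trans (b := dualTensorHom K W V (f w • (g ⊗ₜ[K] act h v)) w₀) rfl ?_
        rw [map_smul, LinearMap.smul_apply, LinearMap.comp_apply, dualTensorHom_apply,
          dualTensorHom_apply, map_smul, extAct_tmul, dualTensorHom_apply, map_smul, smul_comm]

theorem dualTensorHom_coevHW [FiniteDimensional K W] :
    dualTensorHom K W (H ⊗[K] W) (coevHW K H W) = TensorProduct.mk K H W 1 := by
  refine LinearMap.ext fun w => ?_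
  have h₁ := congrArg (TensorProduct.mk K H W 1) ((Module.Basis.ofVectorSpace K W).sum_repr w)
  simp only [coevHW, coevaluation_apply_one]
  simpa using h₁

theorem IsColinear.comp {U : Type*} [AddCommGroup U] [Module K U] {Q : Type*} [AddCommGroup Q]
    [Module K Q] {ρ : U →ₗ[K] H ⊗[K] U} {σ : Q →ₗ[K] H ⊗[K] Q} {τ : V →ₗ[K] H ⊗[K] V}
    {f : Q →ₗ[K] V} {g : U →ₗ[K] Q} (hf : IsColinear σ τ f) (hg : IsColinear ρ σ g) :
    IsColinear ρ τ (f ∘ₗ g) := by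
  rw [IsColinear] at *
  rw [lTensor_comp, LinearMap.comp_assoc, hg, ← LinearMap.comp_assoc, hf, LinearMap.comp_assoc]

variable {sW : DComodStr K H R D W} {sHW : RModStr K H R (H ⊗[K] W)}
  (hact : ∀ h, sHW.act h = LinearMap.rTensor W (LinearMap.mulLeft K h))
  (hcoact : sHW.coact = rhoHW K H R sW)

theorem rhoHW_tmul (h : H) (w : W) : rhoHW K H R sW (h ⊗ₜ w) = sw K h (fun a b =>
    tensorSum (sW.coact w) fun c d => adLin K H a c ⊗ₜ[K] (b ⊗ₜ[K] d)) := by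
  rw [rhoHW]
  simp only [LinearMap.comp_apply, TensorProduct.map_tmul]
  conv_lhs => rw [← tensorSum_tmul_self (comul (R := K) h), ← tensorSum_tmul_self (sW.coact w)]
  simp only [tensorSum_tmul', tmul_tensorSum, map_tensorSum]
  rw [tensorSum_comm]
  rfl

include hcoact in
theorem memDCat_of_coact_eq_rhoHW (hD : ∀ h : H, ∀ a ∈ D, adAct K H h a ∈ D) :
    memDCat K H R D sHW := by
  intro t
  rw [hcoact]
  induction t with
  | zero => rw [map_zero]; exact Submodule.zero_mem _
  | add x y hx hy => rw [map_add]; exact Submodule.add_mem _ hx hy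
  | tmul h w =>
    rw [rhoHW_tmul]
    refine Submodule.sum_mem _ fun i _ => ?_
    exact tensorSum_mem (sW.mem w) (fun c d => adLin K H i.1 c ⊗ₜ[K] (i.2 ⊗ₜ[K] d))
      fun c hc d _ => Submodule.apply_mem_map₂ _ (hD i.1 c hc) trivial

include hcoact in
theorem isColinear_mk_one : IsColinear sW.coact sHW.coact (TensorProduct.mk K H W 1) := by
  refine isColinear_of_tmul fun w => ?_
  rw [hcoact, TensorProduct.mk_apply, rhoHW_tmul, sw_one fun a b => tensorSum (sW.coact w)
    fun c d => adLin K H a c ⊗ₜ[K] (b ⊗ₜ[K] d)]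
  simp only [adLin_one]
  rfl

variable (s : RModStr K H R V)

include hact in
theorem extAct_act (act : H →ₐ[K] Module.End K V) (x : W →ₗ[K] V) (h : H) (t : H ⊗[K] W) :
    extAct act x (sHW.act h t) = act h (extAct act x t) := by
  induction t with
  | zero => simp
  | add t t' ht ht' => simp only [map_add, ht, ht']
  | tmul g w => simp [hact]

include hact in
theorem eq_extAct_of_mem_homHD {f : H ⊗[K] W →ₗ[K] V} (hf : f ∈ homHD K H R sHW s) :
    f = extAct s.act (f ∘ₗ TensorProduct.mk K H W 1) := by
  refine TensorProduct.ext' fun h w => ?_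
  rw [extAct_tmul, LinearMap.comp_apply, (mem_homHD_iff.1 hf).1, hact]
  simp

include hact hcoact in
theorem extAct_mem_homHD {x : W →ₗ[K] V} (hx : IsColinear sW.coact s.coact x) :
    extAct s.act x ∈ homHD K H R sHW s := by
  refine mem_homHD_iff.2 ⟨fun h t => ?_, TensorProduct.ext' fun h w => ?_⟩
  · exact (extAct_act hact s.act x h t).symm
  · rw [LinearMap.comp_apply, LinearMap.comp_apply, hcoact, rhoHW_tmul, extAct_tmul, s.coact_act]
    simp only [map_tensorSum, lTensor_tmul, extAct_tmul]
    refine tensorSum_congr _ fun a b => ?_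
    rw [hx.sum_coact w fun c d => adLin K H a c ⊗ₜ[K] s.act b d]

include hact in
theorem extAct_cmpMod (x : (W →ₗ[K] K) ⊗[K] V) (y : (W →ₗ[K] K) ⊗[K] (H ⊗[K] W)) :
    extAct s.act (dualTensorHom K W V (cmpMod K H s.act (x ⊗ₜ y))) =
      extAct s.act (dualTensorHom K W V x) ∘ₗ
        extAct sHW.act (dualTensorHom K W (H ⊗[K] W) y) := by
  rw [dualTensorHom_cmpMod]
  refine TensorProduct.ext' fun h w => ?_
  rw [extAct_tmul, LinearMap.comp_apply, LinearMap.comp_apply, extAct_tmul,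
    extAct_act hact s.act]

variable [FiniteDimensional K W] {ρstar : (W →ₗ[K] K) →ₗ[K] (W →ₗ[K] K) ⊗[K] H}
  (hρstar : IsDualCoaction K H sW.coact ρstar)

include hact hcoact hρstar in
theorem cmpMod_mem_cotensor {x : (W →ₗ[K] K) ⊗[K] V} (hx : x ∈ cotensor K H ρstar s.coact)
    {y : (W →ₗ[K] K) ⊗[K] (H ⊗[K] W)} (hy : y ∈ cotensor K H ρstar sHW.coact) :
    cmpMod K H s.act (x ⊗ₜ y) ∈ cotensor K H ρstar s.coact := by
  rw [mem_cotensor_iff hρstar] at hx hy ⊢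
  rw [dualTensorHom_cmpMod]
  exact (mem_homHD_iff.1 (extAct_mem_homHD hact hcoact s hx)).2.comp hy

include hcoact hρstar in
theorem coevHW_mem_cotensor : coevHW K H W ∈ cotensor K H ρstar sHW.coact := by
  rw [mem_cotensor_iff hρstar, dualTensorHom_coevHW]
  exact isColinear_mk_one hcoact

/-- Elements of the cotensor product with `W*` correspond to morphisms out of `H ⊗ W`. -/
noncomputable def cotensorEquivHomHD :
    ↥(cotensor K H ρstar s.coact) ≃ₗ[K] ↥(homHD K H R sHW s) :=
  LinearEquiv.ofBijective
    { toFun t := ⟨extAct s.act (dualTensorHom K W V t.1),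
        extAct_mem_homHD hact hcoact s ((mem_cotensor_iff hρstar).1 t.2)⟩
      map_add' t t' := Subtype.ext (by
        simp only [Submodule.coe_add, map_add, extAct, lTensor_add, LinearMap.comp_add])
      map_smul' c t := Subtype.ext (by
        simp only [Submodule.coe_smul, map_smul, extAct, lTensor_smul, LinearMap.comp_smul,
          RingHom.id_apply]) }
    ⟨fun t t' h => Subtype.ext ((dualTensorHom_bijective (R := K)).1 (by
        rw [← extAct_comp_mk_one s.act (dualTensorHom K W V t.1),
          ← extAct_comp_mk_one s.act (dualTensorHom K W V t'.1)]
        exact congrArg (· ∘ₗ TensorProduct.mk K H W 1) (congrArg Subtype.val h))),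
      fun f => by
        obtain ⟨t, ht⟩ := (dualTensorHom_bijective (R := K)).2 (f.1 ∘ₗ TensorProduct.mk K H W 1)
        have ht' : t ∈ cotensor K H ρstar s.coact := by
          rw [mem_cotensor_iff hρstar, ht]
          exact (mem_homHD_iff.1 f.2).2.comp (isColinear_mk_one hcoact)
        refine ⟨⟨t, ht'⟩, Subtype.ext ?_⟩
        rw [eq_extAct_of_mem_homHD hact s f.2, ← ht]
        rfl⟩

end CotensorHom

section CotensorFunctor

variable {K : Type} [Field K] {H : Type} [Ring H] [HopfAlgebra K H] {R : H ⊗[K] H}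
  {D : Submodule K H} [FiniteDimensional K H]

/-- Morphisms of `_H^D M` are the linear maps over `DModAlg`. -/
noncomputable def homHDEquivLinearMap (X Y : DCatObj K H R D) :
    ↥(homHD K H R X.str Y.str) ≃+ (X.V →ₗ[DModAlg R D] Y.V) where
  toFun f := ⟨⟨f.1, map_add f.1⟩, (mem_homHD_iff_toEnd X.memD Y.memD).1 f.2⟩
  invFun g := ⟨LinearMap.restrictScalars K (M := X.V) (M₂ := Y.V) (S := DModAlg R D) g,
    (mem_homHD_iff_toEnd X.memD Y.memD).2 (map_smul g)⟩
  left_inv _ := rfl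
  right_inv _ := rfl
  map_add' _ _ := rfl

variable {W : Type} [AddCommGroup W] [Module K W] [FiniteDimensional K W]
  {sW : DComodStr K H R D W} {sHW : RModStr K H R (H ⊗[K] W)}
  {ρstar : (W →ₗ[K] K) →ₗ[K] (W →ₗ[K] K) ⊗[K] H}
  (hact : ∀ h, sHW.act h = LinearMap.rTensor W (LinearMap.mulLeft K h))
  (hcoact : sHW.coact = rhoHW K H R sW) (hmem : memDCat K H R D sHW)
  (hρstar : IsDualCoaction K H sW.coact ρstar)

/-- `H ⊗ W` as an object of `_H^D M`. -/
def freeObj : DCatObj K H R D := ⟨H ⊗[K] W, sHW, hmem⟩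

/-- Elements of the cotensor product of `W*` with an object `X` of `_H^D M` are the
`DModAlg`-linear maps from `H ⊗ W` to `X`. -/
noncomputable def cotensorEquivLinearMap (X : DCatObj K H R D) :
    ↥(cotensor K H ρstar X.str.coact) ≃+
      ((freeObj hmem).V →ₗ[DModAlg R D] X.V) :=
  (cotensorEquivHomHD hact hcoact X.str hρstar).toAddEquiv.trans
    (homHDEquivLinearMap (freeObj hmem) X)

theorem cotensorEquivLinearMap_cmpMod (X : DCatObj K H R D)
    (t : cotensor K H ρstar X.str.coact) (u : cotensor K H ρstar sHW.coact) :
    cotensorEquivLinearMap hact hcoact hmem hρstar X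
        ⟨cmpMod K H X.str.act (t.1 ⊗ₜ u.1), cmpMod_mem_cotensor hact hcoact X.str hρstar t.2 u.2⟩ =
      cotensorEquivLinearMap hact hcoact hmem hρstar X t ∘ₗ
        cotensorEquivLinearMap hact hcoact hmem hρstar (freeObj hmem) u :=
  LinearMap.ext fun v => LinearMap.congr_fun (extAct_cmpMod hact X.str t.1 u.1) v

omit [FiniteDimensional K W] in
theorem exists_linearMap_ne_zero [IsSemisimpleRing H] [Nontrivial W]
    (hR : IsQuasiTriangular K H R) (hcoss : IsCosemisimpleCoalgebra K H)
    (hD : IsMinimalAdjointStableSubcoalgebra K H R D)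
    (hact : ∀ h, sHW.act h = LinearMap.rTensor W (LinearMap.mulLeft K h))
    (hcoact : sHW.coact = rhoHW K H R sW) (X : Type) [AddCommGroup X]
    [Module (DModAlg R D) X] [Nontrivial X] :
    ∃ f : (freeObj hmem).V →ₗ[DModAlg R D] X, f ≠ 0 := by
  let _ : Module K X := Module.compHom X (algebraMap K (DModAlg R D))
  have : IsScalarTower K (DModAlg R D) X := .of_algebraMap_smul fun _ _ => rfl
  obtain ⟨x, hx, hx₀⟩ :=
    exists_isColinear_ne_zero hcoss hR hD sW (DModAlg.memDCat_str R D X)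
  have hf := (mem_homHD_iff_toEnd hmem (DModAlg.memDCat_str R D X)).1
    (extAct_mem_homHD hact hcoact _ hx)
  simp only [DModAlg.toEnd_str] at hf
  refine ⟨⟨⟨extAct _ x, map_add _⟩, hf⟩, fun h => hx₀ ?_⟩
  rw [← extAct_comp_mk_one (DModAlg.str R D X).act x]
  exact LinearMap.ext fun w => LinearMap.congr_fun h (1 ⊗ₜ w)

/-- An algebra realising the composition product on the cotensor product of `W*` with `H ⊗ W`
is the endomorphism ring of `H ⊗ W`. -/
noncomputable def ringEquivEnd {B : Type} [Ring B] [Module K B]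
    (ψ : B ≃ₗ[K] ↥(cotensor K H ρstar sHW.coact))
    (hψ : ∀ b b' : B, (ψ (b * b')).1 = cmpMod K H sHW.act ((ψ b).1 ⊗ₜ (ψ b').1)) :
    B ≃+* Module.End (DModAlg R D) (freeObj hmem).V where
  __ := ψ.toAddEquiv.trans
    (cotensorEquivLinearMap hact hcoact hmem hρstar (freeObj hmem))
  map_mul' b b' := (congrArg _ (Subtype.ext (hψ b b'))).trans
    (cotensorEquivLinearMap_cmpMod hact hcoact hmem hρstar (freeObj hmem) (ψ b) (ψ b'))

theorem ringEquivEnd_apply {B : Type} [Ring B] [Module K B]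
    (ψ : B ≃ₗ[K] ↥(cotensor K H ρstar sHW.coact))
    (hψ : ∀ b b' : B, (ψ (b * b')).1 = cmpMod K H sHW.act ((ψ b).1 ⊗ₜ (ψ b').1)) (b : B) :
    ringEquivEnd hact hcoact hmem hρstar ψ hψ b =
      cotensorEquivLinearMap hact hcoact hmem hρstar (freeObj hmem) (ψ b) := rfl

theorem coe_cotensorEquivLinearMap_symm_comp {B : Type} [Ring B] [Module K B]
    (ψ : B ≃ₗ[K] ↥(cotensor K H ρstar sHW.coact))
    (hψ : ∀ b b' : B, (ψ (b * b')).1 = cmpMod K H sHW.act ((ψ b).1 ⊗ₜ (ψ b').1))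
    (X : DCatObj K H R D) (b : B) (m : (freeObj hmem).V →ₗ[DModAlg R D] X.V) :
    ((cotensorEquivLinearMap hact hcoact hmem hρstar X).symm
      (m ∘ₗ ringEquivEnd hact hcoact hmem hρstar ψ hψ b)).1 =
      cmpMod K H X.str.act
        (((cotensorEquivLinearMap hact hcoact hmem hρstar X).symm m).1 ⊗ₜ (ψ b).1) := by
  obtain ⟨t, rfl⟩ := (cotensorEquivLinearMap hact hcoact hmem hρstar X).surjective m
  rw [AddEquiv.symm_apply_apply, ringEquivEnd_apply]
  exact congrArg Subtype.val ((AddEquiv.symm_apply_eq _).2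
    (cotensorEquivLinearMap_cmpMod hact hcoact hmem hρstar X t (ψ b)).symm)

include hact hcoact hmem hρstar in
open CategoryTheory in
theorem isSemisimpleRing_and_exists_equivalence [IsSemisimpleRing H] [Nontrivial W]
    (hR : IsQuasiTriangular K H R) (hcoss : IsCosemisimpleCoalgebra K H)
    (hD : IsMinimalAdjointStableSubcoalgebra K H R D) {B : Type} [Ring B] [Module K B]
    (ψ : B ≃ₗ[K] ↥(cotensor K H ρstar sHW.coact))
    (hψ : ∀ b b' : B, (ψ (b * b')).1 = cmpMod K H sHW.act ((ψ b).1 ⊗ₜ (ψ b').1)) :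
    IsSemisimpleRing B ∧ ∃ e : DCatObj K H R D ≌ ModuleCat.{0} Bᵐᵒᵖ, ∀ X : DCatObj K H R D,
      ∃ φ : (e.functor.obj X : Type) ≃+ ↥(cotensor K H ρstar X.str.coact),
        ∀ (b : B) (m : e.functor.obj X), (φ (MulOpposite.op b • m)).1 =
          cmpMod K H X.str.act ((φ m).1 ⊗ₜ (ψ b).1) := by
  let θ : B ≃+* Module.End (DModAlg R D) (freeObj hmem).V :=
    ringEquivEnd hact hcoact hmem hρstar ψ hψ
  have : IsSemisimpleRing (DModAlg R D) := DModAlg.isSemisimpleRing hcoss hR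
  have : Module.Finite K (freeObj hmem).V := inferInstanceAs (Module.Finite K (H ⊗[K] W))
  have : Module.Finite (DModAlg R D) (freeObj hmem).V := .of_restrictScalars_finite K _ _
  have : IsSemisimpleRing (Module.End (DModAlg R D) (freeObj hmem).V) :=
    IsSemisimpleRing.moduleEnd _ _
  have hB : IsSemisimpleRing B := θ.symm.isSemisimpleRing
  have := homFunctor_isEquivalence θ
    (fun X _ _ _ => exists_linearMap_ne_zero hmem hR hcoss hD hact hcoact X)
  refine ⟨hB, (DCatObj.toModuleCat ⋙ homFunctor θ).asEquivalence, fun X =>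
    ⟨(cotensorEquivLinearMap hact hcoact hmem hρstar X).symm, fun b m => ?_⟩⟩
  exact coe_cotensorEquivLinearMap_symm_comp hact hcoact hmem hρstar ψ hψ X b m

end CotensorFunctor

open CategoryTheory in
/-- **Statement 13.** Let `(H,R)` be a finite dimensional semisimple and cosemisimple
quasi-triangular Hopf algebra, `D` a minimal `H`-adjoint-stable subcoalgebra of `H_R`
and `W` a finite dimensional nonzero left `D`-comodule.  Then the `R`-adjoint-stable
algebra `N_W = W* □_D (H ⊗ W)` (with the composition product and unit `Σ wᵢ* ⊗ 1 ⊗ wᵢ`)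
is a semisimple `k`-algebra, and `W* □_D •` and `• ⊗_{N_W} (H ⊗ W)` establish an
equivalence between `_H^D M` and the category of right `N_W`-modules; the functor
`W* □_D •` is pinned down on objects. -/
theorem NW_semisimple_and_equivalence
    [FiniteDimensional K H] (R : H ⊗[K] H) (hR : IsQuasiTriangular K H R)
    (hss : IsSemisimpleRing H) (hcoss : IsCosemisimpleCoalgebra K H)
    (D : Submodule K H) (hD : IsMinimalAdjointStableSubcoalgebra K H R D)
    (W : Type) [AddCommGroup W] [Module K W] [FiniteDimensional K W] [Nontrivial W]
    (sW : DComodStr K H R D W)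
    (ρstar : (W →ₗ[K] K) →ₗ[K] (W →ₗ[K] K) ⊗[K] H)
    (hρstar : IsDualCoaction K H sW.coact ρstar)
    (sHW : RModStr K H R (H ⊗[K] W))
    (hHWact : ∀ h' : H,
      (sHW.act h' : H ⊗[K] W →ₗ[K] H ⊗[K] W) = LinearMap.rTensor W (LinearMap.mulLeft K h'))
    (hHWcoact : sHW.coact = rhoHW K H R sW) :
    -- `N_W = W* □_D (H ⊗ W)` is closed under the composition product and contains the unit
    (∀ x ∈ cotensor K H ρstar (rhoHW K H R sW), ∀ y ∈ cotensor K H ρstar (rhoHW K H R sW),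
        cmpMod K H sHW.act (x ⊗ₜ y) ∈ cotensor K H ρstar (rhoHW K H R sW)) ∧
    (coevHW K H W ∈ cotensor K H ρstar (rhoHW K H R sW)) ∧
    -- any `k`-algebra realizing `(N_W, ∘)` is semisimple and module-categories over it
    -- realize `_H^D M` via the functor `W* □_D •`
    (∀ (B : Type) (_ : Ring B) (_ : Algebra K B)
        (ψ : B ≃ₗ[K] ↥(cotensor K H ρstar (rhoHW K H R sW))),
        (∀ b b' : B, (ψ (b * b') : (W →ₗ[K] K) ⊗[K] (H ⊗[K] W))
            = cmpMod K H sHW.act ((ψ b : (W →ₗ[K] K) ⊗[K] (H ⊗[K] W)) ⊗ₜ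
                (ψ b' : (W →ₗ[K] K) ⊗[K] (H ⊗[K] W)))) →
        ((ψ 1 : (W →ₗ[K] K) ⊗[K] (H ⊗[K] W)) = coevHW K H W) →
        IsSemisimpleRing B ∧
        ∃ e : DCatObj K H R D ≌ ModuleCat.{0} Bᵐᵒᵖ,
          ∀ X : DCatObj K H R D,
            ∃ φ : (e.functor.obj X : Type) ≃+ ↥(cotensor K H ρstar X.str.coact),
              ∀ (b : B) (m : e.functor.obj X),
                ((φ ((MulOpposite.op b) • m) : ↥(cotensor K H ρstar X.str.coact)) :
                    (W →ₗ[K] K) ⊗[K] X.V)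
                  = cmpMod K H X.str.act
                      (((φ m : ↥(cotensor K H ρstar X.str.coact)) :
                          (W →ₗ[K] K) ⊗[K] X.V) ⊗ₜ
                        (ψ b : (W →ₗ[K] K) ⊗[K] (H ⊗[K] W)))) := by
  rw [← hHWcoact]
  have hmem := memDCat_of_coact_eq_rhoHW hHWcoact hD.2.1.1
  exact ⟨fun x hx y hy => cmpMod_mem_cotensor hHWact hHWcoact sHW hρstar hx hy,
    coevHW_mem_cotensor hHWcoact hρstar, fun B _ _ ψ hψ _ =>
      isSemisimpleRing_and_exists_equivalence hHWact hHWcoact hmem hρstar hR hcoss hD ψ hψ⟩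
end

section
/- Let G be a finite group and k a field whose characteristic does not divide |G| (so kG is semisimple and cosemisimple). For g ∈ G let C(g) = {h ∈ G : hgh⁻¹ = g} be its centralizer. For an irreducible left kC(g)-module U, the induced module M(g,U) = kG ⊗_{kC(g)} U, with kG-comodule structure ρ(x⊗u) = xgx⁻¹ ⊗ x ⊗ u for x ∈ G, u ∈ U, is an irreducible object of the Yetter-Drinfeld category _{kG}^{kG}YD. Moreover, every irreducible object of _{kG}^{kG}YD is isomorphic to some M(g,U). -/
open TensorProduct LinearMap

variable (K : Type) [Field K] (H : Type) [Ring H] [HopfAlgebra K H]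

/-- `(h ⊗ h') ⊗ a ↦ h * a * S(h')`. -/
noncomputable def sandwich : (H ⊗[K] H) ⊗[K] H →ₗ[K] H :=
  (LinearMap.mul' K H) ∘ₗ
    (LinearMap.lTensor H ((LinearMap.mul' K H) ∘ₗ
      (LinearMap.lTensor H (HopfAlgebra.antipode (R := K))) ∘ₗ
      (TensorProduct.comm K H H).toLinearMap)) ∘ₗ
    (TensorProduct.assoc K H H H).toLinearMap

/-- `h ↦ Σ (h₍₁₎ ⊗ h₍₃₎) ⊗ h₍₂₎`. -/
noncomputable def deltaYD : H →ₗ[K] (H ⊗[K] H) ⊗[K] H :=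
  (TensorProduct.assoc K H H H).symm.toLinearMap ∘ₗ
    (LinearMap.lTensor H (TensorProduct.comm K H H).toLinearMap) ∘ₗ
    (TensorProduct.assoc K H H H).toLinearMap ∘ₗ
    (LinearMap.rTensor H (Coalgebra.comul (R := K))) ∘ₗ
    (Coalgebra.comul (R := K))

/-- A left-left Yetter–Drinfeld module structure over `H` on the `K`-module `V`:
a left `H`-module structure (given by an algebra map `H → End V`), together with a
left `H`-comodule structure `ρ = coact`, satisfying the compatibility
`Σ (hv)₍₋₁₎ ⊗ (hv)₍₀₎ = Σ h₍₁₎ v₍₋₁₎ S(h₍₃₎) ⊗ h₍₂₎ v₍₀₎`. -/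
structure YDStr (V : Type*) [AddCommGroup V] [Module K V] where
  act : H →ₐ[K] Module.End K V
  coact : V →ₗ[K] H ⊗[K] V
  counit_coact : ∀ v : V,
    (TensorProduct.lid K V)
      ((LinearMap.rTensor V (Coalgebra.counit (R := K))) (coact v)) = v
  coassoc : (LinearMap.rTensor V (Coalgebra.comul (R := K))) ∘ₗ coact
      = (TensorProduct.assoc K H H V).symm.toLinearMap ∘ₗ
        (LinearMap.lTensor H coact) ∘ₗ coact
  yd : coact ∘ₗ (TensorProduct.lift act.toLinearMap)
      = (TensorProduct.map (sandwich K H) (TensorProduct.lift act.toLinearMap)) ∘ₗ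
        (TensorProduct.tensorTensorTensorComm K (H ⊗[K] H) H H V).toLinearMap ∘ₗ
        (TensorProduct.map (deltaYD K H) coact)

/-- A Yetter–Drinfeld module is irreducible if it is nonzero and has no nontrivial
subspace stable under the action and the coaction. -/
def YDIrreducible {V : Type*} [AddCommGroup V] [Module K V] (s : YDStr K H V) : Prop :=
  (⊥ : Submodule K V) ≠ ⊤ ∧
    ∀ W : Submodule K V, (∀ h : H, ∀ w ∈ W, s.act h w ∈ W) →
      (∀ w ∈ W, s.coact w ∈ Submodule.map₂ (TensorProduct.mk K H V) ⊤ W) →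
      W = ⊥ ∨ W = ⊤

/-- An isomorphism of Yetter–Drinfeld modules. -/
def YDIsomorphic {V V' : Type*} [AddCommGroup V] [Module K V] [AddCommGroup V']
    [Module K V'] (s : YDStr K H V) (s' : YDStr K H V') : Prop :=
  ∃ e : V ≃ₗ[K] V', (∀ (h : H) (v : V), e (s.act h v) = s'.act h (e v)) ∧
    (LinearMap.lTensor H e.toLinearMap) ∘ₗ s.coact = s'.coact ∘ₗ e.toLinearMap

namespace YDStr

variable {K H} {G : Type*} {V : Type*} [AddCommGroup V] [Module K V]

/-- The coefficient of the basis vector `B x` in a tensor in `H ⊗ V`. -/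
noncomputable def coeff (B : Module.Basis G K H) (x : G) : H ⊗[K] V →ₗ[K] V :=
  (TensorProduct.lid K V).toLinearMap ∘ₗ LinearMap.rTensor V (B.coord x)

/-- The projection of a Yetter–Drinfeld module onto its homogeneous component of degree `x`. -/
noncomputable def component (B : Module.Basis G K H) (s : YDStr K H V) (x : G) : V →ₗ[K] V :=
  coeff B x ∘ₗ s.coact

@[simp]
theorem coeff_tmul (B : Module.Basis G K H) (x : G) (h : H) (v : V) :
    coeff B x (h ⊗ₜ v) = B.coord x h • v := by
  simp [coeff]

theorem sum_basis_tmul_coeff [Fintype G] (B : Module.Basis G K H) (t : H ⊗[K] V) :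
    ∑ x, B x ⊗ₜ[K] coeff B x t = t := by
  induction t with
  | zero => simp
  | tmul h v =>
    simp only [coeff_tmul, TensorProduct.tmul_smul, TensorProduct.smul_tmul',
      ← TensorProduct.sum_tmul]
    congr 1
    exact B.sum_repr h
  | add t t' ht ht' =>
    simp only [map_add, TensorProduct.tmul_add, Finset.sum_add_distrib, ht, ht']

theorem coact_eq_sum [Fintype G] (B : Module.Basis G K H) (s : YDStr K H V) (v : V) :
    s.coact v = ∑ x, B x ⊗ₜ[K] s.component B x v :=
  (sum_basis_tmul_coeff B _).symm

theorem sum_component [Fintype G] (B : Module.Basis G K H)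
    (hcounit : ∀ x, Coalgebra.counit (R := K) (B x) = 1) (s : YDStr K H V) (v : V) :
    ∑ x, s.component B x v = v := by
  conv_rhs => rw [← s.counit_coact v, coact_eq_sum B]
  simp [hcounit]

theorem coact_component [Fintype G] (B : Module.Basis G K H)
    (hcomul : ∀ x, Coalgebra.comul (R := K) (B x) = B x ⊗ₜ B x) (s : YDStr K H V) (x : G) (v : V) :
    s.coact (s.component B x v) = B x ⊗ₜ s.component B x v := by
  classical
  have h := congrArg (fun f => coeff B x (TensorProduct.assoc K H H V (f v))) s.coassoc
  simp only [LinearMap.comp_apply, LinearEquiv.coe_coe, LinearEquiv.apply_symm_apply] at h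
  rw [coact_eq_sum B s v] at h
  simpa [hcomul, Finsupp.single_apply, ite_smul] using h.symm

theorem component_of_coact_eq [DecidableEq G] (B : Module.Basis G K H) (s : YDStr K H V)
    {z : G} {v : V} (hv : s.coact v = B z ⊗ₜ v) (x : G) :
    s.component B x v = if z = x then v else 0 := by
  simp [component, hv, Finsupp.single_apply]

theorem component_mem (B : Module.Basis G K H) (s : YDStr K H V) {W : Submodule K V} {v : V}
    (hv : s.coact v ∈ Submodule.map₂ (TensorProduct.mk K H V) ⊤ W) (x : G) :
    s.component B x v ∈ W := by
  suffices Submodule.map₂ (TensorProduct.mk K H V) ⊤ W ≤ W.comap (coeff B x) from this hv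
  rw [Submodule.map₂_le]
  intro h _ w hw
  simpa using W.smul_mem _ hw

theorem antipode_of_grouplike [Group G] (b : G →* H)
    (hcomul : ∀ x : G, Coalgebra.comul (R := K) (b x) = (b x) ⊗ₜ (b x))
    (hcounit : ∀ x : G, Coalgebra.counit (R := K) (b x) = 1) (x : G) :
    HopfAlgebra.antipode (R := K) (b x) = b x⁻¹ := by
  have h := HopfAlgebra.mul_antipode_rTensor_comul_apply (R := K) (b x)
  rw [hcomul, hcounit] at h
  simp only [LinearMap.rTensor_tmul, LinearMap.mul'_apply, map_one] at h
  calc _ = HopfAlgebra.antipode (R := K) (b x) * (b x * b x⁻¹) := by simp [← map_mul]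
    _ = b x⁻¹ := by rw [← mul_assoc, h, one_mul]

theorem coact_act [Group G] (b : G →* H)
    (hcomul : ∀ x : G, Coalgebra.comul (R := K) (b x) = (b x) ⊗ₜ (b x))
    (hcounit : ∀ x : G, Coalgebra.counit (R := K) (b x) = 1)
    (s : YDStr K H V) {x : G} {v : V} (hv : s.coact v = b x ⊗ₜ v) (y : G) :
    s.coact (s.act (b y) v) = b (y * x * y⁻¹) ⊗ₜ s.act (b y) v := by
  have h := LinearMap.congr_fun s.yd (b y ⊗ₜ v)
  simpa [deltaYD, sandwich, hcomul, hv, antipode_of_grouplike b hcomul hcounit, mul_assoc] using h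

/-- A subspace stable under the action of a basis of `H` is stable under `H`. -/
theorem act_mem [Fintype G] (B : Module.Basis G K H) (s : YDStr K H V) {W : Submodule K V}
    (hW : ∀ x, ∀ w ∈ W, s.act (B x) w ∈ W) (h : H) {w : V} (hw : w ∈ W) : s.act h w ∈ W := by
  rw [← B.sum_repr h]
  simp only [map_sum, map_smul, LinearMap.sum_apply, LinearMap.smul_apply]
  exact W.sum_mem fun x _ => W.smul_mem _ (hW x w hw)

end YDStr

section Induction

variable {K H} {G : Type*} [Group G] {g : G} {U : Type*} [AddCommGroup U] [Module K U]

/-- The balancing relations defining `kG ⊗_{kC(g)} U` as a quotient of `kG ⊗ U`. -/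
def balancingRelations (b : G →* H) (τ : Representation K (Subgroup.centralizer {g}) U) :
    Submodule K (H ⊗[K] U) :=
  Submodule.span K {x | ∃ (a : H) (c : Subgroup.centralizer {g}) (u : U),
    x = (a * b (c : G)) ⊗ₜ u - a ⊗ₜ (τ c u)}

@[elab_as_elim]
theorem basis_tmul_induction [Fintype G] (B : Module.Basis G K H) {p : H ⊗[K] U → Prop}
    (tmul : ∀ x u, p (B x ⊗ₜ u)) (add : ∀ t t', p t → p t' → p (t + t')) (t : H ⊗[K] U) : p t := by
  rw [← YDStr.sum_basis_tmul_coeff B t]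
  exact Finset.sum_induction _ p add (by simpa using tmul 1 0) fun x _ => tmul x _

/-- The unit `u ↦ 1 ⊗ u` of the induction is injective. -/
theorem eq_zero_of_one_tmul_mem_balancingRelations (B : Module.Basis G K H) (b : G →* H)
    (hB : ∀ x, B x = b x) (τ : Representation K (Subgroup.centralizer {g}) U) {u : U}
    (hu : (1 : H) ⊗ₜ[K] u ∈ balancingRelations b τ) : u = 0 := by
  classical
  let f : G → U →ₗ[K] U := fun x =>
    if hx : x ∈ Subgroup.centralizer {g} then τ ⟨x, hx⟩ else 0
  have hf (x : G) (c : Subgroup.centralizer {g}) (u : U) : f (x * c) u = f x (τ c u) := by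
    by_cases hx : x ∈ Subgroup.centralizer {g}
    · have hxc := mul_mem hx c.2
      simp only [f, dif_pos hx, dif_pos hxc, ← Module.End.mul_apply, ← map_mul]
      rfl
    · have hxc : x * c ∉ Subgroup.centralizer {g} := by
        rwa [Subgroup.mul_mem_cancel_right _ c.2]
      simp [f, hx, hxc]
  let ψ : H ⊗[K] U →ₗ[K] U := TensorProduct.lift (B.constr K f)
  have hψ : balancingRelations b τ ≤ LinearMap.ker ψ := by
    rw [balancingRelations, Submodule.span_le]
    rintro _ ⟨a, c, u, rfl⟩
    have : (B.constr K f).flip u ∘ₗ LinearMap.mulRight K (b c) = (B.constr K f).flip (τ c u) := by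
      refine B.ext fun x => ?_
      simp [hB x, ← map_mul]
      simp [← hB, hf]
    simpa [ψ, sub_eq_zero] using LinearMap.congr_fun this a
  have h := hψ hu
  have h1 : (1 : H) = B 1 := by simp [hB]
  have hf1 : f 1 = 1 := by
    simp only [f, dif_pos (one_mem _)]
    exact map_one τ
  simpa [ψ, h1, hf1] using h

end Induction

section Classification

universe v

variable {K H} {G : Type*} [Group G] [Fintype G]

theorem induced_irreducible {g : G} {U V : Type*} [AddCommGroup U] [Module K U]
    [AddCommGroup V] [Module K V] (B : Module.Basis G K H) (b : G →* H) (hB : ∀ x, B x = b x)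
    (hcounit : ∀ x, Coalgebra.counit (R := K) (B x) = 1)
    (τ : Representation K (Subgroup.centralizer {g}) U) (hU : Nontrivial U)
    (hτ : ∀ W : Submodule K U, (∀ c, ∀ u ∈ W, τ c u ∈ W) → W = ⊥ ∨ W = ⊤)
    (s : YDStr K H V) (π : H ⊗[K] U →ₗ[K] V) (hsurj : Function.Surjective π)
    (hker : LinearMap.ker π = balancingRelations b τ)
    (hact : ∀ h t, s.act h (π t) = π (LinearMap.rTensor U (LinearMap.mulLeft K h) t))
    (hcoact : ∀ (x : G) (u : U),
      s.coact (π (b x ⊗ₜ u)) = b (x * g * x⁻¹) ⊗ₜ π (b x ⊗ₜ u)) :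
    YDIrreducible K H s := by
  classical
  have hinj (u : U) (hu : π (1 ⊗ₜ u) = 0) : u = 0 :=
    eq_zero_of_one_tmul_mem_balancingRelations B b hB τ (hker ▸ LinearMap.mem_ker.2 hu)
  have hbal (a : H) (c : Subgroup.centralizer {g}) (u : U) :
      π ((a * b c) ⊗ₜ u) = π (a ⊗ₜ τ c u) := by
    rw [← sub_eq_zero, ← map_sub, ← LinearMap.mem_ker, hker]
    exact Submodule.subset_span ⟨a, c, u, rfl⟩
  have hcomp (x y : G) (u : U) : s.component B x (π (b y ⊗ₜ u)) =
      if y * g * y⁻¹ = x then π (b y ⊗ₜ u) else 0 :=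
    s.component_of_coact_eq B (by rw [hcoact, hB]) x
  have hconj (y : G) (t : H ⊗[K] U) :
      ∃ u, s.component B (y * g * y⁻¹) (π t) = π (b y ⊗ₜ u) := by
    induction t using basis_tmul_induction B with
    | tmul z u =>
      rw [hB, hcomp]
      split_ifs with h
      · have hc : y⁻¹ * z ∈ Subgroup.centralizer {g} := by
          rw [Subgroup.mem_centralizer_singleton_iff]
          have : z * g = y * g * y⁻¹ * z := by rw [← h]; group
          simp [mul_assoc, this]
        refine ⟨τ ⟨_, hc⟩ u, ?_⟩
        rw [← hbal, ← map_mul, mul_inv_cancel_left]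
      · exact ⟨0, by simp⟩
    | add t t' ht ht' =>
      obtain ⟨u, hu⟩ := ht
      obtain ⟨u', hu'⟩ := ht'
      exact ⟨u + u', by simp [hu, hu', TensorProduct.tmul_add]⟩
  have hnonconj (x : G) (hx : ∀ y, y * g * y⁻¹ ≠ x) (t : H ⊗[K] U) :
      s.component B x (π t) = 0 := by
    induction t using basis_tmul_induction B with
    | tmul z u => rw [hB, hcomp, if_neg (hx z)]
    | add t t' ht ht' => simp [ht, ht']
  refine ⟨fun h => ?_, fun W hWact hWco => or_iff_not_imp_left.2 fun hW => ?_⟩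
  · obtain ⟨u, hu⟩ := exists_ne (0 : U)
    exact hu (hinj u ((Submodule.mem_bot K).1 (h ▸ Submodule.mem_top)))
  · let ι : U →ₗ[K] V := π ∘ₗ TensorProduct.mk K H U 1
    have hbot : W.comap ι ≠ ⊥ := by
      intro hbot
      refine hW ((Submodule.eq_bot_iff W).2 fun w hw => ?_)
      rw [← s.sum_component B hcounit w]
      refine Finset.sum_eq_zero fun x _ => ?_
      have hmem := s.component_mem B (hWco w hw) x
      obtain ⟨t, rfl⟩ := hsurj w
      by_cases hx : ∀ y, y * g * y⁻¹ ≠ x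
      · exact hnonconj x hx t
      · push Not at hx
        obtain ⟨y, rfl⟩ := hx
        obtain ⟨u, hu⟩ := hconj y t
        rw [hu] at hmem ⊢
        have hu0 : u ∈ W.comap ι := by
          have := hWact (b y⁻¹) _ hmem
          rwa [hact, LinearMap.rTensor_tmul, LinearMap.mulLeft_apply, ← map_mul, inv_mul_cancel,
            map_one] at this
        rw [hbot, Submodule.mem_bot] at hu0
        simp [hu0]
    have htop : W.comap ι = ⊤ := by
      refine (hτ _ fun c u hu => ?_).resolve_left hbot
      have := hWact (b c) _ hu
      simp only [ι, LinearMap.comp_apply, TensorProduct.mk_apply, hact, LinearMap.rTensor_tmul,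
        LinearMap.mulLeft_apply, mul_one] at this
      simpa [ι, ← hbal] using this
    refine (Submodule.eq_top_iff').2 fun v => ?_
    obtain ⟨t, rfl⟩ := hsurj v
    induction t with
    | zero => simp
    | add t t' ht ht' => rw [map_add]; exact W.add_mem ht ht'
    | tmul a u =>
      have hu : u ∈ W.comap ι := htop ▸ Submodule.mem_top
      simpa [ι, hact] using hWact a _ hu

theorem exists_induced {V : Type v} [AddCommGroup V] [Module K V]
    (B : Module.Basis G K H) (b : G →* H) (hB : ∀ x, B x = b x)
    (hcomul : ∀ x, Coalgebra.comul (R := K) (B x) = B x ⊗ₜ B x)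
    (hcounit : ∀ x, Coalgebra.counit (R := K) (B x) = 1)
    (s : YDStr K H V) (hs : YDIrreducible K H s) :
    ∃ (g : G) (U : Type v) (_ : AddCommGroup U) (_ : Module K U)
      (τ : Representation K (Subgroup.centralizer {g}) U),
      (Nontrivial U ∧ ∀ W : Submodule K U,
        (∀ c : Subgroup.centralizer {g}, ∀ u ∈ W, τ c u ∈ W) → W = ⊥ ∨ W = ⊤) ∧
      ∃ π : H ⊗[K] U →ₗ[K] V,
        Function.Surjective π ∧
        LinearMap.ker π = balancingRelations b τ ∧
        (∀ h : H, (s.act h : V →ₗ[K] V) ∘ₗ π =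
            π ∘ₗ (LinearMap.rTensor U (LinearMap.mulLeft K h))) ∧
        (∀ (x : G) (u : U), s.coact (π (b x ⊗ₜ u)) =
          (b (x * g * x⁻¹)) ⊗ₜ π (b x ⊗ₜ u)) := by
  classical
  have hcoact_act {x : G} {v : V} (hv : s.coact v = b x ⊗ₜ v) (y : G) :=
    s.coact_act b (fun x => by simp only [← hB, hcomul]) (fun x => by rw [← hB, hcounit]) hv y
  -- a nonzero homogeneous component
  obtain ⟨v, hv⟩ : ∃ v : V, v ≠ 0 := by
    by_contra! h
    exact hs.1 ((Submodule.eq_bot_iff _).2 fun v _ => h v).symm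
  obtain ⟨g, hg⟩ : ∃ g, s.component B g v ≠ 0 := by
    by_contra! h
    exact hv (by rw [← s.sum_component B hcounit v]; simp [h])
  let U : Submodule K V := LinearMap.eqLocus s.coact (TensorProduct.mk K H V (b g))
  have hU (u : U) : s.coact u = b g ⊗ₜ (u : V) := u.2
  have hcompU (w : V) : s.component B g w ∈ U := by
    change s.coact _ = b g ⊗ₜ _
    rw [s.coact_component B hcomul, hB]
  have hcent (c : G) (hc : c ∈ Subgroup.centralizer {g}) : c * g * c⁻¹ = g := by
    rw [Subgroup.mem_centralizer_singleton_iff] at hc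
    rw [hc, mul_inv_cancel_right]
  have hcompact (x : G) (u : U) : s.component B g (s.act (b x) u) =
      if x ∈ Subgroup.centralizer {g} then s.act (b x) u else 0 := by
    rw [s.component_of_coact_eq B (z := x * g * x⁻¹) (by rw [hcoact_act (hU u), hB]) g]
    refine if_congr ?_ rfl rfl
    rw [Subgroup.mem_centralizer_singleton_iff, mul_inv_eq_iff_eq_mul]
  let τ : Representation K (Subgroup.centralizer {g}) U :=
    { toFun := fun c => (s.act (b c)).restrict (p := U) (q := U) fun u hu => by
        change s.coact _ = b g ⊗ₜ _
        rw [hcoact_act (x := g) hu, hcent c c.2]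
      map_one' := by ext; simp
      map_mul' := fun c d => by ext; simp }
  have hτ (c : Subgroup.centralizer {g}) (u : U) : (τ c u : V) = s.act (b c) u := rfl
  let π : H ⊗[K] U →ₗ[K] V := TensorProduct.lift (s.act.toLinearMap.compl₂ U.subtype)
  have hπ (a : H) (u : U) : π (a ⊗ₜ u) = s.act a u := rfl
  -- the Yetter–Drinfeld submodule generated by a subspace of `U`
  have hgen (W : Submodule K U) :
      W = ⊥ ∨ ⨆ x, (W.map U.subtype).map (s.act (b x)) = ⊤ := by
    refine (hs.2 (⨆ x, (W.map U.subtype).map (s.act (b x))) (fun h v hv =>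
      s.act_mem B (fun y v hv => ?_) h hv) (fun v hv => ?_)).imp_left fun hbot => ?_
    · suffices ⨆ x, (W.map U.subtype).map (s.act (b x)) ≤
          (⨆ x, (W.map U.subtype).map (s.act (b x))).comap (s.act (B y)) from this hv
      refine iSup_le fun x => Submodule.map_le_iff_le_comap.2 fun u hu => ?_
      rw [Submodule.mem_comap, Submodule.mem_comap, ← Module.End.mul_apply, ← map_mul, hB,
        ← map_mul]
      exact Submodule.mem_iSup_of_mem (y * x) (Submodule.mem_map_of_mem hu)
    · suffices ⨆ x, (W.map U.subtype).map (s.act (b x)) ≤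
          (Submodule.map₂ (TensorProduct.mk K H V) ⊤
            (⨆ x, (W.map U.subtype).map (s.act (b x)))).comap s.coact from this hv
      refine iSup_le fun x => Submodule.map_le_iff_le_comap.2 ?_
      rintro _ ⟨u, hu, rfl⟩
      rw [Submodule.mem_comap, Submodule.mem_comap, Submodule.coe_subtype, hcoact_act (hU u)]
      exact Submodule.apply_mem_map₂ _ Submodule.mem_top
        (Submodule.mem_iSup_of_mem x (Submodule.mem_map_of_mem (Submodule.mem_map_of_mem hu)))
    · refine (Submodule.eq_bot_iff W).2 fun w hw => ?_
      have hmem : (w : V) ∈ ⨆ x, (W.map U.subtype).map (s.act (b x)) :=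
        Submodule.mem_iSup_of_mem 1 ⟨w, Submodule.mem_map_of_mem hw, by simp⟩
      rw [hbot, Submodule.mem_bot] at hmem
      exact Subtype.ext hmem
  have hUnontrivial : Nontrivial U := ⟨⟨_, hcompU v⟩, 0, fun h => hg (congrArg Subtype.val h)⟩
  have hπsurj : Function.Surjective π := by
    rw [← LinearMap.range_eq_top, eq_top_iff, ← (hgen ⊤).resolve_left top_ne_bot]
    refine iSup_le fun x => Submodule.map_le_iff_le_comap.2 ?_
    rintro _ ⟨u, -, rfl⟩
    exact ⟨b x ⊗ₜ u, hπ _ _⟩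
  refine ⟨g, U, inferInstance, inferInstance, τ, ⟨hUnontrivial, fun W hW => ?_⟩, π, hπsurj, ?_, ?_, ?_⟩
  · refine (hgen W).imp_right fun htop => ?_
    have hle : ⨆ x, (W.map U.subtype).map (s.act (b x)) ≤
        (W.map U.subtype).comap (s.component B g) := by
      refine iSup_le fun x => Submodule.map_le_iff_le_comap.2 ?_
      rintro _ ⟨u, hu, rfl⟩
      rw [Submodule.mem_comap, Submodule.mem_comap, Submodule.coe_subtype, hcompact]
      split_ifs with hx
      · exact ⟨τ ⟨x, hx⟩ u, hW ⟨x, hx⟩ u hu, rfl⟩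
      · exact zero_mem _
    refine (Submodule.eq_top_iff').2 fun u => ?_
    have hu : (u : V) ∈ (W.map U.subtype).comap (s.component B g) :=
      hle (htop ▸ Submodule.mem_top)
    have hu1 : s.component B g u = u := by simpa [one_mem] using hcompact 1 u
    rw [Submodule.mem_comap, hu1] at hu
    obtain ⟨w, hw, hwu⟩ := hu
    rwa [← Subtype.ext hwu]
  · refine le_antisymm (fun t ht => ?_) ?_
    · let P : V →ₗ[K] U := (s.component B g).codRestrict U hcompU
      let θ : V →ₗ[K] H ⊗[K] U := ∑ q : G ⧸ Subgroup.centralizer {g},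
        TensorProduct.mk K H U (b q.out) ∘ₗ P ∘ₗ s.act (b q.out⁻¹)
      have hP (x : G) (u : U) : P (s.act (b x) u) =
          if hx : x ∈ Subgroup.centralizer {g} then τ ⟨x, hx⟩ u else 0 := by
        refine Subtype.ext ((hcompact x u).trans ?_)
        split_ifs <;> rfl
      have hθ (y : G) (u : U) : b y ⊗ₜ u - θ (π (b y ⊗ₜ u)) ∈ balancingRelations b τ := by
        have hact (x : G) : s.act (b x) (s.act (b y) u) = s.act (b (x * y)) u := by
          simp [map_mul]
        have hmem : (y : G ⧸ Subgroup.centralizer {g}).out⁻¹ * y ∈ Subgroup.centralizer {g} :=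
          QuotientGroup.eq.1 (QuotientGroup.out_eq' _)
        have hsum : θ (π (b y ⊗ₜ u)) =
            b (y : G ⧸ Subgroup.centralizer {g}).out ⊗ₜ τ ⟨_, hmem⟩ u := by
          simp only [θ, hπ, LinearMap.sum_apply, LinearMap.comp_apply, hact, hP]
          rw [Finset.sum_eq_single (y : G ⧸ Subgroup.centralizer {g})]
          · rw [dif_pos hmem]; rfl
          · intro q _ hq
            rw [dif_neg, map_zero]
            intro hmem
            exact hq ((QuotientGroup.out_eq' q).symm.trans (QuotientGroup.eq.2 hmem))
          · simp
        rw [hsum]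
        refine Submodule.subset_span ⟨b (y : G ⧸ Subgroup.centralizer {g}).out, ⟨_, hmem⟩, u, ?_⟩
        rw [← map_mul, mul_inv_cancel_left]
      have hθ' (t : H ⊗[K] U) : t - θ (π t) ∈ balancingRelations b τ := by
        refine basis_tmul_induction B (p := fun t => t - θ (π t) ∈ balancingRelations b τ)
          (fun y u => ?_) (fun t t' ht ht' => ?_) t
        · rw [hB]; exact hθ y u
        · rw [map_add, map_add, add_sub_add_comm]
          exact add_mem ht ht'
      simpa [LinearMap.mem_ker.1 ht] using hθ' t
    · rw [balancingRelations, Submodule.span_le]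
      rintro _ ⟨a, c, u, rfl⟩
      simp [hπ, hτ]
  · intro h
    ext a u
    simp [hπ]
  · intro x u
    rw [hπ, hcoact_act (hU u)]

end Classification

/-- **Statement 16.** Let `G` be a finite group and `k` a field with `char k ∤ |G|`, and
let `H = kG` be the group algebra with its standard Hopf algebra structure: `H` has a
basis `(b x)_{x ∈ G}` of grouplike elements with `b : G →* H` multiplicative.  For
`g ∈ G`, `C(g)` its centralizer and `U` an irreducible left `kC(g)`-module, the induced
module `M(g,U) = kG ⊗_{kC(g)} U` (presented as a quotient of `kG ⊗_k U` by the
balancing relations), with kG-action by left multiplication on the first factor and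
comodule structure `ρ(x ⊗ u) = xgx⁻¹ ⊗ x ⊗ u`, is an irreducible Yetter–Drinfeld
module; and every irreducible object of `_{kG}^{kG}YD` is isomorphic to some `M(g,U)`. -/
theorem group_algebra_yd_classification
    (G : Type*) [Group G] [Fintype G] (hchar : (Fintype.card G : K) ≠ 0)
    (b : G →* H)
    (hcomul : ∀ x : G, Coalgebra.comul (R := K) (b x) = (b x) ⊗ₜ (b x))
    (hcounit : ∀ x : G, Coalgebra.counit (R := K) (b x) = 1)
    (hbasis : Function.Bijective (Finsupp.linearCombination K (fun x : G => b x))) :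
    -- (1) every induced module `M(g,U)` with `U` irreducible is an irreducible
    -- Yetter–Drinfeld module
    (∀ (g : G) (U : Type) [AddCommGroup U] [Module K U]
        (τ : Representation K (Subgroup.centralizer {g}) U),
        (Nontrivial U ∧ ∀ W : Submodule K U,
            (∀ c : Subgroup.centralizer {g}, ∀ u ∈ W, τ c u ∈ W) → W = ⊥ ∨ W = ⊤) →
        ∀ (V : Type) [AddCommGroup V] [Module K V]
          (s : YDStr K H V) (π : H ⊗[K] U →ₗ[K] V),
          Function.Surjective π →
          LinearMap.ker π = Submodule.span K
            {x | ∃ (a : H) (c : Subgroup.centralizer {g}) (u : U),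
              x = (a * b (c : G)) ⊗ₜ u - a ⊗ₜ (τ c u)} →
          (∀ h : H,
            (s.act h : V →ₗ[K] V) ∘ₗ π = π ∘ₗ (LinearMap.rTensor U (LinearMap.mulLeft K h))) →
          (∀ (x : G) (u : U), s.coact (π (b x ⊗ₜ u)) =
            (b (x * g * x⁻¹)) ⊗ₜ π (b x ⊗ₜ u)) →
          YDIrreducible K H s) ∧
    -- (2) every irreducible Yetter–Drinfeld module over `kG` arises this way
    (∀ (V : Type) [AddCommGroup V] [Module K V] (s : YDStr K H V),
        YDIrreducible K H s →
        ∃ (g : G) (U : Type) (_ : AddCommGroup U) (_ : Module K U)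
          (τ : Representation K (Subgroup.centralizer {g}) U),
          (Nontrivial U ∧ ∀ W : Submodule K U,
            (∀ c : Subgroup.centralizer {g}, ∀ u ∈ W, τ c u ∈ W) → W = ⊥ ∨ W = ⊤) ∧
          ∃ π : H ⊗[K] U →ₗ[K] V,
            Function.Surjective π ∧
            LinearMap.ker π = Submodule.span K
              {x | ∃ (a : H) (c : Subgroup.centralizer {g}) (u : U),
                x = (a * b (c : G)) ⊗ₜ u - a ⊗ₜ (τ c u)} ∧
            (∀ h : H, (s.act h : V →ₗ[K] V) ∘ₗ π =
                π ∘ₗ (LinearMap.rTensor U (LinearMap.mulLeft K h))) ∧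
            (∀ (x : G) (u : U), s.coact (π (b x ⊗ₜ u)) =
              (b (x * g * x⁻¹)) ⊗ₜ π (b x ⊗ₜ u))) := by
  classical
  obtain ⟨B, hB⟩ : ∃ B : Module.Basis G K H, ∀ x, B x = b x :=
    ⟨Module.Basis.ofRepr (LinearEquiv.ofBijective _ hbasis).symm, fun x => by simp⟩
  have hcomulB : ∀ x, Coalgebra.comul (R := K) (B x) = B x ⊗ₜ B x := fun x => by
    rw [hB, hcomul]
  have hcounitB : ∀ x, Coalgebra.counit (R := K) (B x) = 1 := fun x => by rw [hB, hcounit]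
  exact ⟨fun g U _ _ τ hτ V _ _ s π hsurj hker hact hcoact =>
      induced_irreducible B b hB hcounitB τ hτ.1 hτ.2 s π hsurj hker
        (fun h t => LinearMap.congr_fun (hact h) t) hcoact,
    fun V _ _ s hs => exists_induced B b hB hcomulB hcounitB s hs⟩
end
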